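/- arXiv:2201.08107 — 3 statements merged into one kernel-verified Lean document; each statement's English description precedes it below -/
import Mathlib

section
/- For every real α with −3/2^{1/3} < α < 0, the planar system ẋ = y, ẏ = −x³ + αx²y + y³ has at most one limit cycle: any two nonconstant periodic solutions of the system have the same image in ℝ². -/
/-- `(x,y)` is a solution of `ẋ = y`, `ẏ = -x³ + αx²y + y³`. -/
def IsSolXY (α : ℝ) (x y : ℝ → ℝ) : Prop :=
  ∀ t : ℝ, HasDerivAt x (y t) t ∧
    HasDerivAt y (-(x t) ^ 3 + α * (x t) ^ 2 * y t + (y t) ^ 3) t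

/-- `(x,y)` is periodic with some positive period. -/
def IsPeriodicSol (x y : ℝ → ℝ) : Prop :=
  ∃ T : ℝ, 0 < T ∧ ∀ t : ℝ, x (t + T) = x t ∧ y (t + T) = y t

/-- `(x,y)` is nonconstant. -/
def NonconstSol (x y : ℝ → ℝ) : Prop := ∃ t s : ℝ, (x t, y t) ≠ (x s, y s)

open Set MeasureTheory Filter Topology

/-- Parameters of the field `Y dY/dX = q` and of the Dulac weight `B = exp (-ψ) * V ^ (-σ)`. -/
structure DulacData where
  e : ℝ
  a : ℝ
  b : ℝ
  K : ℝ
  μ : ℝ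
  σ : ℝ

namespace DulacData

variable (p : DulacData)

noncomputable def q (X Y : ℝ) : ℝ := -X ^ 3 + p.e * (Y ^ 3 - X ^ 2 * Y)

noncomputable def V (X Y : ℝ) : ℝ := Y ^ 2 / 2 + X ^ 4 / 4 + p.a * X ^ 3 * Y + p.b * X ^ 2 * Y ^ 2

noncomputable def VX (X Y : ℝ) : ℝ := X ^ 3 + 3 * p.a * X ^ 2 * Y + 2 * p.b * X * Y ^ 2

noncomputable def VY (X Y : ℝ) : ℝ := Y + p.a * X ^ 3 + 2 * p.b * X ^ 2 * Y

noncomputable def ψ (X : ℝ) : ℝ := p.K / 2 * (X ^ 2 - p.μ * (Real.log (X ^ 2 + p.μ) - Real.log p.μ))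

noncomputable def dψ (X : ℝ) : ℝ := p.K * X ^ 3 / (X ^ 2 + p.μ)

noncomputable def B (X Y : ℝ) : ℝ := Real.exp (-p.ψ X - p.σ * Real.log (p.V X Y))

noncomputable def BX (X Y : ℝ) : ℝ := p.B X Y * (-p.dψ X - p.σ * p.VX X Y / p.V X Y)

noncomputable def BY (X Y : ℝ) : ℝ := p.B X Y * (- p.σ * p.VY X Y / p.V X Y)

noncomputable def D (X Y : ℝ) : ℝ :=
  (p.e * (3 * Y ^ 2 - X ^ 2) - Y * p.dψ X) * p.V X Y - p.σ * (p.q X Y * p.VY X Y + Y * p.VX X Y)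

/-- The form `V` is positive on the closed quadrant minus the origin. -/
structure Good : Prop where
  hμ : 0 < p.μ
  pos : ∀ X Y : ℝ, 0 ≤ X → 0 ≤ Y → 0 < X + Y → 0 < p.V X Y

variable {p}

theorem hasDerivAt_ψ (hμ : 0 < p.μ) (X : ℝ) : HasDerivAt p.ψ (p.dψ X) X := by
  have h0 : X ^ 2 + p.μ ≠ 0 := by positivity
  have h1 : HasDerivAt (fun X : ℝ => X ^ 2) (2 * X) X := by simpa using hasDerivAt_pow 2 X
  have h2 := ((h1.sub ((((h1.add_const p.μ).log h0).sub_const (Real.log p.μ)).const_mul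
    p.μ))).const_mul (p.K / 2)
  refine h2.congr_deriv ?_
  unfold dψ
  field_simp
  ring

theorem hasDerivAt_B (hp : p.Good) {X : ℝ} {y : ℝ → ℝ} {y' : ℝ} (hX : 0 ≤ X) (hy0 : 0 ≤ y X)
    (hpos : 0 < X + y X) (hy : HasDerivAt y y' X) :
    HasDerivAt (fun X => p.B X (y X)) (p.BX X (y X) + y' * p.BY X (y X)) X := by
  have hV := hp.pos X (y X) hX hy0 hpos
  have hVd : HasDerivAt (fun X => p.V X (y X)) (p.VX X (y X) + y' * p.VY X (y X)) X := by
    have h1 := hasDerivAt_id X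
    have := ((((hy.pow 2).div_const 2).add ((h1.pow 4).div_const 4)).add
      (((h1.pow 3).const_mul p.a).mul hy)).add (((h1.pow 2).const_mul p.b).mul (hy.pow 2))
    refine this.congr_deriv ?_
    simp [VX, VY]
    ring
  have h : HasDerivAt (fun X => -p.ψ X - p.σ * Real.log (p.V X (y X))) _ X :=
    (hasDerivAt_ψ hp.hμ X).neg.sub ((hVd.log hV.ne').const_mul p.σ)
  refine h.exp.congr_deriv ?_
  simp only [BX, BY, B]
  field_simp
  ring

theorem hasDerivAt_B_right (hp : p.Good) {X Y : ℝ} (hX : 0 ≤ X) (hY : 0 ≤ Y) (h : 0 < X + Y) :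
    HasDerivAt (fun Y => p.B X Y) (p.BY X Y) Y := by
  have hV := hp.pos X Y hX hY h
  have hVd : HasDerivAt (fun Y => p.V X Y) (p.VY X Y) Y := by
    have h1 := hasDerivAt_id Y
    have := ((((h1.pow 2).div_const 2).add_const (X ^ 4 / 4)).add
      (h1.const_mul (p.a * X ^ 3))).add ((h1.pow 2).const_mul (p.b * X ^ 2))
    refine this.congr_deriv ?_
    simp [VY]
    ring
  have h : HasDerivAt (fun Y => -p.ψ X - p.σ * Real.log (p.V X Y)) _ Y :=
    (hasDerivAt_const Y (-p.ψ X)).sub ((hVd.log hV.ne').const_mul p.σ)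
  refine h.exp.congr_deriv ?_
  simp only [BY, B]
  field_simp
  ring

theorem continuousOn_B (hp : p.Good) :
    ContinuousOn (fun z : ℝ × ℝ => p.B z.1 z.2) {z | 0 ≤ z.1 ∧ 0 ≤ z.2 ∧ 0 < z.1 + z.2} := by
  have hψ : Continuous p.ψ := continuous_iff_continuousAt.2 fun X =>
    (hasDerivAt_ψ hp.hμ X).continuousAt
  have hV : Continuous fun z : ℝ × ℝ => p.V z.1 z.2 := by unfold V; fun_prop
  unfold B
  refine Real.continuous_exp.comp_continuousOn (ContinuousOn.sub (by fun_prop) ?_)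
  exact continuousOn_const.mul (hV.continuousOn.log fun z hz => (hp.pos _ _ hz.1 hz.2.1 hz.2.2).ne')

theorem continuousOn_BX (hp : p.Good) :
    ContinuousOn (fun z : ℝ × ℝ => p.BX z.1 z.2) {z | 0 ≤ z.1 ∧ 0 ≤ z.2 ∧ 0 < z.1 + z.2} := by
  have hψ : Continuous fun z : ℝ × ℝ => p.dψ z.1 := by
    unfold dψ
    refine Continuous.div (by fun_prop) (by fun_prop) fun z => ?_
    have := hp.hμ
    positivity
  have hV : Continuous fun z : ℝ × ℝ => p.V z.1 z.2 := by unfold V; fun_prop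
  have hVX : Continuous fun z : ℝ × ℝ => p.VX z.1 z.2 := by unfold VX; fun_prop
  unfold BX
  refine (continuousOn_B hp).mul (hψ.neg.continuousOn.sub ?_)
  exact (continuousOn_const.mul hVX.continuousOn).div hV.continuousOn
    fun z hz => (hp.pos _ _ hz.1 hz.2.1 hz.2.2).ne'

theorem continuousOn_BY (hp : p.Good) :
    ContinuousOn (fun z : ℝ × ℝ => p.BY z.1 z.2) {z | 0 ≤ z.1 ∧ 0 ≤ z.2 ∧ 0 < z.1 + z.2} := by
  have hV : Continuous fun z : ℝ × ℝ => p.V z.1 z.2 := by unfold V; fun_prop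
  have hVX : Continuous fun z : ℝ × ℝ => p.VY z.1 z.2 := by unfold VY; fun_prop
  unfold BY
  refine (continuousOn_B hp).mul ?_
  exact (continuousOn_const.mul hVX.continuousOn).div hV.continuousOn
    fun z hz => (hp.pos _ _ hz.1 hz.2.1 hz.2.2).ne'

/-- The `X`-derivative, along a solution of `Y dY/dX = q`, of the weighted area below the graph. -/
noncomputable def Φ (p : DulacData) (X Y : ℝ) : ℝ :=
  p.q X Y * p.B X Y + ∫ ζ in (0 : ℝ)..Y, ζ * p.BX X ζ

theorem hasDerivAt_Φ (hp : p.Good) {X Y : ℝ} (hX : 0 < X) (hY : 0 < Y) :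
    HasDerivAt (p.Φ X) (p.B X Y / p.V X Y * p.D X Y) Y := by
  have hc : ContinuousOn (fun ζ => ζ * p.BX X ζ) (Ici 0) := by
    refine continuousOn_id.mul ((continuousOn_BX hp).comp (f := fun ζ => (X, ζ)) (by fun_prop) ?_)
    intro ζ hζ
    have : (0 : ℝ) ≤ ζ := hζ
    exact ⟨hX.le, this, by positivity⟩
  have h1 : HasDerivAt (fun Y => ∫ ζ in (0 : ℝ)..Y, ζ * p.BX X ζ) (Y * p.BX X Y) Y := by
    apply intervalIntegral.integral_hasDerivAt_right
    · refine (hc.mono ?_).intervalIntegrable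
      rw [uIcc_of_le hY.le]
      exact Icc_subset_Ici_self
    · exact (hc.mono Ioi_subset_Ici_self).stronglyMeasurableAtFilter isOpen_Ioi Y hY
    · exact hc.continuousAt (Ici_mem_nhds hY)
  have hq : HasDerivAt (fun Y => p.q X Y) (p.e * (3 * Y ^ 2 - X ^ 2)) Y := by
    have h1 := hasDerivAt_id Y
    have := (((h1.pow 3).sub (h1.const_mul (X ^ 2))).const_mul p.e).const_add (-X ^ 3)
    refine this.congr_deriv ?_
    simp
  have hV := hp.pos X Y hX.le hY.le (by positivity)
  refine ((hq.mul (hasDerivAt_B_right hp hX.le hY.le (by positivity))).add h1).congr_deriv ?_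
  simp only [D, BX, BY]
  field_simp
  ring

theorem continuousOn_Φ (hp : p.Good) {X : ℝ} (hX : 0 < X) : ContinuousOn (p.Φ X) (Ici 0) := by
  have hc : ContinuousOn (fun ζ => ζ * p.BX X ζ) (Ici 0) := by
    refine continuousOn_id.mul ((continuousOn_BX hp).comp (f := fun ζ => (X, ζ)) (by fun_prop) ?_)
    intro ζ hζ
    have : (0 : ℝ) ≤ ζ := hζ
    exact ⟨hX.le, this, by positivity⟩
  refine ContinuousOn.add ?_ ?_
  · refine ContinuousOn.mul (by unfold q; fun_prop) ?_
    refine ((continuousOn_B hp).comp (f := fun ζ => (X, ζ)) (by fun_prop) ?_)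
    intro ζ hζ
    have : (0 : ℝ) ≤ ζ := hζ
    exact ⟨hX.le, this, by positivity⟩
  · have h2 : Continuous fun ζ : ℝ => max ζ 0 * p.BX X (max ζ 0) := by
      refine (hc.comp_continuous (f := fun ζ : ℝ => max ζ 0) (by fun_prop) fun ζ => ?_)
      exact le_max_right ζ 0
    have h3 : Continuous fun Y => ∫ ζ in (0 : ℝ)..Y, max ζ 0 * p.BX X (max ζ 0) :=
      intervalIntegral.continuous_primitive (fun a b => h2.intervalIntegrable a b) 0
    refine h3.continuousOn.congr fun Y hY => ?_
    refine intervalIntegral.integral_congr fun ζ hζ => ?_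
    rw [uIcc_of_le hY] at hζ
    simp [max_eq_left hζ.1]

theorem Φ_mono (hp : p.Good) {X : ℝ} (hX : 0 < X) (hD : ∀ Y, 0 < Y → 0 ≤ p.D X Y) :
    MonotoneOn (p.Φ X) (Ici 0) := by
  refine monotoneOn_of_deriv_nonneg (convex_Ici 0) (continuousOn_Φ hp hX) ?_ ?_
  · intro Y hY
    rw [interior_Ici] at hY
    exact (hasDerivAt_Φ hp hX hY).differentiableAt.differentiableWithinAt
  · intro Y hY
    rw [interior_Ici] at hY
    have hY : 0 < Y := hY
    rw [(hasDerivAt_Φ hp hX hY).deriv]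
    exact mul_nonneg (div_nonneg (Real.exp_pos _).le (hp.pos X Y hX.le hY.le (by positivity)).le)
      (hD Y hY)

theorem Φ_anti (hp : p.Good) {X : ℝ} (hX : 0 < X) (hD : ∀ Y, 0 < Y → p.D X Y ≤ 0) :
    AntitoneOn (p.Φ X) (Ici 0) := by
  refine antitoneOn_of_deriv_nonpos (convex_Ici 0) (continuousOn_Φ hp hX) ?_ ?_
  · intro Y hY
    rw [interior_Ici] at hY
    exact (hasDerivAt_Φ hp hX hY).differentiableAt.differentiableWithinAt
  · intro Y hY
    rw [interior_Ici] at hY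
    have hY : 0 < Y := hY
    rw [(hasDerivAt_Φ hp hX hY).deriv]
    exact mul_nonpos_of_nonneg_of_nonpos
      (div_nonneg (Real.exp_pos _).le (hp.pos X Y hX.le hY.le (by positivity)).le) (hD Y hY)

/-- The weighted area below the graph of `y`. -/
noncomputable def H (p : DulacData) (X Y : ℝ) : ℝ := ∫ ζ in (0 : ℝ)..Y, ζ * p.B X ζ

theorem scaled_integral (f : ℝ → ℝ) (Y : ℝ) :
    ∫ ζ in (0 : ℝ)..Y, ζ * f ζ = ∫ s in (0 : ℝ)..1, Y ^ 2 * s * f (Y * s) := by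
  have := intervalIntegral.smul_integral_comp_mul_left (a := 0) (b := 1) (fun ζ => ζ * f ζ) Y
  rw [mul_zero, mul_one] at this
  rw [← this, smul_eq_mul, ← intervalIntegral.integral_const_mul]
  congr 1
  ext s
  ring

theorem hasDerivAt_H (hp : p.Good) {R : ℝ} {y : ℝ → ℝ} (hy0 : ∀ X ∈ Ioo 0 R, 0 < y X)
    (hy : ∀ X ∈ Ioo 0 R, HasDerivAt y (p.q X (y X) / y X) X) {X : ℝ} (hX : X ∈ Ioo 0 R) :
    HasDerivAt (fun X => p.H X (y X)) (p.Φ X (y X)) X := by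
  have hyc : ContinuousOn y (Ioo 0 R) := fun X hX => (hy X hX).continuousAt.continuousWithinAt
  set F' : ℝ → ℝ → ℝ := fun X s => 2 * p.q X (y X) * s * p.B X (y X * s) +
    y X ^ 2 * s * (p.BX X (y X * s) + (p.q X (y X) / y X * s) * p.BY X (y X * s)) with hF'
  have hmaps : MapsTo (fun z : ℝ × ℝ => (z.1, y z.1 * z.2)) (Ioo 0 R ×ˢ Icc 0 1)
      {z | 0 ≤ z.1 ∧ 0 ≤ z.2 ∧ 0 < z.1 + z.2} := by
    rintro ⟨X, s⟩ ⟨h1, h2⟩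
    have h3 : 0 ≤ y X * s := mul_nonneg (hy0 X h1).le h2.1
    exact ⟨h1.1.le, h3, add_pos_of_pos_of_nonneg h1.1 h3⟩
  have hyc' : ContinuousOn (fun z : ℝ × ℝ => y z.1) (Ioo 0 R ×ˢ Icc (0 : ℝ) 1) :=
    hyc.comp continuousOn_fst fun z hz => hz.1
  have hcm : ContinuousOn (fun z : ℝ × ℝ => (z.1, y z.1 * z.2)) (Ioo 0 R ×ˢ Icc (0 : ℝ) 1) :=
    continuousOn_fst.prodMk (hyc'.mul continuousOn_snd)
  have hqc : ContinuousOn (fun z : ℝ × ℝ => p.q z.1 (y z.1)) (Ioo 0 R ×ˢ Icc (0 : ℝ) 1) := by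
    have : Continuous fun z : ℝ × ℝ => p.q z.1 z.2 := by unfold q; fun_prop
    exact this.comp_continuousOn (continuousOn_fst.prodMk hyc')
  have hBc := (continuousOn_B hp).comp hcm hmaps
  have hBXc := (continuousOn_BX hp).comp hcm hmaps
  have hBYc := (continuousOn_BY hp).comp hcm hmaps
  have hFc : ContinuousOn (fun z : ℝ × ℝ => y z.1 ^ 2 * z.2 * p.B z.1 (y z.1 * z.2))
      (Ioo 0 R ×ˢ Icc (0 : ℝ) 1) := ((hyc'.pow 2).mul continuousOn_snd).mul hBc
  have hF'c : ContinuousOn (fun z : ℝ × ℝ => F' z.1 z.2) (Ioo 0 R ×ˢ Icc (0 : ℝ) 1) := by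
    refine (((continuousOn_const.mul hqc).mul continuousOn_snd).mul hBc).add
      (((hyc'.pow 2).mul continuousOn_snd).mul (hBXc.add (((hqc.div hyc' ?_).mul
        continuousOn_snd).mul hBYc)))
    exact fun z hz => (hy0 _ hz.1).ne'
  have slice : ∀ {G : ℝ × ℝ → ℝ}, ContinuousOn G (Ioo 0 R ×ˢ Icc (0 : ℝ) 1) → ∀ X ∈ Ioo 0 R,
      ContinuousOn (fun s => G (X, s)) (uIcc 0 1) := by
    intro G hG X hX
    rw [uIcc_of_le zero_le_one]
    exact hG.comp (by fun_prop) fun s hs => ⟨hX, hs⟩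
  have hsub : uIoc (0 : ℝ) 1 ⊆ uIcc 0 1 := uIoc_subset_uIcc
  obtain ⟨ε, hε, hεs⟩ : ∃ ε > 0, Icc (X - ε) (X + ε) ⊆ Ioo 0 R := by
    obtain ⟨ε, hε, h⟩ := Metric.nhds_basis_closedBall.mem_iff.1 (Ioo_mem_nhds hX.1 hX.2)
    exact ⟨ε, hε, by rwa [Real.closedBall_eq_Icc] at h⟩
  obtain ⟨C, hC⟩ :=
    (isCompact_Icc.prod (isCompact_Icc (a := (0 : ℝ)) (b := 1))).exists_bound_of_continuousOn
    (hF'c.mono (prod_mono hεs subset_rfl))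
  have key := intervalIntegral.hasDerivAt_integral_of_dominated_loc_of_deriv_le
    (μ := volume) (a := 0) (b := 1)
    (F := fun X s => y X ^ 2 * s * p.B X (y X * s)) (F' := F') (x₀ := X)
    (s := Icc (X - ε) (X + ε)) (bound := fun _ => C) (Icc_mem_nhds (by linarith) (by linarith))
    (by
      filter_upwards [Ioo_mem_nhds hX.1 hX.2] with X' hX'
      exact ((slice hFc X' hX').mono hsub).aestronglyMeasurable measurableSet_uIoc)
    (slice hFc X hX).intervalIntegrable
    (((slice hF'c X hX).mono hsub).aestronglyMeasurable measurableSet_uIoc)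
    (by
      refine Eventually.of_forall fun s hs X' hX' => hC (X', s) ⟨hX', ?_⟩
      have := hsub hs
      rwa [uIcc_of_le zero_le_one] at this)
    intervalIntegrable_const
    (by
      refine Eventually.of_forall fun s hs X' hX' => ?_
      have hs' := hsub hs
      rw [uIcc_of_le zero_le_one] at hs'
      have hXR := hεs hX'
      have h0 := hmaps (show (X', s) ∈ Ioo 0 R ×ˢ Icc 0 1 from ⟨hXR, hs'⟩)
      have hys := (hy X' hXR).mul_const s
      have := (((hy X' hXR).pow 2).mul_const s).mul
        (hasDerivAt_B hp (y := fun X => y X * s) h0.1 h0.2.1 h0.2.2 hys)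
      refine this.congr_deriv ?_
      have := (hy0 X' hXR).ne'
      simp only [hF', Pi.pow_apply]
      field_simp
      push_cast
      ring)
  have h2 := key.2
  simp only [H, scaled_integral]
  refine h2.congr_deriv ?_
  have hq : ∀ s ∈ uIcc (0 : ℝ) 1, HasDerivAt (fun s => s ^ 2 * p.q X (y X) * p.B X (y X * s))
      (F' X s - y X ^ 2 * s * p.BX X (y X * s)) s := by
    intro s hs
    rw [uIcc_of_le zero_le_one] at hs
    have h0 := hmaps (show (X, s) ∈ Ioo 0 R ×ˢ Icc 0 1 from ⟨hX, hs⟩)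
    have h1 : HasDerivAt (fun Y => p.B X Y) (p.BY X (y X * s)) (y X * s) :=
      hasDerivAt_B_right hp h0.1 h0.2.1 h0.2.2
    have h3 : HasDerivAt (fun s => y X * s) (y X * 1) s := (hasDerivAt_id s).const_mul (y X)
    have h5 : HasDerivAt (fun s => p.B X (y X * s)) (p.BY X (y X * s) * (y X * 1)) s :=
      h1.comp s h3
    have h4 := ((hasDerivAt_pow 2 s).mul_const (p.q X (y X))).mul h5
    refine h4.congr_deriv ?_
    have := (hy0 X hX).ne'
    simp only [hF']
    field_simp
    push_cast
    ring
  have hbx : ContinuousOn (fun z : ℝ × ℝ => y z.1 ^ 2 * z.2 * p.BX z.1 (y z.1 * z.2))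
      (Ioo 0 R ×ˢ Icc (0 : ℝ) 1) := ((hyc'.pow 2).mul continuousOn_snd).mul hBXc
  have hi := intervalIntegral.integral_eq_sub_of_hasDerivAt hq
    (((slice hF'c X hX).sub (slice hbx X hX)).intervalIntegrable)
  rw [intervalIntegral.integral_sub key.1 (slice hbx X hX).intervalIntegrable] at hi
  rw [Φ, scaled_integral]
  simp at hi
  linarith

theorem continuousOn_mul_B (hp : p.Good) :
    ContinuousOn (fun z : ℝ × ℝ => z.2 * p.B z.1 z.2) {z | 0 ≤ z.1 ∧ 0 ≤ z.2 ∧ 0 < z.1 + z.2} :=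
  continuousOn_snd.mul (continuousOn_B hp)

theorem continuousWithinAt_area (hp : p.Good) {S : Set ℝ} {X c d : ℝ} {y z : ℝ → ℝ}
    (hX : X ∈ S) (hc : 0 ≤ c) (hd : 0 ≤ d) (hcd : 0 < c + d)
    (hy : ContinuousWithinAt y S X) (hz : ContinuousWithinAt z S X)
    (h : ∀ᶠ x in 𝓝[S] X, c ≤ x ∧ d ≤ y x ∧ d ≤ z x) :
    ContinuousWithinAt (fun X => ∫ ζ in y X..z X, ζ * p.B X ζ) S X := by
  set G : ℝ → ℝ → ℝ := fun X ζ => max ζ d * p.B (max X c) (max ζ d) with hG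
  have hGc : Continuous G.uncurry := by
    refine (continuousOn_mul_B hp).comp_continuous
      (f := fun w : ℝ × ℝ => (max w.1 c, max w.2 d)) (by fun_prop) ?_
    intro w
    have h1 := le_max_right w.1 c
    have h2 := le_max_right w.2 d
    exact ⟨hc.trans h1, hd.trans h2, by simp only; linarith⟩
  have hP : Continuous fun w : ℝ × ℝ => ∫ ζ in (0 : ℝ)..w.2, G w.1 ζ :=
    intervalIntegral.continuous_parametric_primitive_of_continuous hGc
  have h1 : ContinuousWithinAt (fun X => (∫ ζ in (0 : ℝ)..z X, G X ζ) - ∫ ζ in (0 : ℝ)..y X, G X ζ)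
      S X :=
    (hP.continuousAt.comp_continuousWithinAt (continuousWithinAt_id.prodMk hz)).sub
      (hP.continuousAt.comp_continuousWithinAt (continuousWithinAt_id.prodMk hy))
  have heq : ∀ x, c ≤ x ∧ d ≤ y x ∧ d ≤ z x → (∫ ζ in y x..z x, ζ * p.B x ζ) =
      (∫ ζ in (0 : ℝ)..z x, G x ζ) - ∫ ζ in (0 : ℝ)..y x, G x ζ := by
    rintro x ⟨h1, h2, h3⟩
    have hx : Continuous (G x) := hGc.comp (Continuous.prodMk_right x)
    rw [intervalIntegral.integral_interval_sub_left (hx.intervalIntegrable _ _)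
      (hx.intervalIntegrable _ _)]
    refine intervalIntegral.integral_congr fun ζ hζ => ?_
    have : d ≤ ζ := (le_min h2 h3).trans hζ.1
    simp only [hG, max_eq_left this, max_eq_left h1]
  refine h1.congr_of_eventuallyEq (h.mono heq) (heq X (h.self_of_nhdsWithin hX))

theorem area_eq (hp : p.Good) {X y z : ℝ} (hX : 0 < X) (hy : 0 ≤ y) (hz : 0 ≤ z) :
    ∫ ζ in y..z, ζ * p.B X ζ = p.H X z - p.H X y := by
  have h : ∀ Y, 0 ≤ Y → IntervalIntegrable (fun ζ => ζ * p.B X ζ) volume 0 Y := by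
    intro Y hY
    refine ContinuousOn.intervalIntegrable ?_
    refine (continuousOn_mul_B hp).comp (f := fun ζ => (X, ζ)) (by fun_prop) fun ζ hζ => ?_
    rw [uIcc_of_le hY] at hζ
    exact ⟨hX.le, hζ.1, by simp only; linarith [hζ.1]⟩
  rw [H, H, intervalIntegral.integral_interval_sub_left (h z hz) (h y hy)]

end DulacData

namespace DulacData

theorem ψ_lt {p p' : DulacData} (hμ : 0 < p.μ) (h : p'.μ = p.μ) (hK : p.K < p'.K) {X : ℝ}
    (hX : 0 < X) : p.ψ X < p'.ψ X := by
  unfold ψ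
  rw [h]
  have h1 : Real.log (X ^ 2 + p.μ) - Real.log p.μ < X ^ 2 / p.μ := by
    rw [← Real.log_div (by positivity) hμ.ne']
    have : (X ^ 2 + p.μ) / p.μ ≠ 1 := by
      rw [Ne, div_eq_one_iff_eq hμ.ne']
      have : 0 < X ^ 2 := by positivity
      linarith
    have h2 := Real.log_lt_sub_one_of_pos (by positivity) this
    have h3 : (X ^ 2 + p.μ) / p.μ - 1 = X ^ 2 / p.μ := by field_simp; ring
    linarith
  have h2 : p.μ * (Real.log (X ^ 2 + p.μ) - Real.log p.μ) < X ^ 2 := by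
    rwa [lt_div_iff₀ hμ, mul_comm] at h1
  have : 0 < X ^ 2 - p.μ * (Real.log (X ^ 2 + p.μ) - Real.log p.μ) := by linarith
  have := mul_lt_mul_of_pos_right hK this
  linarith

/-- A Dulac-type argument: two nested closed curves made of orbit arcs of the left and right fields
cannot coexist when the weighted divergences have constant sign. -/
theorem dulac {l r : DulacData} (hl : l.Good) (hr : r.Good) (hμ : r.μ = l.μ) (hσ : r.σ = l.σ)
    (hK : l.K < r.K) {R₁ R₂ : ℝ} (hR₁ : 0 < R₁) (hR : R₁ < R₂)
    (hlD : ∀ X ∈ Ioo 0 R₂, ∀ Y, 0 < Y → l.D X Y ≤ 0)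
    (hrD : ∀ X ∈ Ioo 0 R₂, ∀ Y, 0 < Y → 0 ≤ r.D X Y)
    {u₁ u₂ v₁ v₂ : ℝ → ℝ} (hu₁ : Continuous u₁) (hu₂ : Continuous u₂) (hv₁ : Continuous v₁)
    (hv₂ : Continuous v₂)
    (pu₁ : ∀ X ∈ Ico 0 R₁, 0 < u₁ X) (pv₁ : ∀ X ∈ Ico 0 R₁, 0 < v₁ X)
    (pu₂ : ∀ X ∈ Ico 0 R₂, 0 < u₂ X) (pv₂ : ∀ X ∈ Ico 0 R₂, 0 < v₂ X)
    (zu₁ : ∀ X, R₁ ≤ X → u₁ X = 0) (zv₁ : ∀ X, R₁ ≤ X → v₁ X = 0)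
    (zu₂ : u₂ R₂ = 0) (zv₂ : v₂ R₂ = 0)
    (du₁ : ∀ X ∈ Ioo 0 R₁, HasDerivAt u₁ (l.q X (u₁ X) / u₁ X) X)
    (dv₁ : ∀ X ∈ Ioo 0 R₁, HasDerivAt v₁ (r.q X (v₁ X) / v₁ X) X)
    (du₂ : ∀ X ∈ Ioo 0 R₂, HasDerivAt u₂ (l.q X (u₂ X) / u₂ X) X)
    (dv₂ : ∀ X ∈ Ioo 0 R₂, HasDerivAt v₂ (r.q X (v₂ X) / v₂ X) X)
    (huv₁ : u₁ 0 = v₁ 0) (huv₂ : u₂ 0 = v₂ 0)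
    (hu : ∀ X ∈ Ico 0 R₁, u₁ X ≤ u₂ X) (hv : ∀ X ∈ Ico 0 R₁, v₁ X ≤ v₂ X) : False := by
  have nu₁ : ∀ X, 0 ≤ X → 0 ≤ u₁ X := fun X hX => (lt_or_ge X R₁).elim
    (fun h => (pu₁ X ⟨hX, h⟩).le) fun h => (zu₁ X h).ge
  have nv₁ : ∀ X, 0 ≤ X → 0 ≤ v₁ X := fun X hX => (lt_or_ge X R₁).elim
    (fun h => (pv₁ X ⟨hX, h⟩).le) fun h => (zv₁ X h).ge
  have nu₂ : ∀ X ∈ Icc 0 R₂, 0 ≤ u₂ X := fun X hX => hX.2.lt_or_eq.elim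
    (fun h => (pu₂ X ⟨hX.1, h⟩).le) fun h => by rw [h, zu₂]
  have nv₂ : ∀ X ∈ Icc 0 R₂, 0 ≤ v₂ X := fun X hX => hX.2.lt_or_eq.elim
    (fun h => (pv₂ X ⟨hX.1, h⟩).le) fun h => by rw [h, zv₂]
  set J : ℝ → ℝ := fun X => (∫ ζ in u₁ X..u₂ X, ζ * l.B X ζ) - ∫ ζ in v₁ X..v₂ X, ζ * r.B X ζ
    with hJ
  have area_cont : ∀ {p : DulacData}, p.Good → ∀ {y z : ℝ → ℝ}, Continuous y → Continuous z →
      (∀ X ∈ Icc 0 R₂, 0 ≤ y X) → (∀ X ∈ Icc 0 R₂, 0 ≤ z X) → 0 < y 0 → 0 < z 0 →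
      ContinuousOn (fun X => ∫ ζ in y X..z X, ζ * p.B X ζ) (Icc 0 R₂) := by
    intro p hp y z hy hz ny nz hy0 hz0 X hX
    rcases hX.1.eq_or_lt with h | h
    · subst h
      have hm : 0 < min (y 0) (z 0) := lt_min hy0 hz0
      refine continuousWithinAt_area hp hX le_rfl (d := min (y 0) (z 0) / 2) (by positivity)
        (by linarith) hy.continuousWithinAt hz.continuousWithinAt ?_
      have h1 : ∀ᶠ x in 𝓝 0, min (y 0) (z 0) / 2 < y x := hy.continuousAt.eventually_const_lt
        (by linarith [min_le_left (y 0) (z 0)])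
      have h2 : ∀ᶠ x in 𝓝 0, min (y 0) (z 0) / 2 < z x := hz.continuousAt.eventually_const_lt
        (by linarith [min_le_right (y 0) (z 0)])
      filter_upwards [mem_nhdsWithin_of_mem_nhds h1, mem_nhdsWithin_of_mem_nhds h2,
        self_mem_nhdsWithin] with x h1 h2 h3
      exact ⟨h3.1, h1.le, h2.le⟩
    · refine continuousWithinAt_area hp hX (c := X / 2) (by positivity) le_rfl
        (by linarith) hy.continuousWithinAt hz.continuousWithinAt ?_
      filter_upwards [mem_nhdsWithin_of_mem_nhds (Ioi_mem_nhds (half_lt_self h)),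
        self_mem_nhdsWithin] with x h1 h2
      exact ⟨le_of_lt h1, ny x h2, nz x h2⟩
  have hR₂ : 0 < R₂ := hR₁.trans hR
  have hJc : ContinuousOn J (Icc 0 R₂) :=
    (area_cont hl hu₁ hu₂ (fun X hX => nu₁ X hX.1) nu₂ (pu₁ 0 ⟨le_rfl, hR₁⟩)
      (pu₂ 0 ⟨le_rfl, hR₂⟩)).sub
    (area_cont hr hv₁ hv₂ (fun X hX => nv₁ X hX.1) nv₂ (pv₁ 0 ⟨le_rfl, hR₁⟩)
      (pv₂ 0 ⟨le_rfl, hR₂⟩))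
  have hJeq : ∀ X ∈ Ioo 0 R₂, J X = (l.H X (u₂ X) - l.H X (u₁ X)) -
      (r.H X (v₂ X) - r.H X (v₁ X)) := by
    intro X hX
    have hX' : X ∈ Icc 0 R₂ := Ioo_subset_Icc_self hX
    simp only [hJ]
    rw [area_eq hl hX.1 (nu₁ X hX.1.le) (nu₂ X hX'), area_eq hr hX.1 (nv₁ X hX.1.le) (nv₂ X hX')]
  have hJ0 : J 0 = 0 := by
    have : ∀ ζ, l.B 0 ζ = r.B 0 ζ := by
      intro ζ
      simp [B, ψ, V, hμ, hσ]
    simp [hJ, huv₁, huv₂, this]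
  have hJR : J R₂ = 0 := by
    simp [hJ, zu₂, zv₂, zu₁ R₂ hR.le, zv₁ R₂ hR.le]
  have hd₁ : ∀ X ∈ Ioo 0 R₁, HasDerivAt J ((l.Φ X (u₂ X) - l.Φ X (u₁ X)) -
      (r.Φ X (v₂ X) - r.Φ X (v₁ X))) X := by
    intro X hX
    have hX2 : X ∈ Ioo 0 R₂ := ⟨hX.1, hX.2.trans hR⟩
    refine HasDerivAt.congr_of_eventuallyEq ?_ (eventually_of_mem (Ioo_mem_nhds hX2.1 hX2.2) hJeq)
    exact ((hasDerivAt_H hl (fun X hX => pu₂ X (Ioo_subset_Ico_self hX)) du₂ hX2).sub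
      (hasDerivAt_H hl (fun X hX => pu₁ X (Ioo_subset_Ico_self hX)) du₁ hX)).sub
      ((hasDerivAt_H hr (fun X hX => pv₂ X (Ioo_subset_Ico_self hX)) dv₂ hX2).sub
      (hasDerivAt_H hr (fun X hX => pv₁ X (Ioo_subset_Ico_self hX)) dv₁ hX))
  have hd₂ : ∀ X ∈ Ioo R₁ R₂, HasDerivAt J (l.Φ X (u₂ X) - r.Φ X (v₂ X)) X := by
    intro X hX
    have hX2 : X ∈ Ioo 0 R₂ := ⟨hR₁.trans hX.1, hX.2⟩
    have h1 : J =ᶠ[𝓝 X] fun X => l.H X (u₂ X) - r.H X (v₂ X) := by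
      filter_upwards [Ioo_mem_nhds hX.1 hX.2] with x hx
      rw [hJeq x ⟨hR₁.trans hx.1, hx.2⟩, zu₁ x hx.1.le, zv₁ x hx.1.le]
      simp [H]
    refine HasDerivAt.congr_of_eventuallyEq ?_ h1
    exact (hasDerivAt_H hl (fun X hX => pu₂ X (Ioo_subset_Ico_self hX)) du₂ hX2).sub
      (hasDerivAt_H hr (fun X hX => pv₂ X (Ioo_subset_Ico_self hX)) dv₂ hX2)
  have ha₁ : AntitoneOn J (Icc 0 R₁) := by
    refine antitoneOn_of_deriv_nonpos (convex_Icc _ _) (hJc.mono (Icc_subset_Icc_right hR.le)) ?_ ?_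
    · intro X hX
      rw [interior_Icc] at hX
      exact (hd₁ X hX).differentiableAt.differentiableWithinAt
    · intro X hX
      rw [interior_Icc] at hX
      rw [(hd₁ X hX).deriv]
      have hX2 : X ∈ Ioo 0 R₂ := ⟨hX.1, hX.2.trans hR⟩
      have h0 := Ioo_subset_Ico_self hX
      have h1 := Φ_anti hl hX.1 (hlD X hX2) (pu₁ X h0).le (nu₂ X (Ioo_subset_Icc_self hX2))
        (hu X h0)
      have h2 := Φ_mono hr hX.1 (hrD X hX2) (pv₁ X h0).le (nv₂ X (Ioo_subset_Icc_self hX2))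
        (hv X h0)
      linarith
  have ha₂ : StrictAntiOn J (Icc R₁ R₂) := by
    refine strictAntiOn_of_deriv_neg (convex_Icc _ _) (hJc.mono (Icc_subset_Icc_left hR₁.le)) ?_
    intro X hX
    rw [interior_Icc] at hX
    rw [(hd₂ X hX).deriv]
    have hX0 : 0 < X := hR₁.trans hX.1
    have hX2 : X ∈ Ioo 0 R₂ := ⟨hX0, hX.2⟩
    have h1 := Φ_anti hl hX0 (hlD X hX2) self_mem_Ici (nu₂ X (Ioo_subset_Icc_self hX2))
      (nu₂ X (Ioo_subset_Icc_self hX2))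
    have h2 := Φ_mono hr hX0 (hrD X hX2) self_mem_Ici (nv₂ X (Ioo_subset_Icc_self hX2))
      (nv₂ X (Ioo_subset_Icc_self hX2))
    have h3 : l.Φ X 0 = -X ^ 3 * l.B X 0 := by simp [Φ, q]
    have h4 : r.Φ X 0 = -X ^ 3 * r.B X 0 := by simp [Φ, q]
    have h5 : r.B X 0 < l.B X 0 := by
      have := ψ_lt hl.hμ hμ hK hX0
      simp only [B, V, hσ]
      apply Real.exp_lt_exp.2
      simp
      linarith
    have h6 : 0 < X ^ 3 := by positivity
    nlinarith [mul_pos h6 (sub_pos.2 h5)]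
  have h1 := ha₁ (left_mem_Icc.2 hR₁.le) (right_mem_Icc.2 hR₁.le) hR₁.le
  have h2 := ha₂ (left_mem_Icc.2 hR.le) (right_mem_Icc.2 hR.le) hR
  linarith

end DulacData

namespace DulacData

/-- Weights in the scaled coordinates; `s = 1` for the left half-plane, `s = -1` for the right. -/
noncomputable def weight (s k μ P g σ E : ℝ) : DulacData where
  e := -s * E
  a := E * P
  b := E * g
  K := k * E
  μ := μ
  σ := σ

noncomputable def coeffA (s P g σ t : ℝ) : ℝ :=
  σ * (1 + 3 * s * P) - 1 / 2 + 2 * σ * s * g * t + (3 / 2 - σ) * t ^ 2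

noncomputable def coeffγ (P g E t : ℝ) : ℝ := 1 / 4 + E * (P * t + g * t ^ 2)

noncomputable def coeffβ (s P g σ E t : ℝ) : ℝ :=
  -σ * (P + 2 * g * t) * (s + E * (t ^ 3 - t)) + (3 * t ^ 2 - 1) * coeffγ P g E t

noncomputable def coeffC₁ (s k μ P g σ E t : ℝ) : ℝ :=
  t ^ 2 * coeffA s P g σ t + s * k * t ^ 3 / 2 + μ * coeffβ s P g σ E t

noncomputable def coeffC₂ (s k P g σ E t : ℝ) : ℝ :=
  coeffβ s P g σ E t + s * k * t * coeffγ P g E t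

/-- The quadratic form in `Z = X ^ 2`, with `t = Y / X`, that controls the sign of `D`. -/
noncomputable def quadForm (s k μ P g σ E t Z : ℝ) : ℝ :=
  t ^ 2 * (μ * coeffA s P g σ t) + coeffC₁ s k μ P g σ E t * Z + coeffC₂ s k P g σ E t * Z ^ 2

theorem D_weight {s k μ P g σ E X t : ℝ} (hs : s ^ 2 = 1) (hμ : 0 < μ) :
    (weight s k μ P g σ E).D X (t * X) * (X ^ 2 + μ) =
      -s * (E * X ^ 4 * quadForm s k μ P g σ E t (X ^ 2)) := by
  have h : X ^ 2 + μ ≠ 0 := by positivity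
  simp only [D, dψ, q, V, VX, VY, weight, quadForm, coeffA, coeffγ, coeffβ, coeffC₁, coeffC₂]
  field_simp
  ring_nf
  simp only [hs]
  ring

theorem D_left {k μ P g σ E X Y : ℝ} (hμ : 0 < μ) (hE : 0 ≤ E) (hX : 0 < X)
    (h : 0 ≤ quadForm 1 k μ P g σ E (Y / X) (X ^ 2)) :
    (weight 1 k μ P g σ E).D X Y ≤ 0 := by
  have h1 := D_weight (s := 1) (k := k) (P := P) (g := g) (σ := σ) (E := E) (X := X) (t := Y / X)
    (by norm_num) hμ
  rw [div_mul_cancel₀ _ hX.ne'] at h1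
  have h2 : 0 < X ^ 2 + μ := by positivity
  have h3 : 0 ≤ E * X ^ 4 * quadForm 1 k μ P g σ E (Y / X) (X ^ 2) := by positivity
  by_contra! h4
  linarith [mul_pos h4 h2]

theorem D_right {k μ P g σ E X Y : ℝ} (hμ : 0 < μ) (hE : 0 ≤ E) (hX : 0 < X)
    (h : 0 ≤ quadForm (-1) k μ P g σ E (Y / X) (X ^ 2)) :
    0 ≤ (weight (-1) k μ P g σ E).D X Y := by
  have h1 := D_weight (s := -1) (k := k) (P := P) (g := g) (σ := σ) (E := E) (X := X) (t := Y / X)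
    (by norm_num) hμ
  rw [div_mul_cancel₀ _ hX.ne'] at h1
  have h2 : 0 < X ^ 2 + μ := by positivity
  have h3 : 0 ≤ E * X ^ 4 * quadForm (-1) k μ P g σ E (Y / X) (X ^ 2) := by positivity
  by_contra! h4
  linarith [mul_neg_of_neg_of_pos h4 h2]

theorem good_weight {s k μ P g σ E : ℝ} (hμ : 0 < μ) (hE : 0 ≤ E) (hg : 0 ≤ g)
    (h : 0 ≤ P ∨ E * P ^ 2 ≤ g) : (weight s k μ P g σ E).Good := by
  refine ⟨hμ, fun X Y hX hY hXY => ?_⟩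
  simp only [V, weight]
  have hpos : 0 < Y ^ 2 / 2 + X ^ 4 / 4 := by
    rcases hX.eq_or_lt with h0 | h0
    · have : 0 < Y := by linarith
      positivity
    · positivity
  rcases h with h | h
  · have : 0 ≤ E * P * X ^ 3 * Y + E * g * X ^ 2 * Y ^ 2 := by positivity
    linarith
  · rcases hX.eq_or_lt with h0 | h0
    · subst h0
      simpa using hpos
    · rcases hY.eq_or_lt with h1 | h1
      · subst h1
        simpa using hpos
      · have h2 : 0 ≤ E * (g - E * P ^ 2) * X ^ 2 * Y ^ 2 :=
          mul_nonneg (mul_nonneg (mul_nonneg hE (by linarith)) (by positivity)) (by positivity)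
        nlinarith [sq_nonneg (X ^ 2 / 2 + E * P * X * Y), pow_pos h1 2]

theorem quad_nonneg_of_coeff {t a b c Z M : ℝ} (hZ : 0 ≤ Z) (hM : Z ≤ M) (ha : 0 ≤ a) (hb : 0 ≤ b)
    (hc : 0 ≤ b + M * c) : 0 ≤ t ^ 2 * a + b * Z + c * Z ^ 2 := by
  have h1 : 0 ≤ b + Z * c := by
    rcases le_or_gt 0 c with h | h
    · positivity
    · nlinarith
  nlinarith [mul_nonneg (sq_nonneg t) ha, mul_nonneg hZ h1]

theorem quad_nonneg_of_pos {t a b c Z : ℝ} (hZ : 0 ≤ Z) (ha : 0 ≤ a) (hb : 0 ≤ b) (hc : 0 ≤ c) :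
    0 ≤ t ^ 2 * a + b * Z + c * Z ^ 2 := by positivity

theorem quad_nonneg_of_disc {t a b c Z m : ℝ} (hZ : 0 ≤ Z) (ha : 0 ≤ a) (hc : 0 ≤ c)
    (hm : m ^ 2 ≤ a * c) (hb : 0 ≤ b + 2 * t * m) : 0 ≤ t ^ 2 * a + b * Z + c * Z ^ 2 := by
  have h1 : 2 * (t * Z * m) ≤ t ^ 2 * a + c * Z ^ 2 := by
    have h2 : 0 ≤ t ^ 2 * a + c * Z ^ 2 := by positivity
    refine (abs_le_of_sq_le_sq' ?_ h2).2
    nlinarith [sq_nonneg (t ^ 2 * a - c * Z ^ 2), mul_le_mul_of_nonneg_left hm (sq_nonneg (t * Z))]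
  nlinarith [mul_nonneg hZ hb]

end DulacData

namespace DulacData

set_option maxHeartbeats 1000000 in
theorem quadForm_left_small {E t Z : ℝ} (hE₀ : 0 ≤ E) (hE₁ : E ≤ 23/10) (ht : 0 ≤ t) (hZ : 0 ≤ Z) :
    0 ≤ quadForm 1 (14383/10000) (3201/2500) (-1079/5000) (299/2000) (14559/10000) E t Z := by
  replace hE₀ := sub_nonneg.2 hE₀
  replace hE₁ := sub_nonneg.2 hE₁
  simp only [quadForm]
  rcases le_or_gt t (43/250) with h | h
  · have h₀ : 0 ≤ t - 0 := by linarith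
    have h₁ : 0 ≤ (43/250) - t := by linarith
    have b := fun i j : ℕ => mul_nonneg (pow_nonneg h₀ i) (pow_nonneg h₁ j)
    have e₀ := fun i j => mul_nonneg hE₀ (b i j)
    have e₁ := fun i j => mul_nonneg hE₁ (b i j)
    refine quad_nonneg_of_disc (m := (129/5000)) hZ ?_ ?_ ?_ ?_
    · simp only [coeffA]
      linarith [b 0 2, b 1 1, b 2 0]
    · simp only [coeffC₂, coeffβ, coeffγ]
      linarith [e₀ 0 4, e₀ 1 3, e₀ 2 2, e₀ 3 1, e₀ 4 0, e₁ 0 4, e₁ 1 3, e₁ 2 2, e₁ 3 1, e₁ 4 0]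
    · simp only [coeffC₂, coeffβ, coeffγ, coeffA]
      linarith [e₀ 0 6, e₀ 1 5, e₀ 2 4, e₀ 3 3, e₀ 4 2, e₀ 5 1, e₀ 6 0, e₁ 0 6, e₁ 1 5, e₁ 2 4,
        e₁ 3 3, e₁ 4 2, e₁ 5 1, e₁ 6 0]
    · simp only [coeffC₁, coeffβ, coeffγ, coeffA]
      linarith [e₀ 0 4, e₀ 1 3, e₀ 2 2, e₀ 3 1, e₀ 4 0, e₁ 0 4, e₁ 1 3, e₁ 2 2, e₁ 3 1, e₁ 4 0]
  rcases le_or_gt t (309/1000) with h | h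
  · have h₀ : 0 ≤ t - (43/250) := by linarith
    have h₁ : 0 ≤ (309/1000) - t := by linarith
    have b := fun i j : ℕ => mul_nonneg (pow_nonneg h₀ i) (pow_nonneg h₁ j)
    have e₀ := fun i j => mul_nonneg hE₀ (b i j)
    have e₁ := fun i j => mul_nonneg hE₁ (b i j)
    refine quad_nonneg_of_disc (m := (397/10000)) hZ ?_ ?_ ?_ ?_
    · simp only [coeffA]
      linarith [b 0 2, b 1 1, b 2 0]
    · simp only [coeffC₂, coeffβ, coeffγ]
      linarith [e₀ 0 4, e₀ 1 3, e₀ 2 2, e₀ 3 1, e₀ 4 0, e₁ 0 4, e₁ 1 3, e₁ 2 2, e₁ 3 1, e₁ 4 0]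
    · simp only [coeffC₂, coeffβ, coeffγ, coeffA]
      linarith [e₀ 0 6, e₀ 1 5, e₀ 2 4, e₀ 3 3, e₀ 4 2, e₀ 5 1, e₀ 6 0, e₁ 0 6, e₁ 1 5, e₁ 2 4,
        e₁ 3 3, e₁ 4 2, e₁ 5 1, e₁ 6 0]
    · simp only [coeffC₁, coeffβ, coeffγ, coeffA]
      linarith [e₀ 0 4, e₀ 1 3, e₀ 2 2, e₀ 3 1, e₀ 4 0, e₁ 0 4, e₁ 1 3, e₁ 2 2, e₁ 3 1, e₁ 4 0]
  rcases le_or_gt t (2309/1000) with h | h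
  · have h₀ : 0 ≤ t - (309/1000) := by linarith
    have h₁ : 0 ≤ (2309/1000) - t := by linarith
    have b := fun i j : ℕ => mul_nonneg (pow_nonneg h₀ i) (pow_nonneg h₁ j)
    have e₀ := fun i j => mul_nonneg hE₀ (b i j)
    have e₁ := fun i j => mul_nonneg hE₁ (b i j)
    refine quad_nonneg_of_disc (m := (7/10000)) hZ ?_ ?_ ?_ ?_
    · simp only [coeffA]
      linarith [b 0 2, b 1 1, b 2 0]
    · simp only [coeffC₂, coeffβ, coeffγ]
      linarith [e₀ 0 4, e₀ 1 3, e₀ 2 2, e₀ 3 1, e₀ 4 0, e₁ 0 4, e₁ 1 3, e₁ 2 2, e₁ 3 1, e₁ 4 0]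
    · simp only [coeffC₂, coeffβ, coeffγ, coeffA]
      linarith [e₀ 0 6, e₀ 1 5, e₀ 2 4, e₀ 3 3, e₀ 4 2, e₀ 5 1, e₀ 6 0, e₁ 0 6, e₁ 1 5, e₁ 2 4,
        e₁ 3 3, e₁ 4 2, e₁ 5 1, e₁ 6 0]
    · simp only [coeffC₁, coeffβ, coeffγ, coeffA]
      linarith [e₀ 0 4, e₀ 1 3, e₀ 2 2, e₀ 3 1, e₀ 4 0, e₁ 0 4, e₁ 1 3, e₁ 2 2, e₁ 3 1, e₁ 4 0]
  rcases le_or_gt t (1127/250) with h | h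
  · have h₀ : 0 ≤ t - (2309/1000) := by linarith
    have h₁ : 0 ≤ (1127/250) - t := by linarith
    have b := fun i j : ℕ => mul_nonneg (pow_nonneg h₀ i) (pow_nonneg h₁ j)
    have e₀ := fun i j => mul_nonneg hE₀ (b i j)
    have e₁ := fun i j => mul_nonneg hE₁ (b i j)
    refine quad_nonneg_of_pos hZ ?_ ?_ ?_
    · simp only [coeffA]
      linarith [b 0 2, b 1 1, b 2 0]
    · simp only [coeffC₁, coeffβ, coeffγ, coeffA]
      linarith [e₀ 0 4, e₀ 1 3, e₀ 2 2, e₀ 3 1, e₀ 4 0, e₁ 0 4, e₁ 1 3, e₁ 2 2, e₁ 3 1, e₁ 4 0]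
    · simp only [coeffC₂, coeffβ, coeffγ]
      linarith [e₀ 0 4, e₀ 1 3, e₀ 2 2, e₀ 3 1, e₀ 4 0, e₁ 0 4, e₁ 1 3, e₁ 2 2, e₁ 3 1, e₁ 4 0]
  have h₀ : 0 ≤ t - (1127/250) := by linarith
  have b := fun i : ℕ => pow_nonneg h₀ i
  have e₀ := fun i => mul_nonneg hE₀ (b i)
  have e₁ := fun i => mul_nonneg hE₁ (b i)
  refine quad_nonneg_of_pos hZ ?_ ?_ ?_
  · simp only [coeffA]
    linarith [b 0, b 1, b 2]
  · simp only [coeffC₁, coeffβ, coeffγ, coeffA]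
    linarith [e₀ 0, e₀ 1, e₀ 2, e₀ 3, e₀ 4, e₁ 0, e₁ 1, e₁ 2, e₁ 3, e₁ 4]
  · simp only [coeffC₂, coeffβ, coeffγ]
    linarith [e₀ 0, e₀ 1, e₀ 2, e₀ 3, e₀ 4, e₁ 0, e₁ 1, e₁ 2, e₁ 3, e₁ 4]

set_option maxHeartbeats 1000000 in
theorem quadForm_right_small {E t Z : ℝ} (hE₀ : 0 ≤ E) (hE₁ : E ≤ 23/10) (ht : 0 ≤ t) (hZ : 0 ≤ Z) :
    0 ≤ quadForm (-1) (14483/10000) (3201/2500) (1077/5000) 0 (14559/10000) E t Z := by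
  replace hE₀ := sub_nonneg.2 hE₀
  replace hE₁ := sub_nonneg.2 hE₁
  simp only [quadForm]
  rcases le_or_gt t (42/125) with h | h
  · have h₀ : 0 ≤ t - 0 := by linarith
    have h₁ : 0 ≤ (42/125) - t := by linarith
    have b := fun i j : ℕ => mul_nonneg (pow_nonneg h₀ i) (pow_nonneg h₁ j)
    have e₀ := fun i j => mul_nonneg hE₀ (b i j)
    have e₁ := fun i j => mul_nonneg hE₁ (b i j)
    refine quad_nonneg_of_pos hZ ?_ ?_ ?_
    · simp only [coeffA]
      linarith [b 0 2, b 1 1, b 2 0]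
    · simp only [coeffC₁, coeffβ, coeffγ, coeffA]
      linarith [e₀ 0 4, e₀ 1 3, e₀ 2 2, e₀ 3 1, e₀ 4 0, e₁ 0 4, e₁ 1 3, e₁ 2 2, e₁ 3 1, e₁ 4 0]
    · simp only [coeffC₂, coeffβ, coeffγ]
      linarith [e₀ 0 3, e₀ 1 2, e₀ 2 1, e₀ 3 0, e₁ 0 3, e₁ 1 2, e₁ 2 1, e₁ 3 0]
  rcases le_or_gt t (292/125) with h | h
  · have h₀ : 0 ≤ t - (42/125) := by linarith
    have h₁ : 0 ≤ (292/125) - t := by linarith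
    have b := fun i j : ℕ => mul_nonneg (pow_nonneg h₀ i) (pow_nonneg h₁ j)
    have e₀ := fun i j => mul_nonneg hE₀ (b i j)
    have e₁ := fun i j => mul_nonneg hE₁ (b i j)
    refine quad_nonneg_of_disc (m := (987/10000) * t ^ 2) hZ ?_ ?_ ?_ ?_
    · simp only [coeffA]
      linarith [b 0 2, b 1 1, b 2 0]
    · simp only [coeffC₂, coeffβ, coeffγ]
      linarith [e₀ 0 3, e₀ 1 2, e₀ 2 1, e₀ 3 0, e₁ 0 3, e₁ 1 2, e₁ 2 1, e₁ 3 0]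
    · simp only [coeffC₂, coeffβ, coeffγ, coeffA]
      linarith [e₀ 0 5, e₀ 1 4, e₀ 2 3, e₀ 3 2, e₀ 4 1, e₀ 5 0, e₁ 0 5, e₁ 1 4, e₁ 2 3, e₁ 3 2,
        e₁ 4 1, e₁ 5 0]
    · simp only [coeffC₁, coeffβ, coeffγ, coeffA]
      linarith [e₀ 0 4, e₀ 1 3, e₀ 2 2, e₀ 3 1, e₀ 4 0, e₁ 0 4, e₁ 1 3, e₁ 2 2, e₁ 3 1, e₁ 4 0]
  rcases le_or_gt t (5292/125) with h | h
  · have h₀ : 0 ≤ t - (292/125) := by linarith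
    have h₁ : 0 ≤ (5292/125) - t := by linarith
    have b := fun i j : ℕ => mul_nonneg (pow_nonneg h₀ i) (pow_nonneg h₁ j)
    have e₀ := fun i j => mul_nonneg hE₀ (b i j)
    have e₁ := fun i j => mul_nonneg hE₁ (b i j)
    refine quad_nonneg_of_disc (m := (921/5000) * t ^ 2) hZ ?_ ?_ ?_ ?_
    · simp only [coeffA]
      linarith [b 0 2, b 1 1, b 2 0]
    · simp only [coeffC₂, coeffβ, coeffγ]
      linarith [e₀ 0 3, e₀ 1 2, e₀ 2 1, e₀ 3 0, e₁ 0 3, e₁ 1 2, e₁ 2 1, e₁ 3 0]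
    · simp only [coeffC₂, coeffβ, coeffγ, coeffA]
      linarith [e₀ 0 5, e₀ 1 4, e₀ 2 3, e₀ 3 2, e₀ 4 1, e₀ 5 0, e₁ 0 5, e₁ 1 4, e₁ 2 3, e₁ 3 2,
        e₁ 4 1, e₁ 5 0]
    · simp only [coeffC₁, coeffβ, coeffγ, coeffA]
      linarith [e₀ 0 4, e₀ 1 3, e₀ 2 2, e₀ 3 1, e₀ 4 0, e₁ 0 4, e₁ 1 3, e₁ 2 2, e₁ 3 1, e₁ 4 0]
  have h₀ : 0 ≤ t - (5292/125) := by linarith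
  have b := fun i : ℕ => pow_nonneg h₀ i
  have e₀ := fun i => mul_nonneg hE₀ (b i)
  have e₁ := fun i => mul_nonneg hE₁ (b i)
  refine quad_nonneg_of_pos hZ ?_ ?_ ?_
  · simp only [coeffA]
    linarith [b 0, b 1, b 2]
  · simp only [coeffC₁, coeffβ, coeffγ, coeffA]
    linarith [e₀ 0, e₀ 1, e₀ 2, e₀ 3, e₀ 4, e₁ 0, e₁ 1, e₁ 2, e₁ 3, e₁ 4]
  · simp only [coeffC₂, coeffβ, coeffγ]
    linarith [e₀ 0, e₀ 1, e₀ 2, e₀ 3, e₁ 0, e₁ 1, e₁ 2, e₁ 3]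

set_option maxHeartbeats 1000000 in
theorem quadForm_left_medium {E t Z : ℝ} (hE₀ : 23/10 ≤ E) (hE₁ : E ≤ 1643/500) (ht : 0 ≤ t)
    (hZ : 0 ≤ Z) :
    0 ≤ quadForm 1 (18831/10000) (1769/2500) (-221/1000) (189/1000) (373/250) E t Z := by
  replace hE₀ := sub_nonneg.2 hE₀
  replace hE₁ := sub_nonneg.2 hE₁
  simp only [quadForm]
  rcases le_or_gt t (43/250) with h | h
  · have h₀ : 0 ≤ t - 0 := by linarith
    have h₁ : 0 ≤ (43/250) - t := by linarith
    have b := fun i j : ℕ => mul_nonneg (pow_nonneg h₀ i) (pow_nonneg h₁ j)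
    have e₀ := fun i j => mul_nonneg hE₀ (b i j)
    have e₁ := fun i j => mul_nonneg hE₁ (b i j)
    refine quad_nonneg_of_disc (m := (2117/10000) * t) hZ ?_ ?_ ?_ ?_
    · simp only [coeffA]
      linarith [b 0 2, b 1 1, b 2 0]
    · simp only [coeffC₂, coeffβ, coeffγ]
      linarith [e₀ 0 4, e₀ 1 3, e₀ 2 2, e₀ 3 1, e₀ 4 0, e₁ 0 4, e₁ 1 3, e₁ 2 2, e₁ 3 1, e₁ 4 0]
    · simp only [coeffC₂, coeffβ, coeffγ, coeffA]
      linarith [e₀ 0 6, e₀ 1 5, e₀ 2 4, e₀ 3 3, e₀ 4 2, e₀ 5 1, e₀ 6 0, e₁ 0 6, e₁ 1 5, e₁ 2 4,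
        e₁ 3 3, e₁ 4 2, e₁ 5 1, e₁ 6 0]
    · simp only [coeffC₁, coeffβ, coeffγ, coeffA]
      linarith [e₀ 0 4, e₀ 1 3, e₀ 2 2, e₀ 3 1, e₀ 4 0, e₁ 0 4, e₁ 1 3, e₁ 2 2, e₁ 3 1, e₁ 4 0]
  rcases le_or_gt t (217/1000) with h | h
  · have h₀ : 0 ≤ t - (43/250) := by linarith
    have h₁ : 0 ≤ (217/1000) - t := by linarith
    have b := fun i j : ℕ => mul_nonneg (pow_nonneg h₀ i) (pow_nonneg h₁ j)
    have e₀ := fun i j => mul_nonneg hE₀ (b i j)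
    have e₁ := fun i j => mul_nonneg hE₁ (b i j)
    refine quad_nonneg_of_disc (m := (79/2500)) hZ ?_ ?_ ?_ ?_
    · simp only [coeffA]
      linarith [b 0 2, b 1 1, b 2 0]
    · simp only [coeffC₂, coeffβ, coeffγ]
      linarith [e₀ 0 4, e₀ 1 3, e₀ 2 2, e₀ 3 1, e₀ 4 0, e₁ 0 4, e₁ 1 3, e₁ 2 2, e₁ 3 1, e₁ 4 0]
    · simp only [coeffC₂, coeffβ, coeffγ, coeffA]
      linarith [e₀ 0 6, e₀ 1 5, e₀ 2 4, e₀ 3 3, e₀ 4 2, e₀ 5 1, e₀ 6 0, e₁ 0 6, e₁ 1 5, e₁ 2 4,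
        e₁ 3 3, e₁ 4 2, e₁ 5 1, e₁ 6 0]
    · simp only [coeffC₁, coeffβ, coeffγ, coeffA]
      linarith [e₀ 0 4, e₀ 1 3, e₀ 2 2, e₀ 3 1, e₀ 4 0, e₁ 0 4, e₁ 1 3, e₁ 2 2, e₁ 3 1, e₁ 4 0]
  rcases le_or_gt t (123/500) with h | h
  · have h₀ : 0 ≤ t - (217/1000) := by linarith
    have h₁ : 0 ≤ (123/500) - t := by linarith
    have b := fun i j : ℕ => mul_nonneg (pow_nonneg h₀ i) (pow_nonneg h₁ j)
    have e₀ := fun i j => mul_nonneg hE₀ (b i j)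
    have e₁ := fun i j => mul_nonneg hE₁ (b i j)
    refine quad_nonneg_of_disc (m := (263/10000)) hZ ?_ ?_ ?_ ?_
    · simp only [coeffA]
      linarith [b 0 2, b 1 1, b 2 0]
    · simp only [coeffC₂, coeffβ, coeffγ]
      linarith [e₀ 0 4, e₀ 1 3, e₀ 2 2, e₀ 3 1, e₀ 4 0, e₁ 0 4, e₁ 1 3, e₁ 2 2, e₁ 3 1, e₁ 4 0]
    · simp only [coeffC₂, coeffβ, coeffγ, coeffA]
      linarith [e₀ 0 6, e₀ 1 5, e₀ 2 4, e₀ 3 3, e₀ 4 2, e₀ 5 1, e₀ 6 0, e₁ 0 6, e₁ 1 5, e₁ 2 4,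
        e₁ 3 3, e₁ 4 2, e₁ 5 1, e₁ 6 0]
    · simp only [coeffC₁, coeffβ, coeffγ, coeffA]
      linarith [e₀ 0 4, e₀ 1 3, e₀ 2 2, e₀ 3 1, e₀ 4 0, e₁ 0 4, e₁ 1 3, e₁ 2 2, e₁ 3 1, e₁ 4 0]
  rcases le_or_gt t (291/1000) with h | h
  · have h₀ : 0 ≤ t - (123/500) := by linarith
    have h₁ : 0 ≤ (291/1000) - t := by linarith
    have b := fun i j : ℕ => mul_nonneg (pow_nonneg h₀ i) (pow_nonneg h₁ j)
    have e₀ := fun i j => mul_nonneg hE₀ (b i j)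
    have e₁ := fun i j => mul_nonneg hE₁ (b i j)
    refine quad_nonneg_of_disc (m := (163/10000)) hZ ?_ ?_ ?_ ?_
    · simp only [coeffA]
      linarith [b 0 2, b 1 1, b 2 0]
    · simp only [coeffC₂, coeffβ, coeffγ]
      linarith [e₀ 0 4, e₀ 1 3, e₀ 2 2, e₀ 3 1, e₀ 4 0, e₁ 0 4, e₁ 1 3, e₁ 2 2, e₁ 3 1, e₁ 4 0]
    · simp only [coeffC₂, coeffβ, coeffγ, coeffA]
      linarith [e₀ 0 6, e₀ 1 5, e₀ 2 4, e₀ 3 3, e₀ 4 2, e₀ 5 1, e₀ 6 0, e₁ 0 6, e₁ 1 5, e₁ 2 4,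
        e₁ 3 3, e₁ 4 2, e₁ 5 1, e₁ 6 0]
    · simp only [coeffC₁, coeffβ, coeffγ, coeffA]
      linarith [e₀ 0 4, e₀ 1 3, e₀ 2 2, e₀ 3 1, e₀ 4 0, e₁ 0 4, e₁ 1 3, e₁ 2 2, e₁ 3 1, e₁ 4 0]
  rcases le_or_gt t (379/1000) with h | h
  · have h₀ : 0 ≤ t - (291/1000) := by linarith
    have h₁ : 0 ≤ (379/1000) - t := by linarith
    have b := fun i j : ℕ => mul_nonneg (pow_nonneg h₀ i) (pow_nonneg h₁ j)
    have e₀ := fun i j => mul_nonneg hE₀ (b i j)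
    have e₁ := fun i j => mul_nonneg hE₁ (b i j)
    refine quad_nonneg_of_pos hZ ?_ ?_ ?_
    · simp only [coeffA]
      linarith [b 0 2, b 1 1, b 2 0]
    · simp only [coeffC₁, coeffβ, coeffγ, coeffA]
      linarith [e₀ 0 4, e₀ 1 3, e₀ 2 2, e₀ 3 1, e₀ 4 0, e₁ 0 4, e₁ 1 3, e₁ 2 2, e₁ 3 1, e₁ 4 0]
    · simp only [coeffC₂, coeffβ, coeffγ]
      linarith [e₀ 0 4, e₀ 1 3, e₀ 2 2, e₀ 3 1, e₀ 4 0, e₁ 0 4, e₁ 1 3, e₁ 2 2, e₁ 3 1, e₁ 4 0]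
  have h₀ : 0 ≤ t - (379/1000) := by linarith
  have b := fun i : ℕ => pow_nonneg h₀ i
  have e₀ := fun i => mul_nonneg hE₀ (b i)
  have e₁ := fun i => mul_nonneg hE₁ (b i)
  refine quad_nonneg_of_pos hZ ?_ ?_ ?_
  · simp only [coeffA]
    linarith [b 0, b 1, b 2]
  · simp only [coeffC₁, coeffβ, coeffγ, coeffA]
    linarith [e₀ 0, e₀ 1, e₀ 2, e₀ 3, e₀ 4, e₁ 0, e₁ 1, e₁ 2, e₁ 3, e₁ 4]
  · simp only [coeffC₂, coeffβ, coeffγ]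
    linarith [e₀ 0, e₀ 1, e₀ 2, e₀ 3, e₀ 4, e₁ 0, e₁ 1, e₁ 2, e₁ 3, e₁ 4]

set_option maxHeartbeats 1000000 in
theorem quadForm_right_medium {E t Z : ℝ} (hE₀ : 23/10 ≤ E) (hE₁ : E ≤ 1643/500) (ht : 0 ≤ t)
    (hZ : 0 ≤ Z) :
    0 ≤ quadForm (-1) (18931/10000) (1769/2500) (2213/10000) 0 (373/250) E t Z := by
  replace hE₀ := sub_nonneg.2 hE₀
  replace hE₁ := sub_nonneg.2 hE₁
  simp only [quadForm]
  rcases le_or_gt t (419/1000) with h | h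
  · have h₀ : 0 ≤ t - 0 := by linarith
    have h₁ : 0 ≤ (419/1000) - t := by linarith
    have b := fun i j : ℕ => mul_nonneg (pow_nonneg h₀ i) (pow_nonneg h₁ j)
    have e₀ := fun i j => mul_nonneg hE₀ (b i j)
    have e₁ := fun i j => mul_nonneg hE₁ (b i j)
    refine quad_nonneg_of_pos hZ ?_ ?_ ?_
    · simp only [coeffA]
      linarith [b 0 2, b 1 1, b 2 0]
    · simp only [coeffC₁, coeffβ, coeffγ, coeffA]
      linarith [e₀ 0 4, e₀ 1 3, e₀ 2 2, e₀ 3 1, e₀ 4 0, e₁ 0 4, e₁ 1 3, e₁ 2 2, e₁ 3 1, e₁ 4 0]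
    · simp only [coeffC₂, coeffβ, coeffγ]
      linarith [e₀ 0 3, e₀ 1 2, e₀ 2 1, e₀ 3 0, e₁ 0 3, e₁ 1 2, e₁ 2 1, e₁ 3 0]
  rcases le_or_gt t (529/1000) with h | h
  · have h₀ : 0 ≤ t - (419/1000) := by linarith
    have h₁ : 0 ≤ (529/1000) - t := by linarith
    have b := fun i j : ℕ => mul_nonneg (pow_nonneg h₀ i) (pow_nonneg h₁ j)
    have e₀ := fun i j => mul_nonneg hE₀ (b i j)
    have e₁ := fun i j => mul_nonneg hE₁ (b i j)
    refine quad_nonneg_of_pos hZ ?_ ?_ ?_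
    · simp only [coeffA]
      linarith [b 0 2, b 1 1, b 2 0]
    · simp only [coeffC₁, coeffβ, coeffγ, coeffA]
      linarith [e₀ 0 4, e₀ 1 3, e₀ 2 2, e₀ 3 1, e₀ 4 0, e₁ 0 4, e₁ 1 3, e₁ 2 2, e₁ 3 1, e₁ 4 0]
    · simp only [coeffC₂, coeffβ, coeffγ]
      linarith [e₀ 0 3, e₀ 1 2, e₀ 2 1, e₀ 3 0, e₁ 0 3, e₁ 1 2, e₁ 2 1, e₁ 3 0]
  rcases le_or_gt t (1553/1000) with h | h
  · have h₀ : 0 ≤ t - (529/1000) := by linarith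
    have h₁ : 0 ≤ (1553/1000) - t := by linarith
    have b := fun i j : ℕ => mul_nonneg (pow_nonneg h₀ i) (pow_nonneg h₁ j)
    have e₀ := fun i j => mul_nonneg hE₀ (b i j)
    have e₁ := fun i j => mul_nonneg hE₁ (b i j)
    refine quad_nonneg_of_pos hZ ?_ ?_ ?_
    · simp only [coeffA]
      linarith [b 0 2, b 1 1, b 2 0]
    · simp only [coeffC₁, coeffβ, coeffγ, coeffA]
      linarith [e₀ 0 4, e₀ 1 3, e₀ 2 2, e₀ 3 1, e₀ 4 0, e₁ 0 4, e₁ 1 3, e₁ 2 2, e₁ 3 1, e₁ 4 0]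
    · simp only [coeffC₂, coeffβ, coeffγ]
      linarith [e₀ 0 3, e₀ 1 2, e₀ 2 1, e₀ 3 0, e₁ 0 3, e₁ 1 2, e₁ 2 1, e₁ 3 0]
  rcases le_or_gt t (1227/500) with h | h
  · have h₀ : 0 ≤ t - (1553/1000) := by linarith
    have h₁ : 0 ≤ (1227/500) - t := by linarith
    have b := fun i j : ℕ => mul_nonneg (pow_nonneg h₀ i) (pow_nonneg h₁ j)
    have e₀ := fun i j => mul_nonneg hE₀ (b i j)
    have e₁ := fun i j => mul_nonneg hE₁ (b i j)
    refine quad_nonneg_of_disc (m := (67/1000) * t ^ 2) hZ ?_ ?_ ?_ ?_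
    · simp only [coeffA]
      linarith [b 0 2, b 1 1, b 2 0]
    · simp only [coeffC₂, coeffβ, coeffγ]
      linarith [e₀ 0 3, e₀ 1 2, e₀ 2 1, e₀ 3 0, e₁ 0 3, e₁ 1 2, e₁ 2 1, e₁ 3 0]
    · simp only [coeffC₂, coeffβ, coeffγ, coeffA]
      linarith [e₀ 0 5, e₀ 1 4, e₀ 2 3, e₀ 3 2, e₀ 4 1, e₀ 5 0, e₁ 0 5, e₁ 1 4, e₁ 2 3, e₁ 3 2,
        e₁ 4 1, e₁ 5 0]
    · simp only [coeffC₁, coeffβ, coeffγ, coeffA]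
      linarith [e₀ 0 4, e₀ 1 3, e₀ 2 2, e₀ 3 1, e₀ 4 0, e₁ 0 4, e₁ 1 3, e₁ 2 2, e₁ 3 1, e₁ 4 0]
  rcases le_or_gt t (127/40) with h | h
  · have h₀ : 0 ≤ t - (1227/500) := by linarith
    have h₁ : 0 ≤ (127/40) - t := by linarith
    have b := fun i j : ℕ => mul_nonneg (pow_nonneg h₀ i) (pow_nonneg h₁ j)
    have e₀ := fun i j => mul_nonneg hE₀ (b i j)
    have e₁ := fun i j => mul_nonneg hE₁ (b i j)
    refine quad_nonneg_of_disc (m := (957/10000) * t ^ 2) hZ ?_ ?_ ?_ ?_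
    · simp only [coeffA]
      linarith [b 0 2, b 1 1, b 2 0]
    · simp only [coeffC₂, coeffβ, coeffγ]
      linarith [e₀ 0 3, e₀ 1 2, e₀ 2 1, e₀ 3 0, e₁ 0 3, e₁ 1 2, e₁ 2 1, e₁ 3 0]
    · simp only [coeffC₂, coeffβ, coeffγ, coeffA]
      linarith [e₀ 0 5, e₀ 1 4, e₀ 2 3, e₀ 3 2, e₀ 4 1, e₀ 5 0, e₁ 0 5, e₁ 1 4, e₁ 2 3, e₁ 3 2,
        e₁ 4 1, e₁ 5 0]
    · simp only [coeffC₁, coeffβ, coeffγ, coeffA]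
      linarith [e₀ 0 4, e₀ 1 3, e₀ 2 2, e₀ 3 1, e₀ 4 0, e₁ 0 4, e₁ 1 3, e₁ 2 2, e₁ 3 1, e₁ 4 0]
  rcases le_or_gt t (3751/1000) with h | h
  · have h₀ : 0 ≤ t - (127/40) := by linarith
    have h₁ : 0 ≤ (3751/1000) - t := by linarith
    have b := fun i j : ℕ => mul_nonneg (pow_nonneg h₀ i) (pow_nonneg h₁ j)
    have e₀ := fun i j => mul_nonneg hE₀ (b i j)
    have e₁ := fun i j => mul_nonneg hE₁ (b i j)
    refine quad_nonneg_of_disc (m := (1091/10000) * t ^ 2) hZ ?_ ?_ ?_ ?_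
    · simp only [coeffA]
      linarith [b 0 2, b 1 1, b 2 0]
    · simp only [coeffC₂, coeffβ, coeffγ]
      linarith [e₀ 0 3, e₀ 1 2, e₀ 2 1, e₀ 3 0, e₁ 0 3, e₁ 1 2, e₁ 2 1, e₁ 3 0]
    · simp only [coeffC₂, coeffβ, coeffγ, coeffA]
      linarith [e₀ 0 5, e₀ 1 4, e₀ 2 3, e₀ 3 2, e₀ 4 1, e₀ 5 0, e₁ 0 5, e₁ 1 4, e₁ 2 3, e₁ 3 2,
        e₁ 4 1, e₁ 5 0]
    · simp only [coeffC₁, coeffβ, coeffγ, coeffA]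
      linarith [e₀ 0 4, e₀ 1 3, e₀ 2 2, e₀ 3 1, e₀ 4 0, e₁ 0 4, e₁ 1 3, e₁ 2 2, e₁ 3 1, e₁ 4 0]
  rcases le_or_gt t (1163/250) with h | h
  · have h₀ : 0 ≤ t - (3751/1000) := by linarith
    have h₁ : 0 ≤ (1163/250) - t := by linarith
    have b := fun i j : ℕ => mul_nonneg (pow_nonneg h₀ i) (pow_nonneg h₁ j)
    have e₀ := fun i j => mul_nonneg hE₀ (b i j)
    have e₁ := fun i j => mul_nonneg hE₁ (b i j)
    refine quad_nonneg_of_disc (m := (1217/10000) * t ^ 2) hZ ?_ ?_ ?_ ?_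
    · simp only [coeffA]
      linarith [b 0 2, b 1 1, b 2 0]
    · simp only [coeffC₂, coeffβ, coeffγ]
      linarith [e₀ 0 3, e₀ 1 2, e₀ 2 1, e₀ 3 0, e₁ 0 3, e₁ 1 2, e₁ 2 1, e₁ 3 0]
    · simp only [coeffC₂, coeffβ, coeffγ, coeffA]
      linarith [e₀ 0 5, e₀ 1 4, e₀ 2 3, e₀ 3 2, e₀ 4 1, e₀ 5 0, e₁ 0 5, e₁ 1 4, e₁ 2 3, e₁ 3 2,
        e₁ 4 1, e₁ 5 0]
    · simp only [coeffC₁, coeffβ, coeffγ, coeffA]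
      linarith [e₀ 0 4, e₀ 1 3, e₀ 2 2, e₀ 3 1, e₀ 4 0, e₁ 0 4, e₁ 1 3, e₁ 2 2, e₁ 3 1, e₁ 4 0]
  rcases le_or_gt t (1011/125) with h | h
  · have h₀ : 0 ≤ t - (1163/250) := by linarith
    have h₁ : 0 ≤ (1011/125) - t := by linarith
    have b := fun i j : ℕ => mul_nonneg (pow_nonneg h₀ i) (pow_nonneg h₁ j)
    have e₀ := fun i j => mul_nonneg hE₀ (b i j)
    have e₁ := fun i j => mul_nonneg hE₁ (b i j)
    refine quad_nonneg_of_disc (m := (169/1250) * t ^ 2) hZ ?_ ?_ ?_ ?_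
    · simp only [coeffA]
      linarith [b 0 2, b 1 1, b 2 0]
    · simp only [coeffC₂, coeffβ, coeffγ]
      linarith [e₀ 0 3, e₀ 1 2, e₀ 2 1, e₀ 3 0, e₁ 0 3, e₁ 1 2, e₁ 2 1, e₁ 3 0]
    · simp only [coeffC₂, coeffβ, coeffγ, coeffA]
      linarith [e₀ 0 5, e₀ 1 4, e₀ 2 3, e₀ 3 2, e₀ 4 1, e₀ 5 0, e₁ 0 5, e₁ 1 4, e₁ 2 3, e₁ 3 2,
        e₁ 4 1, e₁ 5 0]
    · simp only [coeffC₁, coeffβ, coeffγ, coeffA]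
      linarith [e₀ 0 4, e₀ 1 3, e₀ 2 2, e₀ 3 1, e₀ 4 0, e₁ 0 4, e₁ 1 3, e₁ 2 2, e₁ 3 1, e₁ 4 0]
  have h₀ : 0 ≤ t - (1011/125) := by linarith
  have b := fun i : ℕ => pow_nonneg h₀ i
  have e₀ := fun i => mul_nonneg hE₀ (b i)
  have e₁ := fun i => mul_nonneg hE₁ (b i)
  refine quad_nonneg_of_disc (m := (689/5000) * t ^ 2) hZ ?_ ?_ ?_ ?_
  · simp only [coeffA]
    linarith [b 0, b 1, b 2]
  · simp only [coeffC₂, coeffβ, coeffγ]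
    linarith [e₀ 0, e₀ 1, e₀ 2, e₀ 3, e₁ 0, e₁ 1, e₁ 2, e₁ 3]
  · simp only [coeffC₂, coeffβ, coeffγ, coeffA]
    linarith [e₀ 0, e₀ 1, e₀ 2, e₀ 3, e₀ 4, e₀ 5, e₁ 0, e₁ 1, e₁ 2, e₁ 3, e₁ 4, e₁ 5]
  · simp only [coeffC₁, coeffβ, coeffγ, coeffA]
    linarith [e₀ 0, e₀ 1, e₀ 2, e₀ 3, e₀ 4, e₁ 0, e₁ 1, e₁ 2, e₁ 3, e₁ 4]

set_option maxHeartbeats 1000000 in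
theorem quadForm_left_large {E t Z : ℝ} (hE₀ : 657/200 ≤ E) (hE₁ : E ≤ 147/40) (ht : 0 ≤ t)
    (hZ : 0 ≤ Z) (hZM : Z ≤ 6/5) :
    0 ≤ quadForm 1 (11941/5000) (6487/10000) (-109/500) (1747/10000) (2957/2000) E t Z := by
  replace hE₀ := sub_nonneg.2 hE₀
  replace hE₁ := sub_nonneg.2 hE₁
  simp only [quadForm]
  rcases le_or_gt t (137/1000) with h | h
  · have h₀ : 0 ≤ t - 0 := by linarith
    have h₁ : 0 ≤ (137/1000) - t := by linarith
    have b := fun i j : ℕ => mul_nonneg (pow_nonneg h₀ i) (pow_nonneg h₁ j)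
    have e₀ := fun i j => mul_nonneg hE₀ (b i j)
    have e₁ := fun i j => mul_nonneg hE₁ (b i j)
    refine quad_nonneg_of_disc (m := (221/10000)) hZ ?_ ?_ ?_ ?_
    · simp only [coeffA]
      linarith [b 0 2, b 1 1, b 2 0]
    · simp only [coeffC₂, coeffβ, coeffγ]
      linarith [e₀ 0 4, e₀ 1 3, e₀ 2 2, e₀ 3 1, e₀ 4 0, e₁ 0 4, e₁ 1 3, e₁ 2 2, e₁ 3 1, e₁ 4 0]
    · simp only [coeffC₂, coeffβ, coeffγ, coeffA]
      linarith [e₀ 0 6, e₀ 1 5, e₀ 2 4, e₀ 3 3, e₀ 4 2, e₀ 5 1, e₀ 6 0, e₁ 0 6, e₁ 1 5, e₁ 2 4,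
        e₁ 3 3, e₁ 4 2, e₁ 5 1, e₁ 6 0]
    · simp only [coeffC₁, coeffβ, coeffγ, coeffA]
      linarith [e₀ 0 4, e₀ 1 3, e₀ 2 2, e₀ 3 1, e₀ 4 0, e₁ 0 4, e₁ 1 3, e₁ 2 2, e₁ 3 1, e₁ 4 0]
  rcases le_or_gt t (9/40) with h | h
  · have h₀ : 0 ≤ t - (137/1000) := by linarith
    have h₁ : 0 ≤ (9/40) - t := by linarith
    have b := fun i j : ℕ => mul_nonneg (pow_nonneg h₀ i) (pow_nonneg h₁ j)
    have e₀ := fun i j => mul_nonneg hE₀ (b i j)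
    have e₁ := fun i j => mul_nonneg hE₁ (b i j)
    refine quad_nonneg_of_disc (m := (319/10000)) hZ ?_ ?_ ?_ ?_
    · simp only [coeffA]
      linarith [b 0 2, b 1 1, b 2 0]
    · simp only [coeffC₂, coeffβ, coeffγ]
      linarith [e₀ 0 4, e₀ 1 3, e₀ 2 2, e₀ 3 1, e₀ 4 0, e₁ 0 4, e₁ 1 3, e₁ 2 2, e₁ 3 1, e₁ 4 0]
    · simp only [coeffC₂, coeffβ, coeffγ, coeffA]
      linarith [e₀ 0 6, e₀ 1 5, e₀ 2 4, e₀ 3 3, e₀ 4 2, e₀ 5 1, e₀ 6 0, e₁ 0 6, e₁ 1 5, e₁ 2 4,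
        e₁ 3 3, e₁ 4 2, e₁ 5 1, e₁ 6 0]
    · simp only [coeffC₁, coeffβ, coeffγ, coeffA]
      linarith [e₀ 0 4, e₀ 1 3, e₀ 2 2, e₀ 3 1, e₀ 4 0, e₁ 0 4, e₁ 1 3, e₁ 2 2, e₁ 3 1, e₁ 4 0]
  rcases le_or_gt t (27/100) with h | h
  · have h₀ : 0 ≤ t - (9/40) := by linarith
    have h₁ : 0 ≤ (27/100) - t := by linarith
    have b := fun i j : ℕ => mul_nonneg (pow_nonneg h₀ i) (pow_nonneg h₁ j)
    have e₀ := fun i j => mul_nonneg hE₀ (b i j)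
    have e₁ := fun i j => mul_nonneg hE₁ (b i j)
    refine quad_nonneg_of_disc (m := (33/2000)) hZ ?_ ?_ ?_ ?_
    · simp only [coeffA]
      linarith [b 0 2, b 1 1, b 2 0]
    · simp only [coeffC₂, coeffβ, coeffγ]
      linarith [e₀ 0 4, e₀ 1 3, e₀ 2 2, e₀ 3 1, e₀ 4 0, e₁ 0 4, e₁ 1 3, e₁ 2 2, e₁ 3 1, e₁ 4 0]
    · simp only [coeffC₂, coeffβ, coeffγ, coeffA]
      linarith [e₀ 0 6, e₀ 1 5, e₀ 2 4, e₀ 3 3, e₀ 4 2, e₀ 5 1, e₀ 6 0, e₁ 0 6, e₁ 1 5, e₁ 2 4,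
        e₁ 3 3, e₁ 4 2, e₁ 5 1, e₁ 6 0]
    · simp only [coeffC₁, coeffβ, coeffγ, coeffA]
      linarith [e₀ 0 4, e₀ 1 3, e₀ 2 2, e₀ 3 1, e₀ 4 0, e₁ 0 4, e₁ 1 3, e₁ 2 2, e₁ 3 1, e₁ 4 0]
  have h₀ : 0 ≤ t - (27/100) := by linarith
  have b := fun i : ℕ => pow_nonneg h₀ i
  have e₀ := fun i => mul_nonneg hE₀ (b i)
  have e₁ := fun i => mul_nonneg hE₁ (b i)
  refine quad_nonneg_of_coeff hZ hZM ?_ ?_ ?_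
  · simp only [coeffA]
    linarith [b 0, b 1, b 2]
  · simp only [coeffC₁, coeffβ, coeffγ, coeffA]
    linarith [e₀ 0, e₀ 1, e₀ 2, e₀ 3, e₀ 4, e₁ 0, e₁ 1, e₁ 2, e₁ 3, e₁ 4]
  · simp only [coeffC₁, coeffC₂, coeffβ, coeffγ, coeffA]
    linarith [e₀ 0, e₀ 1, e₀ 2, e₀ 3, e₀ 4, e₁ 0, e₁ 1, e₁ 2, e₁ 3, e₁ 4]

set_option maxHeartbeats 1000000 in
theorem quadForm_right_large {E t Z : ℝ} (hE₀ : 657/200 ≤ E) (hE₁ : E ≤ 147/40) (ht : 0 ≤ t)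
    (hZ : 0 ≤ Z) (hZM : Z ≤ 6/5) :
    0 ≤ quadForm (-1) (11991/5000) (6487/10000) (133/625) 0 (2957/2000) E t Z := by
  replace hE₀ := sub_nonneg.2 hE₀
  replace hE₁ := sub_nonneg.2 hE₁
  simp only [quadForm]
  rcases le_or_gt t (131/250) with h | h
  · have h₀ : 0 ≤ t - 0 := by linarith
    have h₁ : 0 ≤ (131/250) - t := by linarith
    have b := fun i j : ℕ => mul_nonneg (pow_nonneg h₀ i) (pow_nonneg h₁ j)
    have e₀ := fun i j => mul_nonneg hE₀ (b i j)
    have e₁ := fun i j => mul_nonneg hE₁ (b i j)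
    refine quad_nonneg_of_coeff hZ hZM ?_ ?_ ?_
    · simp only [coeffA]
      linarith [b 0 2, b 1 1, b 2 0]
    · simp only [coeffC₁, coeffβ, coeffγ, coeffA]
      linarith [e₀ 0 4, e₀ 1 3, e₀ 2 2, e₀ 3 1, e₀ 4 0, e₁ 0 4, e₁ 1 3, e₁ 2 2, e₁ 3 1, e₁ 4 0]
    · simp only [coeffC₁, coeffC₂, coeffβ, coeffγ, coeffA]
      linarith [e₀ 0 4, e₀ 1 3, e₀ 2 2, e₀ 3 1, e₀ 4 0, e₁ 0 4, e₁ 1 3, e₁ 2 2, e₁ 3 1, e₁ 4 0]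
  rcases le_or_gt t (1343/1000) with h | h
  · have h₀ : 0 ≤ t - (131/250) := by linarith
    have h₁ : 0 ≤ (1343/1000) - t := by linarith
    have b := fun i j : ℕ => mul_nonneg (pow_nonneg h₀ i) (pow_nonneg h₁ j)
    have e₀ := fun i j => mul_nonneg hE₀ (b i j)
    have e₁ := fun i j => mul_nonneg hE₁ (b i j)
    refine quad_nonneg_of_coeff hZ hZM ?_ ?_ ?_
    · simp only [coeffA]
      linarith [b 0 2, b 1 1, b 2 0]
    · simp only [coeffC₁, coeffβ, coeffγ, coeffA]
      linarith [e₀ 0 4, e₀ 1 3, e₀ 2 2, e₀ 3 1, e₀ 4 0, e₁ 0 4, e₁ 1 3, e₁ 2 2, e₁ 3 1, e₁ 4 0]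
    · simp only [coeffC₁, coeffC₂, coeffβ, coeffγ, coeffA]
      linarith [e₀ 0 4, e₀ 1 3, e₀ 2 2, e₀ 3 1, e₀ 4 0, e₁ 0 4, e₁ 1 3, e₁ 2 2, e₁ 3 1, e₁ 4 0]
  rcases le_or_gt t (561/250) with h | h
  · have h₀ : 0 ≤ t - (1343/1000) := by linarith
    have h₁ : 0 ≤ (561/250) - t := by linarith
    have b := fun i j : ℕ => mul_nonneg (pow_nonneg h₀ i) (pow_nonneg h₁ j)
    have e₀ := fun i j => mul_nonneg hE₀ (b i j)
    have e₁ := fun i j => mul_nonneg hE₁ (b i j)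
    refine quad_nonneg_of_disc (m := (911/10000) * t ^ 2) hZ ?_ ?_ ?_ ?_
    · simp only [coeffA]
      linarith [b 0 2, b 1 1, b 2 0]
    · simp only [coeffC₂, coeffβ, coeffγ]
      linarith [e₀ 0 3, e₀ 1 2, e₀ 2 1, e₀ 3 0, e₁ 0 3, e₁ 1 2, e₁ 2 1, e₁ 3 0]
    · simp only [coeffC₂, coeffβ, coeffγ, coeffA]
      linarith [e₀ 0 5, e₀ 1 4, e₀ 2 3, e₀ 3 2, e₀ 4 1, e₀ 5 0, e₁ 0 5, e₁ 1 4, e₁ 2 3, e₁ 3 2,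
        e₁ 4 1, e₁ 5 0]
    · simp only [coeffC₁, coeffβ, coeffγ, coeffA]
      linarith [e₀ 0 4, e₀ 1 3, e₀ 2 2, e₀ 3 1, e₀ 4 0, e₁ 0 4, e₁ 1 3, e₁ 2 2, e₁ 3 1, e₁ 4 0]
  rcases le_or_gt t (6539/1000) with h | h
  · have h₀ : 0 ≤ t - (561/250) := by linarith
    have h₁ : 0 ≤ (6539/1000) - t := by linarith
    have b := fun i j : ℕ => mul_nonneg (pow_nonneg h₀ i) (pow_nonneg h₁ j)
    have e₀ := fun i j => mul_nonneg hE₀ (b i j)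
    have e₁ := fun i j => mul_nonneg hE₁ (b i j)
    refine quad_nonneg_of_disc (m := (1517/10000) * t ^ 2) hZ ?_ ?_ ?_ ?_
    · simp only [coeffA]
      linarith [b 0 2, b 1 1, b 2 0]
    · simp only [coeffC₂, coeffβ, coeffγ]
      linarith [e₀ 0 3, e₀ 1 2, e₀ 2 1, e₀ 3 0, e₁ 0 3, e₁ 1 2, e₁ 2 1, e₁ 3 0]
    · simp only [coeffC₂, coeffβ, coeffγ, coeffA]
      linarith [e₀ 0 5, e₀ 1 4, e₀ 2 3, e₀ 3 2, e₀ 4 1, e₀ 5 0, e₁ 0 5, e₁ 1 4, e₁ 2 3, e₁ 3 2,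
        e₁ 4 1, e₁ 5 0]
    · simp only [coeffC₁, coeffβ, coeffγ, coeffA]
      linarith [e₀ 0 4, e₀ 1 3, e₀ 2 2, e₀ 3 1, e₀ 4 0, e₁ 0 4, e₁ 1 3, e₁ 2 2, e₁ 3 1, e₁ 4 0]
  have h₀ : 0 ≤ t - (6539/1000) := by linarith
  have b := fun i : ℕ => pow_nonneg h₀ i
  have e₀ := fun i => mul_nonneg hE₀ (b i)
  have e₁ := fun i => mul_nonneg hE₁ (b i)
  refine quad_nonneg_of_disc (m := (71/500) * t ^ 2) hZ ?_ ?_ ?_ ?_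
  · simp only [coeffA]
    linarith [b 0, b 1, b 2]
  · simp only [coeffC₂, coeffβ, coeffγ]
    linarith [e₀ 0, e₀ 1, e₀ 2, e₀ 3, e₁ 0, e₁ 1, e₁ 2, e₁ 3]
  · simp only [coeffC₂, coeffβ, coeffγ, coeffA]
    linarith [e₀ 0, e₀ 1, e₀ 2, e₀ 3, e₀ 4, e₀ 5, e₁ 0, e₁ 1, e₁ 2, e₁ 3, e₁ 4, e₁ 5]
  · simp only [coeffC₁, coeffβ, coeffγ, coeffA]
    linarith [e₀ 0, e₀ 1, e₀ 2, e₀ 3, e₀ 4, e₁ 0, e₁ 1, e₁ 2, e₁ 3, e₁ 4]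

end DulacData

/-- `f` is an arc of an orbit of `ẋ = y`, `ẏ = -x³ - A x² y + y³` in the upper half-plane, over
the interval `[p, q]` with `p < 0 < q`, extended by zero. -/
structure Arc (A p q : ℝ) (f : ℝ → ℝ) : Prop where
  neg : p < 0
  pos : 0 < q
  cont : Continuous f
  eq_zero_left : ∀ x ≤ p, f x = 0
  eq_zero_right : ∀ x, q ≤ x → f x = 0
  pos_of_mem : ∀ x ∈ Ioo p q, 0 < f x
  deriv : ∀ x ∈ Ioo p q, HasDerivAt f ((-x ^ 3 - A * x ^ 2 * f x + f x ^ 3) / f x) x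

namespace Arc

variable {A p q r : ℝ} {f : ℝ → ℝ}

theorem le_comp_neg (h : Arc A (-r) q f) {B a b : ℝ} {η η' : ℝ → ℝ} (hB : B ≤ A) (ha : 0 ≤ a)
    (hab : a < b) (har : a < r) (hη : ∀ x, HasDerivAt η (η' x) x) (hpos : ∀ x ∈ Icc a b, 0 < η x)
    (hlt : ∀ x ∈ Icc a b, η x * η' x < -x ^ 3 + B * x ^ 2 * η x - η x ^ 3)
    (hle : η a ≤ f (-a)) : b < r ∧ η b ≤ f (-b) := by
  have key : ∀ x ∈ Icc a (min b r), η x ≤ f (-x) := by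
    refine image_le_of_deriv_right_lt_deriv_boundary'
      (B' := fun x => (-x ^ 3 + A * x ^ 2 * f (-x) - f (-x) ^ 3) / f (-x))
      (fun x _ => (hη x).continuousAt.continuousWithinAt)
      (fun x _ => (hη x).hasDerivWithinAt) hle (h.cont.comp continuous_neg).continuousOn
      ?_ ?_
    · intro x hx
      have hx' : -x ∈ Ioo (-r) q :=
        ⟨by linarith [hx.2.trans_le (min_le_right b r)], by linarith [hx.1, h.pos]⟩
      have hf := h.pos_of_mem _ hx'
      refine HasDerivAt.hasDerivWithinAt ?_
      refine ((h.deriv _ hx').comp x (hasDerivAt_neg x)).congr_deriv ?_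
      field_simp
      ring
    · intro x hx he
      have hxb : x ∈ Icc a b := ⟨hx.1, (hx.2.trans_le (min_le_left b r)).le⟩
      have hp := hpos x hxb
      rw [← he, lt_div_iff₀ hp]
      have h1 := hlt x hxb
      have h2 : B * (x ^ 2 * η x) ≤ A * (x ^ 2 * η x) :=
        mul_le_mul_of_nonneg_right hB (by positivity)
      linarith
  have hbr : b < r := by
    by_contra! hrb
    have h1 := key r ⟨har.le, by rw [min_eq_right hrb]⟩
    rw [h.eq_zero_left _ le_rfl] at h1
    linarith [hpos r ⟨har.le, hrb⟩]
  exact ⟨hbr, key b ⟨hab.le, by rw [min_eq_left hbr.le]⟩⟩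

theorem le_barrier (h : Arc A p r f) {B a b : ℝ} {η η' : ℝ → ℝ} (hB : B ≤ A) (ha : 0 ≤ a)
    (hab : a < b) (hbr : b < r) (hη : ∀ x, HasDerivAt η (η' x) x)
    (hlt : ∀ x ∈ Icc a b, -x ^ 3 - B * x ^ 2 * η x + η x ^ 3 < η x * η' x)
    (hle : f a ≤ η a) : f b ≤ η b := by
  have key : ∀ x ∈ Icc a b, f x ≤ η x := by
    have hx' : ∀ x ∈ Ico a b, x ∈ Ioo p r := fun x hx =>
      ⟨by linarith [hx.1, h.neg], hx.2.trans hbr⟩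
    refine image_le_of_deriv_right_lt_deriv_boundary' h.cont.continuousOn
      (fun x hx => (h.deriv x (hx' x hx)).hasDerivWithinAt) hle
      (fun x _ => (hη x).continuousAt.continuousWithinAt) (fun x _ => (hη x).hasDerivWithinAt) ?_
    intro x hx he
    have hp := h.pos_of_mem x (hx' x hx)
    rw [div_lt_iff₀ hp, he, mul_comm (η' x)]
    rw [he] at hp
    have h1 := hlt x (Ico_subset_Icc_self hx)
    have h2 : B * (x ^ 2 * η x) ≤ A * (x ^ 2 * η x) :=
      mul_le_mul_of_nonneg_right hB (by positivity)
    linarith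
  exact key b (right_mem_Icc.2 hab.le)

end Arc

noncomputable def quartic (a b c d e x : ℝ) : ℝ := a + b * x + c * x ^ 2 + d * x ^ 3 + e * x ^ 4

noncomputable def quartic' (b c d e x : ℝ) : ℝ := b + 2 * c * x + 3 * d * x ^ 2 + 4 * e * x ^ 3

theorem hasDerivAt_quartic (a b c d e x : ℝ) :
    HasDerivAt (quartic a b c d e) (quartic' b c d e x) x := by
  have h := hasDerivAt_id x
  have := ((((h.const_mul b).const_add a).add ((h.pow 2).const_mul c)).add
    ((h.pow 3).const_mul d)).add ((h.pow 4).const_mul e)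
  refine this.congr_deriv ?_
  simp [quartic']
  ring

namespace Arc

variable {A p q r : ℝ} {f : ℝ → ℝ}

theorem lower_first_pos {x : ℝ} (ha : 0 ≤ x) (hb : x ≤ (4/5)) :
    0 < quartic (8381/10000) (-3557/5000) (6289/10000) (1557/10000) (-1977/10000) x := by
  simp only [quartic]
  have h₀ : 0 ≤ x - 0 := by linarith
  have h₁ : 0 ≤ (4/5) - x := by linarith
  have b := fun i j : ℕ => mul_nonneg (pow_nonneg h₀ i) (pow_nonneg h₁ j)
  linarith [b 0 4, b 1 3, b 2 2, b 3 1, b 4 0]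

theorem lower_first_lt {x : ℝ} (ha : 0 ≤ x) (hb : x ≤ (4/5)) :
    quartic (8381/10000) (-3557/5000) (6289/10000) (1557/10000) (-1977/10000) x *
      quartic' (-3557/5000) (6289/10000) (1557/10000) (-1977/10000) x <
      -x ^ 3 + 221 / 100 * x ^ 2 *
        quartic (8381/10000) (-3557/5000) (6289/10000) (1557/10000) (-1977/10000) x -
          quartic (8381/10000) (-3557/5000) (6289/10000) (1557/10000) (-1977/10000) x ^ 3 := by
  simp only [quartic, quartic']
  rcases le_or_gt x (2/5) with h | h
  · have h₀ : 0 ≤ x - 0 := by linarith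
    have h₁ : 0 ≤ (2/5) - x := by linarith
    have b := fun i j : ℕ => mul_nonneg (pow_nonneg h₀ i) (pow_nonneg h₁ j)
    linarith [b 0 12, b 1 11, b 2 10, b 3 9, b 4 8, b 5 7, b 6 6, b 7 5, b 8 4, b 9 3, b 10 2,
      b 11 1, b 12 0]
  have h₀ : 0 ≤ x - (2/5) := by linarith
  have h₁ : 0 ≤ (4/5) - x := by linarith
  have b := fun i j : ℕ => mul_nonneg (pow_nonneg h₀ i) (pow_nonneg h₁ j)
  linarith [b 0 12, b 1 11, b 2 10, b 3 9, b 4 8, b 5 7, b 6 6, b 7 5, b 8 4, b 9 3, b 10 2,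
    b 11 1, b 12 0]

theorem lower_second_pos {x : ℝ} (ha : (4/5) ≤ x) (hb : x ≤ (8/5)) :
    0 < quartic (1043/1250) (-7983/10000) (10189/10000) (-3969/10000) (311/5000) x := by
  simp only [quartic]
  have h₀ : 0 ≤ x - (4/5) := by linarith
  have h₁ : 0 ≤ (8/5) - x := by linarith
  have b := fun i j : ℕ => mul_nonneg (pow_nonneg h₀ i) (pow_nonneg h₁ j)
  linarith [b 0 4, b 1 3, b 2 2, b 3 1, b 4 0]

theorem lower_second_lt {x : ℝ} (ha : (4/5) ≤ x) (hb : x ≤ (8/5)) :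
    quartic (1043/1250) (-7983/10000) (10189/10000) (-3969/10000) (311/5000) x *
      quartic' (-7983/10000) (10189/10000) (-3969/10000) (311/5000) x <
      -x ^ 3 + 221 / 100 * x ^ 2 *
        quartic (1043/1250) (-7983/10000) (10189/10000) (-3969/10000) (311/5000) x -
          quartic (1043/1250) (-7983/10000) (10189/10000) (-3969/10000) (311/5000) x ^ 3 := by
  simp only [quartic, quartic']
  have h₀ : 0 ≤ x - (4/5) := by linarith
  have h₁ : 0 ≤ (8/5) - x := by linarith
  have b := fun i j : ℕ => mul_nonneg (pow_nonneg h₀ i) (pow_nonneg h₁ j)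
  linarith [b 0 12, b 1 11, b 2 10, b 3 9, b 4 8, b 5 7, b 6 6, b 7 5, b 8 4, b 9 3, b 10 2,
    b 11 1, b 12 0]

theorem lower_third_pos {x : ℝ} (ha : (8/5) ≤ x) (hb : x ≤ (11/5)) :
    0 < quartic (2557/10000) (487/1000) (-71/1000) (23/1000) 0 x := by
  simp only [quartic]
  have h₀ : 0 ≤ x - (8/5) := by linarith
  have h₁ : 0 ≤ (11/5) - x := by linarith
  have b := fun i j : ℕ => mul_nonneg (pow_nonneg h₀ i) (pow_nonneg h₁ j)
  linarith [b 0 3, b 1 2, b 2 1, b 3 0]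

theorem lower_third_lt {x : ℝ} (ha : (8/5) ≤ x) (hb : x ≤ (11/5)) :
    quartic (2557/10000) (487/1000) (-71/1000) (23/1000) 0 x *
      quartic' (487/1000) (-71/1000) (23/1000) 0 x <
      -x ^ 3 + 221 / 100 * x ^ 2 * quartic (2557/10000) (487/1000) (-71/1000) (23/1000) 0 x -
        quartic (2557/10000) (487/1000) (-71/1000) (23/1000) 0 x ^ 3 := by
  simp only [quartic, quartic']
  have h₀ : 0 ≤ x - (8/5) := by linarith
  have h₁ : 0 ≤ (11/5) - x := by linarith
  have b := fun i j : ℕ => mul_nonneg (pow_nonneg h₀ i) (pow_nonneg h₁ j)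
  linarith [b 0 9, b 1 8, b 2 7, b 3 6, b 4 5, b 5 4, b 6 3, b 7 2, b 8 1, b 9 0]

theorem lower_tail_pos {x : ℝ} (ha : (11/5) ≤ x) :
    0 < quartic (931/10000) (129/250) 0 0 0 x := by
  simp only [quartic]
  have h₀ : 0 ≤ x - (11/5) := by linarith
  have b := fun i : ℕ => pow_nonneg h₀ i
  linarith [b 0, b 1]

theorem lower_tail_lt {x : ℝ} (ha : (11/5) ≤ x) :
    quartic (931/10000) (129/250) 0 0 0 x * quartic' (129/250) 0 0 0 x <
      -x ^ 3 + 221 / 100 * x ^ 2 * quartic (931/10000) (129/250) 0 0 0 x -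
        quartic (931/10000) (129/250) 0 0 0 x ^ 3 := by
  simp only [quartic, quartic']
  have h₀ : 0 ≤ x - (11/5) := by linarith
  have b := fun i : ℕ => pow_nonneg h₀ i
  linarith [b 0, b 1, b 2, b 3]

theorem upper_first_lt {x : ℝ} (ha : 0 ≤ x) (hb : x ≤ (9/10)) :
    -x ^ 3 - 221 / 100 * x ^ 2 *
      quartic (4191/5000) (1831/2500) (4789/10000) (171/2500) (-349/1000) x +
        quartic (4191/5000) (1831/2500) (4789/10000) (171/2500) (-349/1000) x ^ 3 <
      quartic (4191/5000) (1831/2500) (4789/10000) (171/2500) (-349/1000) x *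
        quartic' (1831/2500) (4789/10000) (171/2500) (-349/1000) x := by
  simp only [quartic, quartic']
  rcases le_or_gt x (9/20) with h | h
  · have h₀ : 0 ≤ x - 0 := by linarith
    have h₁ : 0 ≤ (9/20) - x := by linarith
    have b := fun i j : ℕ => mul_nonneg (pow_nonneg h₀ i) (pow_nonneg h₁ j)
    linarith [b 0 12, b 1 11, b 2 10, b 3 9, b 4 8, b 5 7, b 6 6, b 7 5, b 8 4, b 9 3, b 10 2,
      b 11 1, b 12 0]
  have h₀ : 0 ≤ x - (9/20) := by linarith
  have h₁ : 0 ≤ (9/10) - x := by linarith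
  have b := fun i j : ℕ => mul_nonneg (pow_nonneg h₀ i) (pow_nonneg h₁ j)
  linarith [b 0 12, b 1 11, b 2 10, b 3 9, b 4 8, b 5 7, b 6 6, b 7 5, b 8 4, b 9 3, b 10 2,
    b 11 1, b 12 0]

theorem upper_second_lt {x : ℝ} (ha : (9/10) ≤ x) (hb : x ≤ (13/10)) :
    -x ^ 3 - 221 / 100 * x ^ 2 *
      quartic (-12121/2500) (15393/625) (-94047/2500) (274587/10000) (-78607/10000) x +
        quartic (-12121/2500) (15393/625) (-94047/2500) (274587/10000) (-78607/10000) x ^ 3 <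
      quartic (-12121/2500) (15393/625) (-94047/2500) (274587/10000) (-78607/10000) x *
        quartic' (15393/625) (-94047/2500) (274587/10000) (-78607/10000) x := by
  simp only [quartic, quartic']
  rcases le_or_gt x (11/10) with h | h
  · have h₀ : 0 ≤ x - (9/10) := by linarith
    have h₁ : 0 ≤ (11/10) - x := by linarith
    have b := fun i j : ℕ => mul_nonneg (pow_nonneg h₀ i) (pow_nonneg h₁ j)
    linarith [b 0 12, b 1 11, b 2 10, b 3 9, b 4 8, b 5 7, b 6 6, b 7 5, b 8 4, b 9 3, b 10 2,
      b 11 1, b 12 0]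
  have h₀ : 0 ≤ x - (11/10) := by linarith
  have h₁ : 0 ≤ (13/10) - x := by linarith
  have b := fun i j : ℕ => mul_nonneg (pow_nonneg h₀ i) (pow_nonneg h₁ j)
  linarith [b 0 12, b 1 11, b 2 10, b 3 9, b 4 8, b 5 7, b 6 6, b 7 5, b 8 4, b 9 3, b 10 2,
    b 11 1, b 12 0]

theorem upper_third_lt {x : ℝ} (ha : (13/10) ≤ x) (hb : x ≤ (13/8)) :
    -x ^ 3 - 221 / 100 * x ^ 2 * quartic (-7631/800) (1887/100) (-8) 0 0 x +
      quartic (-7631/800) (1887/100) (-8) 0 0 x ^ 3 <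
      quartic (-7631/800) (1887/100) (-8) 0 0 x * quartic' (1887/100) (-8) 0 0 x := by
  simp only [quartic, quartic']
  have h₀ : 0 ≤ x - (13/10) := by linarith
  have h₁ : 0 ≤ (13/8) - x := by linarith
  have b := fun i j : ℕ => mul_nonneg (pow_nonneg h₀ i) (pow_nonneg h₁ j)
  linarith [b 0 6, b 1 5, b 2 4, b 3 3, b 4 2, b 5 1, b 6 0]

theorem apply_zero_lt (h : Arc A (-r) q f) (hA : 221 / 100 ≤ A) : f 0 < 8381 / 10000 := by
  by_contra! h0
  have hr : 0 < r := by linarith [h.neg]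
  have h1 := h.le_comp_neg (a := 0) (b := (4/5)) hA (by norm_num) (by norm_num) hr
    (hasDerivAt_quartic (8381/10000) (-3557/5000) (6289/10000) (1557/10000) (-1977/10000))
    (fun x hx => lower_first_pos hx.1 hx.2)
    (fun x hx => lower_first_lt hx.1 hx.2)
    (by rw [neg_zero]; norm_num [quartic]; linarith)
  have h2 := h.le_comp_neg (a := 4/5) (b := (8/5)) hA (by norm_num) (by norm_num) h1.1
    (hasDerivAt_quartic (1043/1250) (-7983/10000) (10189/10000) (-3969/10000) (311/5000))
    (fun x hx => lower_second_pos hx.1 hx.2)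
    (fun x hx => lower_second_lt hx.1 hx.2)
    (le_trans (by norm_num [quartic]) h1.2)
  have h3 := h.le_comp_neg (a := 8/5) (b := (11/5)) hA (by norm_num) (by norm_num) h2.1
    (hasDerivAt_quartic (2557/10000) (487/1000) (-71/1000) (23/1000) 0)
    (fun x hx => lower_third_pos hx.1 hx.2)
    (fun x hx => lower_third_lt hx.1 hx.2)
    (le_trans (by norm_num [quartic]) h2.2)
  have h4 := h.le_comp_neg (a := 11/5) (b := (r + 3)) hA (by norm_num) (by linarith) h3.1
    (hasDerivAt_quartic (931/10000) (129/250) 0 0 0)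
    (fun x hx => lower_tail_pos hx.1)
    (fun x hx => lower_tail_lt hx.1)
    (le_trans (by norm_num [quartic]) h3.2)
  linarith [h4.1]

theorem radius_le (h : Arc A p r f) (hA : 221 / 100 ≤ A) (h0 : f 0 < 8381 / 10000) :
    r ≤ 13 / 8 := by
  by_contra! hr
  have h1 := h.le_barrier (a := 0) (b := (9/10)) hA (by norm_num) (by norm_num) (by linarith)
    (hasDerivAt_quartic (4191/5000) (1831/2500) (4789/10000) (171/2500) (-349/1000))
    (fun x hx => upper_first_lt hx.1 hx.2)
    (by norm_num [quartic]; linarith)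
  have h2 := h.le_barrier (a := 9/10) (b := (13/10)) hA (by norm_num) (by norm_num) (by linarith)
    (hasDerivAt_quartic (-12121/2500) (15393/625) (-94047/2500) (274587/10000) (-78607/10000))
    (fun x hx => upper_second_lt hx.1 hx.2)
    (le_trans h1 (by norm_num [quartic]))
  have h3 := h.le_barrier (a := 13/10) (b := (13/8)) hA (by norm_num) (by norm_num) (by linarith)
    (hasDerivAt_quartic (-7631/800) (1887/100) (-8) 0 0)
    (fun x hx => upper_third_lt hx.1 hx.2)
    (le_trans h2 (by norm_num [quartic]))
  have h4 := h.pos_of_mem (13 / 8) ⟨by linarith [h.neg], hr⟩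
  norm_num [quartic] at h3
  linarith

end Arc

namespace Arc

variable {A r r₁ r₂ : ℝ} {f f₁ f₂ : ℝ → ℝ}

theorem hasDerivAt_right {w : ℝ} (hw : 0 < w) (h : Arc (w ^ 2) (-r) r f) (k μ P g σ : ℝ) {X : ℝ}
    (hX : X ∈ Ioo 0 (r / w)) :
    HasDerivAt (fun X => f (w * X) / w ^ 2)
      ((DulacData.weight (-1) k μ P g σ (w ^ 3)).q X (f (w * X) / w ^ 2) / (f (w * X) / w ^ 2))
      X := by
  have h1 : w * X < r := by rw [mul_comm]; exact (lt_div_iff₀ hw).1 hX.2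
  have h0 := mul_pos hw hX.1
  have hx : w * X ∈ Ioo (-r) r := ⟨by linarith [h.pos], h1⟩
  have hf := h.pos_of_mem _ hx
  have h2 := ((h.deriv _ hx).comp X ((hasDerivAt_id X).const_mul w)).div_const (w ^ 2)
  refine h2.congr_deriv ?_
  simp only [DulacData.q, DulacData.weight]
  field_simp
  ring

theorem hasDerivAt_left {w : ℝ} (hw : 0 < w) (h : Arc (w ^ 2) (-r) r f) (k μ P g σ : ℝ) {X : ℝ}
    (hX : X ∈ Ioo 0 (r / w)) :
    HasDerivAt (fun X => f (-(w * X)) / w ^ 2)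
      ((DulacData.weight 1 k μ P g σ (w ^ 3)).q X (f (-(w * X)) / w ^ 2) /
        (f (-(w * X)) / w ^ 2)) X := by
  have h1 : w * X < r := by rw [mul_comm]; exact (lt_div_iff₀ hw).1 hX.2
  have h0 := mul_pos hw hX.1
  have hx : -(w * X) ∈ Ioo (-r) r := ⟨by linarith [h.pos], by linarith [h.pos]⟩
  have hf := h.pos_of_mem _ hx
  have h2 := ((h.deriv _ hx).comp X ((hasDerivAt_id X).const_mul w).neg).div_const (w ^ 2)
  refine h2.congr_deriv ?_
  simp only [DulacData.q, DulacData.weight]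
  field_simp
  ring

theorem false_of_quadForm {w : ℝ} (hw : 0 < w) (h₁ : Arc (w ^ 2) (-r₁) r₁ f₁)
    (h₂ : Arc (w ^ 2) (-r₂) r₂ f₂) (hr : r₁ < r₂) (hf : ∀ x ∈ Icc (-r₁) r₁, f₁ x ≤ f₂ x)
    {k k' μ P P' g σ : ℝ} (hk : k < k') (hμ : 0 < μ) (hP' : 0 ≤ P') (hg : w ^ 3 * P ^ 2 ≤ g)
    (hl : ∀ t X, 0 ≤ t → X ∈ Ioo 0 (r₂ / w) →
      0 ≤ DulacData.quadForm 1 k μ P g σ (w ^ 3) t (X ^ 2))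
    (hR : ∀ t X, 0 ≤ t → X ∈ Ioo 0 (r₂ / w) →
      0 ≤ DulacData.quadForm (-1) k' μ P' 0 σ (w ^ 3) t (X ^ 2)) : False := by
  have hE : 0 < w ^ 3 := by positivity
  have mem : ∀ {r X : ℝ}, X ∈ Ico 0 (r / w) → 0 ≤ w * X ∧ w * X < r := fun {r X} hX =>
    ⟨mul_nonneg hw.le hX.1, by rw [mul_comm]; exact (lt_div_iff₀ hw).1 hX.2⟩
  have pos_right : ∀ {r : ℝ} {f : ℝ → ℝ}, Arc (w ^ 2) (-r) r f → ∀ X ∈ Ico 0 (r / w),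
      0 < f (w * X) / w ^ 2 := fun h X hX =>
    div_pos (h.pos_of_mem _ ⟨by linarith [mem hX, h.pos], (mem hX).2⟩) (by positivity)
  have pos_left : ∀ {r : ℝ} {f : ℝ → ℝ}, Arc (w ^ 2) (-r) r f → ∀ X ∈ Ico 0 (r / w),
      0 < f (-(w * X)) / w ^ 2 := fun h X hX =>
    div_pos (h.pos_of_mem _ ⟨by linarith [mem hX], by linarith [mem hX, h.pos]⟩) (by positivity)
  have zero_right : ∀ {r : ℝ} {f : ℝ → ℝ}, Arc (w ^ 2) (-r) r f → ∀ X, r / w ≤ X →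
      f (w * X) / w ^ 2 = 0 := fun h X hX => by
    rw [h.eq_zero_right _ (by rw [mul_comm]; exact (div_le_iff₀ hw).1 hX), zero_div]
  have zero_left : ∀ {r : ℝ} {f : ℝ → ℝ}, Arc (w ^ 2) (-r) r f → ∀ X, r / w ≤ X →
      f (-(w * X)) / w ^ 2 = 0 := fun h X hX => by
    rw [h.eq_zero_left _ (neg_le_neg (by rw [mul_comm]; exact (div_le_iff₀ hw).1 hX)), zero_div]
  have hc₁ := h₁.cont
  have hc₂ := h₂.cont
  refine DulacData.dulac (l := .weight 1 k μ P g σ (w ^ 3)) (r := .weight (-1) k' μ P' 0 σ (w ^ 3))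
    (R₁ := r₁ / w) (R₂ := r₂ / w) (u₁ := fun X => f₁ (-(w * X)) / w ^ 2)
    (u₂ := fun X => f₂ (-(w * X)) / w ^ 2) (v₁ := fun X => f₁ (w * X) / w ^ 2)
    (v₂ := fun X => f₂ (w * X) / w ^ 2)
    (DulacData.good_weight hμ hE.le (le_trans (by positivity) hg) (Or.inr hg))
    (DulacData.good_weight hμ hE.le le_rfl (Or.inl hP')) rfl rfl
    (mul_lt_mul_of_pos_right hk hE) (div_pos h₁.pos hw) (div_lt_div_of_pos_right hr hw)
    (fun X hX Y hY => DulacData.D_left hμ hE.le hX.1 (hl _ X (div_pos hY hX.1).le hX))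
    (fun X hX Y hY => DulacData.D_right hμ hE.le hX.1 (hR _ X (div_pos hY hX.1).le hX))
    (by fun_prop) (by fun_prop) (by fun_prop) (by fun_prop)
    (pos_left h₁) (pos_right h₁) (pos_left h₂) (pos_right h₂) (zero_left h₁) (zero_right h₁)
    (zero_left h₂ _ le_rfl) (zero_right h₂ _ le_rfl)
    (fun X hX => h₁.hasDerivAt_left hw _ _ _ _ _ hX)
    (fun X hX => h₁.hasDerivAt_right hw _ _ _ _ _ hX)
    (fun X hX => h₂.hasDerivAt_left hw _ _ _ _ _ hX)
    (fun X hX => h₂.hasDerivAt_right hw _ _ _ _ _ hX) (by simp) (by simp) ?_ ?_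
  · intro X hX
    exact div_le_div_of_nonneg_right (hf _ ⟨by linarith [mem hX], by linarith [mem hX, h₁.pos]⟩)
      (by positivity)
  · intro X hX
    exact div_le_div_of_nonneg_right (hf _ ⟨by linarith [mem hX, h₁.pos], (mem hX).2.le⟩)
      (by positivity)

/-- Two nested symmetric arcs cannot coexist. -/
theorem false_of_lt (hA₀ : 0 < A) (hA : A ^ 3 < 27 / 2) (h₁ : Arc A (-r₁) r₁ f₁)
    (h₂ : Arc A (-r₂) r₂ f₂) (hr : r₁ < r₂) (hf : ∀ x ∈ Icc (-r₁) r₁, f₁ x ≤ f₂ x) : False := by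
  obtain ⟨w, hw, rfl⟩ : ∃ w : ℝ, 0 < w ∧ w ^ 2 = A := ⟨√A, Real.sqrt_pos.2 hA₀, Real.sq_sqrt hA₀.le⟩
  have hE : 0 < w ^ 3 := by positivity
  have hEE : (w ^ 3) ^ 2 = (w ^ 2) ^ 3 := by ring
  have hE_lt : w ^ 3 < 147 / 40 := by
    by_contra! h
    nlinarith
  rcases le_or_gt (w ^ 3) (23 / 10) with h | h
  · exact false_of_quadForm hw h₁ h₂ hr hf (by norm_num) (by norm_num) (by norm_num)
      (by linarith)
      (fun t X ht _ => DulacData.quadForm_left_small hE.le h ht (sq_nonneg X))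
      (fun t X ht _ => DulacData.quadForm_right_small hE.le h ht (sq_nonneg X))
  rcases le_or_gt (221 / 100) (w ^ 2) with h' | h'
  · have hE_gt : 657 / 200 ≤ w ^ 3 := by
      by_contra! h3
      have := pow_le_pow_left₀ (by norm_num) h' 3
      norm_num at this
      nlinarith
    have hX : ∀ X ∈ Ioo 0 (r₂ / w), X ^ 2 ≤ 6 / 5 := by
      intro X hX
      have h4 := h₂.radius_le h' (h₂.apply_zero_lt h')
      have h5 : X * w < r₂ := (lt_div_iff₀ hw).1 hX.2
      have h6 : (X * w) ^ 2 ≤ (13 / 8) ^ 2 :=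
        pow_le_pow_left₀ (mul_nonneg hX.1.le hw.le) (by linarith) 2
      rw [mul_pow] at h6
      by_contra! h7
      nlinarith
    exact false_of_quadForm hw h₁ h₂ hr hf (by norm_num) (by norm_num) (by norm_num)
      (by linarith)
      (fun t X ht hx => DulacData.quadForm_left_large hE_gt hE_lt.le ht (sq_nonneg X) (hX X hx))
      (fun t X ht hx => DulacData.quadForm_right_large hE_gt hE_lt.le ht (sq_nonneg X) (hX X hx))
  · have hE_le : w ^ 3 ≤ 1643 / 500 := by
      by_contra! h3
      have := pow_le_pow_left₀ (by positivity) h'.le 3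
      norm_num at this
      nlinarith
    exact false_of_quadForm hw h₁ h₂ hr hf (by norm_num) (by norm_num) (by norm_num)
      (by linarith)
      (fun t X ht _ => DulacData.quadForm_left_medium h.le hE_le ht (sq_nonneg X))
      (fun t X ht _ => DulacData.quadForm_right_medium h.le hE_le ht (sq_nonneg X))

end Arc

namespace Arc

variable {A p p₁ p₂ q q₁ q₂ : ℝ} {f f₁ f₂ : ℝ → ℝ}

theorem nonneg (h : Arc A p q f) (x : ℝ) : 0 ≤ f x := by
  rcases le_or_gt x p with h1 | h1
  · exact (h.eq_zero_left x h1).ge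
  rcases le_or_gt q x with h2 | h2
  · exact (h.eq_zero_right x h2).ge
  · exact (h.pos_of_mem x ⟨h1, h2⟩).le

theorem hasDerivAt_sub (h₁ : Arc A p₁ q₁ f₁) (h₂ : Arc A p₂ q₂ f₂) {x : ℝ} (hx₁ : x ∈ Ioo p₁ q₁)
    (hx₂ : x ∈ Ioo p₂ q₂) : HasDerivAt (fun x => f₂ x - f₁ x)
      ((x ^ 3 / (f₁ x * f₂ x) + f₁ x + f₂ x) * (f₂ x - f₁ x)) x := by
  have pos₁ := h₁.pos_of_mem x hx₁
  have pos₂ := h₂.pos_of_mem x hx₂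
  refine ((h₂.deriv x hx₂).sub (h₁.deriv x hx₁)).congr_deriv ?_
  field_simp
  ring

theorem eq_of_eq (h₁ : Arc A p₁ q₁ f₁) (h₂ : Arc A p₂ q₂ f₂) (hp : p₂ < p₁) {a c : ℝ}
    (ha : p₁ < a) (hac : a ≤ c) (hc₁ : c < q₁) (hc₂ : c < q₂) (h : f₁ c = f₂ c) :
    f₁ a = f₂ a := by
  have mem₁ : ∀ x ∈ Icc a c, x ∈ Ioo p₁ q₁ := fun x hx => ⟨by linarith [hx.1], by linarith [hx.2]⟩
  have mem₂ : ∀ x ∈ Icc a c, x ∈ Ioo p₂ q₂ := fun x hx => ⟨by linarith [hx.1], by linarith [hx.2]⟩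
  have hcont : ContinuousOn (fun x => x ^ 3 / (f₁ x * f₂ x) + f₁ x + f₂ x) (Icc a c) := by
    have hc₁ := h₁.cont
    have hc₂ := h₂.cont
    refine ((ContinuousOn.div (by fun_prop) (by fun_prop) fun x hx => ?_).add
      hc₁.continuousOn).add hc₂.continuousOn
    exact (mul_pos (h₁.pos_of_mem x (mem₁ x hx)) (h₂.pos_of_mem x (mem₂ x hx))).ne'
  obtain ⟨m, hm⟩ := isCompact_Icc.bddBelow_image hcont
  have hder : ∀ x ∈ Icc a c, HasDerivAt
      (fun x => (f₂ x - f₁ x) ^ 2 * Real.exp (-(2 * m) * x))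
      (2 * ((x ^ 3 / (f₁ x * f₂ x) + f₁ x + f₂ x) - m) *
        ((f₂ x - f₁ x) ^ 2 * Real.exp (-(2 * m) * x))) x := by
    intro x hx
    refine (((h₁.hasDerivAt_sub h₂ (mem₁ x hx) (mem₂ x hx)).pow 2).mul
      ((hasDerivAt_id x).const_mul (-(2 * m))).exp).congr_deriv ?_
    simp
    ring
  have hmono : MonotoneOn (fun x => (f₂ x - f₁ x) ^ 2 * Real.exp (-(2 * m) * x)) (Icc a c) := by
    refine monotoneOn_of_hasDerivWithinAt_nonneg (convex_Icc a c)
      (fun x hx => (hder x hx).continuousAt.continuousWithinAt)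
      (fun x hx => (hder x (interior_subset hx)).hasDerivWithinAt) fun x hx => ?_
    have := hm (mem_image_of_mem _ (interior_subset hx))
    refine mul_nonneg (by linarith) (by positivity)
  have h0 := hmono (left_mem_Icc.2 hac) (right_mem_Icc.2 hac) hac
  simp only [h, sub_self] at h0
  have h1 := Real.exp_pos (-(2 * m) * a)
  have h2 : (f₂ a - f₁ a) ^ 2 ≤ 0 := by
    by_contra! h3
    linarith [mul_pos h3 h1]
  nlinarith [sq_nonneg (f₂ a - f₁ a)]

/-- Arcs are nested: the one which starts further to the left lies above. -/
theorem lt_of_lt (h₁ : Arc A p₁ q₁ f₁) (h₂ : Arc A p₂ q₂ f₂) (hp : p₂ < p₁) :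
    q₁ < q₂ ∧ ∀ x ∈ Icc p₁ q₁, f₁ x < f₂ x := by
  have hc₁ := h₁.cont
  have hc₂ := h₂.cont
  have hp₁ : f₁ p₁ < f₂ p₁ := by
    rw [h₁.eq_zero_left _ le_rfl]
    exact h₂.pos_of_mem _ ⟨hp, h₁.neg.trans h₂.pos⟩
  have hne : ∀ c ∈ Icc p₁ (min q₁ q₂), c < min q₁ q₂ → f₁ c ≠ f₂ c := by
    intro c hc hcq h
    have h3 : Tendsto (fun x => f₂ x - f₁ x) (𝓝[>] p₁) (𝓝 (f₂ p₁ - f₁ p₁)) :=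
      (hc₂.sub hc₁).continuousWithinAt
    have hpc : p₁ < c := lt_of_le_of_ne hc.1 fun h4 => by rw [← h4] at h; exact hp₁.ne h
    have h4 : (fun x => f₂ x - f₁ x) =ᶠ[𝓝[>] p₁] fun _ => 0 := by
      filter_upwards [Ioo_mem_nhdsGT hpc] with x hx
      rw [h₁.eq_of_eq h₂ hp hx.1 hx.2.le (hcq.trans_le (min_le_left _ _))
        (hcq.trans_le (min_le_right _ _)) h, sub_self]
    have := tendsto_nhds_unique h3 (tendsto_const_nhds.congr' h4.symm)
    linarith
  have hlt : ∀ x, p₁ ≤ x → x < min q₁ q₂ → f₁ x < f₂ x := by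
    intro x hx hxq
    by_contra! h
    obtain ⟨c, hc, hc0⟩ := intermediate_value_Icc hx (hc₁.sub hc₂).continuousOn
      (show (0 : ℝ) ∈ Icc (f₁ p₁ - f₂ p₁) (f₁ x - f₂ x) from ⟨by linarith, by linarith⟩)
    exact hne c ⟨hc.1, hc.2.trans hxq.le⟩ (hc.2.trans_lt hxq) (sub_eq_zero.1 hc0)
  have hq : 0 < min q₁ q₂ := lt_min h₁.pos h₂.pos
  have hmono : MonotoneOn (fun x => f₂ x - f₁ x) (Icc 0 (min q₁ q₂)) := by
    have mem : ∀ x ∈ Ioo 0 (min q₁ q₂), x ∈ Ioo p₁ q₁ ∧ x ∈ Ioo p₂ q₂ := fun x hx =>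
      ⟨⟨h₁.neg.trans hx.1, hx.2.trans_le (min_le_left _ _)⟩,
        ⟨h₂.neg.trans hx.1, hx.2.trans_le (min_le_right _ _)⟩⟩
    refine monotoneOn_of_hasDerivWithinAt_nonneg (convex_Icc _ _) (hc₂.sub hc₁).continuousOn
      (f' := fun x => (x ^ 3 / (f₁ x * f₂ x) + f₁ x + f₂ x) * (f₂ x - f₁ x)) ?_ ?_
    · rw [interior_Icc]
      exact fun x hx => (h₁.hasDerivAt_sub h₂ (mem x hx).1 (mem x hx).2).hasDerivWithinAt
    · rw [interior_Icc]
      intro x hx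
      have := h₁.pos_of_mem x (mem x hx).1
      have := h₂.pos_of_mem x (mem x hx).2
      have := hx.1
      have := hlt x (h₁.neg.trans hx.1).le hx.2
      exact mul_nonneg (by positivity) (by linarith)
  have h0 := hmono (left_mem_Icc.2 hq.le) (right_mem_Icc.2 hq.le) hq.le
  have h1 := hlt 0 h₁.neg.le hq
  have h2 : f₁ (min q₁ q₂) < f₂ (min q₁ q₂) := by simp only at h0; linarith
  have hqq : q₁ < q₂ := by
    by_contra! h
    rw [min_eq_right h, h₂.eq_zero_right _ le_rfl] at h2
    linarith [h₁.nonneg q₂]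
  rw [min_eq_left hqq.le] at hlt h2
  refine ⟨hqq, fun x hx => hx.2.lt_or_eq.elim (hlt x hx.1) fun h => h ▸ h2⟩

end Arc

namespace IsSolXY

variable {α : ℝ} {x y x₁ y₁ x₂ y₂ : ℝ → ℝ}

theorem continuous_fst (h : IsSolXY α x y) : Continuous x :=
  continuous_iff_continuousAt.2 fun t => (h t).1.continuousAt

theorem continuous_snd (h : IsSolXY α x y) : Continuous y :=
  continuous_iff_continuousAt.2 fun t => (h t).2.continuousAt

theorem neg (h : IsSolXY α x y) : IsSolXY α (fun t => -x t) (fun t => -y t) := fun t =>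
  ⟨(h t).1.neg, (h t).2.neg.congr_deriv (by ring)⟩

theorem comp_add_const (h : IsSolXY α x y) (c : ℝ) :
    IsSolXY α (fun t => x (t + c)) (fun t => y (t + c)) := fun t =>
  ⟨(h (t + c)).1.comp_add_const t c, (h (t + c)).2.comp_add_const t c⟩

theorem zero : IsSolXY α (fun _ => 0) (fun _ => 0) := fun t =>
  ⟨hasDerivAt_const t 0, (hasDerivAt_const t 0).congr_deriv (by ring)⟩

theorem eq_of_eq (h₁ : IsSolXY α x₁ y₁) (h₂ : IsSolXY α x₂ y₂) {s : ℝ} (hx : x₁ s = x₂ s)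
    (hy : y₁ s = y₂ s) (t : ℝ) : x₁ t = x₂ t ∧ y₁ t = y₂ t := by
  set v : ℝ × ℝ → ℝ × ℝ := fun p => (p.2, -p.1 ^ 3 + α * p.1 ^ 2 * p.2 + p.2 ^ 3) with hv
  have hvc : ContDiff ℝ 1 v := by fun_prop
  set F : ℝ → ℝ × ℝ := fun t => (x₁ t, y₁ t) with hF
  set G : ℝ → ℝ × ℝ := fun t => (x₂ t, y₂ t) with hG
  have hF' : ∀ t, HasDerivAt F (v (F t)) t := fun t => (h₁ t).1.prodMk (h₁ t).2
  have hG' : ∀ t, HasDerivAt G (v (G t)) t := fun t => (h₂ t).1.prodMk (h₂ t).2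
  have hFc : Continuous F := h₁.continuous_fst.prodMk h₁.continuous_snd
  have hGc : Continuous G := h₂.continuous_fst.prodMk h₂.continuous_snd
  set I := Icc (min s t - 1) (max s t + 1) with hI
  obtain ⟨K, hK⟩ := LocallyLipschitzOn.exists_lipschitzOnWith_of_compact
    ((isCompact_Icc.image (s := I) hFc).union (isCompact_Icc.image (s := I) hGc))
    (hvc.locallyLipschitz.locallyLipschitzOn (s := image F I ∪ image G I))
  have hst : ∀ r, min s t ≤ r → r ≤ max s t → r ∈ Ioo (min s t - 1) (max s t + 1) := fun r h1 h2 =>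
    ⟨by linarith, by linarith⟩
  have heq := ODE_solution_unique_of_mem_Ioo (v := fun _ => v) (s := fun _ => image F I ∪ image G I)
    (f := F) (g := G) (fun _ _ => hK) (hst s (min_le_left _ _) (le_max_left _ _))
    (fun t ht => ⟨hF' t, Or.inl (mem_image_of_mem F (Ioo_subset_Icc_self ht))⟩)
    (fun t ht => ⟨hG' t, Or.inr (mem_image_of_mem G (Ioo_subset_Icc_self ht))⟩)
    (Prod.ext hx hy) (hst t (min_le_right _ _) (le_max_right _ _))
  exact Prod.ext_iff.1 heq

theorem range_eq_of_eq (h₁ : IsSolXY α x₁ y₁) (h₂ : IsSolXY α x₂ y₂) {s₁ s₂ : ℝ}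
    (hx : x₁ s₁ = x₂ s₂) (hy : y₁ s₁ = y₂ s₂) :
    range (fun t => (x₁ t, y₁ t)) = range (fun t => (x₂ t, y₂ t)) := by
  have h := h₁.eq_of_eq (h₂.comp_add_const (s₂ - s₁)) (s := s₁)
    (by simpa using hx) (by simpa using hy)
  have h1 : (fun t => (x₁ t, y₁ t)) = (fun t => (x₂ t, y₂ t)) ∘ fun t => t + (s₂ - s₁) :=
    funext fun t => Prod.ext (h t).1 (h t).2
  rw [h1]
  exact (Equiv.addRight (s₂ - s₁)).surjective.range_comp _

theorem ne_zero (h : IsSolXY α x y) (hn : NonconstSol x y) (t : ℝ) (hy : y t = 0) : x t ≠ 0 := by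
  intro hx
  obtain ⟨s, s', hs⟩ := hn
  have h1 := h.eq_of_eq zero (s := t) hx hy
  exact hs (by rw [(h1 s).1, (h1 s).2, (h1 s').1, (h1 s').2])

end IsSolXY

theorem eventually_mul_neg_of_hasDerivAt {y : ℝ → ℝ} {d a : ℝ} (h : HasDerivAt y d a) (hd : d < 0)
    (h0 : y a = 0) : ∀ᶠ s in 𝓝[≠] a, (s - a) * y s < 0 := by
  filter_upwards [h.tendsto_slope.eventually_lt_const hd, self_mem_nhdsWithin] with s hs hsa
  rw [slope_def_field, h0, sub_zero] at hs
  have h1 : s - a ≠ 0 := sub_ne_zero.2 hsa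
  have h2 : (s - a) * y s = y s / (s - a) * (s - a) ^ 2 := by field_simp
  rw [h2]
  exact mul_neg_of_neg_of_pos hs (by positivity)

theorem exists_zero_pos_Ioo {y : ℝ → ℝ} (hy : Continuous y) {d a b : ℝ} (h : HasDerivAt y d b)
    (hd : d < 0) (hb : y b = 0) (hab : a < b) (ha : y a = 0) :
    ∃ c < b, y c = 0 ∧ ∀ t ∈ Ioo c b, 0 < y t := by
  have h1 : ∀ᶠ s in 𝓝[<] b, 0 < y s := by
    filter_upwards [(eventually_mul_neg_of_hasDerivAt h hd hb).filter_mono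
      (nhdsWithin_mono b fun s (hs : s < b) => hs.ne), self_mem_nhdsWithin] with s hs hsb
    exact pos_of_mul_neg_right hs (sub_neg.2 hsb).le
  obtain ⟨l, hl, hl'⟩ := (mem_nhdsLT_iff_exists_Ioo_subset' hab).1 h1
  obtain ⟨m, hm⟩ := exists_between (max_lt (show l < b from hl) hab)
  have hlm : l < m := (le_max_left _ _).trans_lt hm.1
  have ham : a < m := (le_max_right _ _).trans_lt hm.1
  obtain ⟨c, hc, hmax⟩ := ((isCompact_Icc (a := a) (b := m)).inter_right
    (isClosed_singleton.preimage hy)).exists_isGreatest ⟨a, ⟨le_rfl, ham.le⟩, ha⟩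
  refine ⟨c, hc.1.2.trans_lt hm.2, hc.2, fun t ht => ?_⟩
  rcases le_or_gt t m with htm | htm
  · by_contra! hyt
    obtain ⟨z, hz, hz0⟩ := intermediate_value_Icc htm hy.continuousOn
      (show (0 : ℝ) ∈ Icc (y t) (y m) from ⟨hyt, (hl' ⟨hlm, hm.2⟩).le⟩)
    have := hmax ⟨⟨hc.1.1.trans (ht.1.le.trans hz.1), hz.2⟩, hz0⟩
    linarith [ht.1, hz.1]
  · exact hl' ⟨hlm.trans htm, ht.2⟩

namespace IsSolXY

variable {α : ℝ} {x y : ℝ → ℝ}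

theorem exists_arc (h : IsSolXY α x y) (hne : ∀ t, y t = 0 → x t ≠ 0) {a b : ℝ} (hab : a < b)
    (ha : y a = 0) (hb : y b = 0) (hpos : ∀ t ∈ Ioo a b, 0 < y t) :
    ∃ f, Arc (-α) (x a) (x b) f := by
  have hmono : StrictMonoOn x (Icc a b) := strictMonoOn_of_deriv_pos (convex_Icc a b)
    h.continuous_fst.continuousOn fun t ht => by
      rw [(h t).1.deriv]
      exact hpos t (by rwa [interior_Icc] at ht)
  have hxab : x a < x b := hmono (left_mem_Icc.2 hab.le) (right_mem_Icc.2 hab.le) hab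
  have hmaps : ∀ t : Icc a b, x t ∈ Icc (x a) (x b) := fun t =>
    ⟨hmono.monotoneOn (left_mem_Icc.2 hab.le) t.2 t.2.1,
      hmono.monotoneOn t.2 (right_mem_Icc.2 hab.le) t.2.2⟩
  let e : Icc a b ≃o Icc (x a) (x b) := StrictMono.orderIsoOfSurjective
    (fun t => ⟨x t, hmaps t⟩) (fun s t hst => hmono s.2 t.2 hst) fun X => by
      obtain ⟨t, ht, htX⟩ := intermediate_value_Icc hab.le h.continuous_fst.continuousOn X.2
      exact ⟨⟨t, ht⟩, Subtype.ext htX⟩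
  have he : ∀ t, (e t : ℝ) = x t := fun t => rfl
  set g : ℝ → ℝ := fun X => e.symm (projIcc (x a) (x b) hxab.le X) with hg
  have hgc : Continuous g :=
    continuous_subtype_val.comp (e.symm.continuous.comp continuous_projIcc)
  have hxg : ∀ X ∈ Icc (x a) (x b), x (g X) = X := fun X hX => by
    rw [hg, ← he, e.apply_symm_apply, projIcc_of_mem _ hX]
  have hg_mem : ∀ X, g X ∈ Icc a b := fun X => (e.symm _).2
  have hg_left : ∀ X ≤ x a, g X = a := fun X hX => by
    refine hmono.injOn (hg_mem X) (left_mem_Icc.2 hab.le) ?_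
    rw [hg, ← he, e.apply_symm_apply, projIcc_of_le_left _ hX]
  have hg_right : ∀ X, x b ≤ X → g X = b := fun X hX => by
    refine hmono.injOn (hg_mem X) (right_mem_Icc.2 hab.le) ?_
    rw [hg, ← he, e.apply_symm_apply, projIcc_of_right_le _ hX]
  have hg_Ioo : ∀ X ∈ Ioo (x a) (x b), g X ∈ Ioo a b := fun X hX => by
    have h1 := hxg X (Ioo_subset_Icc_self hX)
    refine ⟨lt_of_le_of_ne (hg_mem X).1 fun h2 => ?_, lt_of_le_of_ne (hg_mem X).2 fun h2 => ?_⟩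
    · rw [← h2] at h1
      exact hX.1.ne h1
    · rw [h2] at h1
      exact hX.2.ne' h1
  refine ⟨fun X => y (g X), ?_, ?_, h.continuous_snd.comp hgc,
    fun X hX => by rw [hg_left X hX, ha], fun X hX => by rw [hg_right X hX, hb],
    fun X hX => hpos _ (hg_Ioo X hX), fun X hX => ?_⟩
  · by_contra! h0
    have hxa : 0 < x a := lt_of_le_of_ne h0 (hne a ha).symm
    have h1 := ((eventually_mul_neg_of_hasDerivAt (h a).2
      (by rw [ha]; have := pow_pos hxa 3; linarith) ha).filter_mono
      (nhdsWithin_mono a fun s (hs : s ∈ Ioi a) => (mem_Ioi.1 hs).ne')).and (Ioo_mem_nhdsGT hab)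
    obtain ⟨s, hs, hsm⟩ := h1.exists
    exact absurd hs (mul_pos (sub_pos.2 hsm.1) (hpos s hsm)).le.not_gt
  · by_contra! h0
    have hxb : x b < 0 := lt_of_le_of_ne h0 (hne b hb)
    have h1 := ((eventually_mul_neg_of_hasDerivAt (h b).2.neg
      (by rw [hb]; have := Odd.pow_neg (by decide : Odd 3) hxb; linarith)
      (by simp [hb])).filter_mono
      (nhdsWithin_mono b fun s (hs : s ∈ Iio b) => (mem_Iio.1 hs).ne)).and (Ioo_mem_nhdsLT hab)
    obtain ⟨s, hs, hsm⟩ := h1.exists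
    simp only [Pi.neg_apply] at hs
    linarith [mul_pos (sub_pos.2 hsm.2) (hpos s hsm)]
  · have h1 := hpos _ (hg_Ioo X hX)
    have h2 : HasDerivAt g (y (g X))⁻¹ X := HasDerivAt.of_local_left_inverse hgc.continuousAt
      (h (g X)).1 h1.ne' (by
        filter_upwards [Icc_mem_nhds hX.1 hX.2] with Z hZ using hxg Z hZ)
    refine ((h (g X)).2.comp X h2).congr_deriv ?_
    rw [hxg X (Ioo_subset_Icc_self hX)]
    ring

theorem exists_symm_arc_of_abs_le (h : IsSolXY α x y) (hp : IsPeriodicSol x y)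
    (hne : ∀ t, y t = 0 → x t ≠ 0) {τ : ℝ} (hτ : ∀ t, |x t| ≤ x τ) :
    ∃ r f, Arc (-α) (-r) r f ∧ (∃ t, x t = -r ∧ y t = 0) ∧ ∃ t, x t = r ∧ y t = 0 := by
  obtain ⟨T, hT, hper⟩ := hp
  have hy : y τ = 0 :=
    IsLocalMax.hasDerivAt_eq_zero (.of_forall fun t => (le_abs_self _).trans (hτ t)) (h τ).1
  have hx : 0 < x τ := lt_of_le_of_ne ((abs_nonneg _).trans (hτ τ)) (hne τ hy).symm
  have hd : -(x τ) ^ 3 + α * (x τ) ^ 2 * y τ + (y τ) ^ 3 < 0 := by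
    rw [hy]
    linarith [pow_pos hx 3]
  obtain ⟨c, hc, hyc, hpos⟩ := exists_zero_pos_Ioo h.continuous_snd (h τ).2 hd hy
    (sub_lt_self τ hT) (by rw [← (hper (τ - T)).2, sub_add_cancel, hy])
  obtain ⟨f, hf⟩ := h.exists_arc hne hc hyc hy hpos
  obtain ⟨c', hc', hyc', hpos'⟩ := exists_zero_pos_Ioo (y := fun s => -y (-s)) (b := -τ)
    (a := -τ - T) (by have := h.continuous_snd; fun_prop)
    (((HasDerivAt.comp (-τ) (by rw [neg_neg]; exact (h τ).2) (hasDerivAt_neg (-τ))).neg).congr_deriv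
      (by ring : _ = -(x τ) ^ 3 + α * (x τ) ^ 2 * y τ + (y τ) ^ 3)) hd (by simp [hy])
    (by linarith)
    (by rw [show -(-τ - T) = τ + T by ring, (hper τ).2, hy, neg_zero])
  obtain ⟨f', hf'⟩ := h.neg.exists_arc (a := τ) (b := -c')
    (fun t ht => neg_ne_zero.2 (hne t (neg_eq_zero.1 ht))) (by linarith) (by simp [hy]) hyc'
    (fun t ht => by simpa using hpos' (-t) ⟨by linarith [ht.2], by linarith [ht.1]⟩)
  have hxc : x c = -x τ := by
    by_contra h1
    have h2 := neg_le_of_abs_le (hτ c)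
    have h3 := (hf.lt_of_lt hf' (lt_of_le_of_ne h2 (Ne.symm h1))).1
    have h4 := neg_le_of_abs_le (hτ (-c'))
    linarith
  rw [hxc] at hf
  exact ⟨x τ, f, hf, ⟨c, hxc, hyc⟩, τ, rfl, hy⟩

/-- A nonconstant periodic orbit contains a symmetric arc. -/
theorem exists_symm_arc (h : IsSolXY α x y) (hp : IsPeriodicSol x y) (hn : NonconstSol x y) :
    ∃ r f, Arc (-α) (-r) r f ∧ (∃ t, x t = -r ∧ y t = 0) ∧ ∃ t, x t = r ∧ y t = 0 := by
  have hne := h.ne_zero hn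
  obtain ⟨T, hT, hper⟩ := id hp
  obtain ⟨τ, -, hτ⟩ := (isCompact_Icc (a := (0 : ℝ)) (b := T)).exists_isMaxOn
    (nonempty_Icc.2 hT.le) h.continuous_fst.abs.continuousOn
  have hmax : ∀ t, |x t| ≤ |x τ| := fun t => by
    obtain ⟨s, hs, hst⟩ := Function.Periodic.exists_mem_Ico₀ (fun t => (hper t).1 :
      Function.Periodic x T) hT t
    rw [hst]
    exact hτ (Ico_subset_Icc_self hs)
  rcases le_or_gt 0 (x τ) with h0 | h0
  · exact h.exists_symm_arc_of_abs_le hp hne fun t => (hmax t).trans_eq (abs_of_nonneg h0)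
  · obtain ⟨r, f, hf, ⟨t, ht, ht'⟩, s, hs, hs'⟩ := h.neg.exists_symm_arc_of_abs_le
      ⟨T, hT, fun t => ⟨congrArg Neg.neg (hper t).1, congrArg Neg.neg (hper t).2⟩⟩
      (fun t ht => neg_ne_zero.2 (hne t (neg_eq_zero.1 ht)))
      fun t => (abs_neg (x t)).trans_le ((hmax t).trans_eq (abs_of_neg h0))
    exact ⟨r, f, hf, ⟨s, by linarith, by linarith⟩, t, by linarith, by linarith⟩

end IsSolXY

theorem Arc.not_radius_lt {α r₁ r₂ : ℝ} {f₁ f₂ : ℝ → ℝ} (hf₁ : Arc (-α) (-r₁) r₁ f₁) (hα : α < 0)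
    (hα' : (-α) ^ 3 < 27 / 2) (hf₂ : Arc (-α) (-r₂) r₂ f₂) : ¬ r₁ < r₂ :=
  fun hr => Arc.false_of_lt (neg_pos.2 hα) hα' hf₁ hf₂ hr fun x hx =>
    ((hf₁.lt_of_lt hf₂ (neg_lt_neg hr)).2 x hx).le

/-- For `-3/2^(1/3) < α < 0`, the system `ẋ = y`, `ẏ = -x³ + αx²y + y³` has at most one limit
cycle: any two nonconstant periodic solutions have the same image in `ℝ²`. -/
theorem at_most_one_limit_cycle (α : ℝ)
    (h₁ : -3 / (2 : ℝ) ^ ((1 : ℝ) / 3) < α) (h₂ : α < 0) :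
    ∀ x₁ y₁ x₂ y₂ : ℝ → ℝ,
      IsSolXY α x₁ y₁ → IsPeriodicSol x₁ y₁ → NonconstSol x₁ y₁ →
      IsSolXY α x₂ y₂ → IsPeriodicSol x₂ y₂ → NonconstSol x₂ y₂ →
      Set.range (fun t => (x₁ t, y₁ t)) = Set.range (fun t => (x₂ t, y₂ t)) := by
  have hα : (-α) ^ 3 < 27 / 2 := by
    have hc : 0 < (2 : ℝ) ^ ((1 : ℝ) / 3) := by positivity
    have hc3 : ((2 : ℝ) ^ ((1 : ℝ) / 3)) ^ 3 = 2 := by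
      rw [← Real.rpow_natCast, ← Real.rpow_mul (by norm_num)]
      norm_num
    rw [div_lt_iff₀ hc] at h₁
    have h3 : (-α * (2 : ℝ) ^ ((1 : ℝ) / 3)) ^ 3 < 3 ^ 3 :=
      pow_lt_pow_left₀ (by linarith) (mul_nonneg (by linarith) hc.le) (by norm_num)
    rw [mul_pow, hc3] at h3
    linarith
  intro x₁ y₁ x₂ y₂ hs₁ hp₁ hn₁ hs₂ hp₂ hn₂
  obtain ⟨r₁, f₁, hf₁, ⟨t₁, hx₁, hy₁⟩, -⟩ := hs₁.exists_symm_arc hp₁ hn₁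
  obtain ⟨r₂, f₂, hf₂, ⟨t₂, hx₂, hy₂⟩, -⟩ := hs₂.exists_symm_arc hp₂ hn₂
  have hr : r₁ = r₂ := le_antisymm
    (not_lt.1 (hf₂.not_radius_lt h₂ hα hf₁)) (not_lt.1 (hf₁.not_radius_lt h₂ hα hf₂))
  exact hs₁.range_eq_of_eq hs₂ (by rw [hx₁, hx₂, hr]) (by rw [hy₁, hy₂])
end

section
/- For every real α with −3·((6√3−9)/4)^{1/3} < α < 0, the planar system ẋ = y, ẏ = −x³ + αx²y + y³ has at least one limit cycle, i.e., it admits a nonconstant periodic solution. -/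
open Set Metric
open scoped NNReal Topology

section Barriers

variable {f f' g g' : ℝ → ℝ} {T t₀ t₁ : ℝ}

/-- A function starting below a barrier stays below it, if it is slower than the barrier at
every contact. -/
theorem le_of_deriv_lt_at_contact
    (hf : ∀ t ∈ Icc 0 T, HasDerivWithinAt f (f' t) (Icc 0 T) t)
    (hg : ∀ t ∈ Icc 0 T, HasDerivWithinAt g (g' t) (Icc 0 T) t)
    (h₀ : 0 ≤ t₀) (h₀₁ : t₀ ≤ t₁) (h₁ : t₁ ≤ T) (hfg : f t₀ ≤ g t₀)
    (hc : ∀ t ∈ Ico t₀ t₁, f t = g t → f' t < g' t) : f t₁ ≤ g t₁ := by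
  have hsub : Icc t₀ t₁ ⊆ Icc 0 T := Icc_subset_Icc h₀ h₁
  have hmem : ∀ t ∈ Ico t₀ t₁, Icc 0 T ∈ 𝓝[≥] t := fun t ht ↦
    Icc_mem_nhdsGE_of_mem ⟨h₀.trans ht.1, ht.2.trans_le h₁⟩
  exact image_le_of_deriv_right_lt_deriv_boundary'
    (fun t ht ↦ ((hf t (hsub ht)).continuousWithinAt).mono hsub)
    (fun t ht ↦ (hf t (hsub (Ico_subset_Icc_self ht))).mono_of_mem_nhdsWithin (hmem t ht)) hfg
    (fun t ht ↦ ((hg t (hsub ht)).continuousWithinAt).mono hsub)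
    (fun t ht ↦ (hg t (hsub (Ico_subset_Icc_self ht))).mono_of_mem_nhdsWithin (hmem t ht)) hc
    (right_mem_Icc.2 h₀₁)

theorem le_of_deriv_le
    (hf : ∀ t ∈ Icc 0 T, HasDerivWithinAt f (f' t) (Icc 0 T) t)
    (hg : ∀ t ∈ Icc 0 T, HasDerivWithinAt g (g' t) (Icc 0 T) t)
    (h₀ : 0 ≤ t₀) (h₀₁ : t₀ ≤ t₁) (h₁ : t₁ ≤ T) (hfg : f t₀ ≤ g t₀)
    (hc : ∀ t ∈ Ico t₀ t₁, f' t ≤ g' t) : f t₁ ≤ g t₁ := by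
  have hsub : Icc t₀ t₁ ⊆ Icc 0 T := Icc_subset_Icc h₀ h₁
  have hmem : ∀ t ∈ Ico t₀ t₁, Icc 0 T ∈ 𝓝[≥] t := fun t ht ↦
    Icc_mem_nhdsGE_of_mem ⟨h₀.trans ht.1, ht.2.trans_le h₁⟩
  exact image_le_of_deriv_right_le_deriv_boundary
    (fun t ht ↦ ((hf t (hsub ht)).continuousWithinAt).mono hsub)
    (fun t ht ↦ (hf t (hsub (Ico_subset_Icc_self ht))).mono_of_mem_nhdsWithin (hmem t ht)) hfg
    (fun t ht ↦ ((hg t (hsub ht)).continuousWithinAt).mono hsub)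
    (fun t ht ↦ (hg t (hsub (Ico_subset_Icc_self ht))).mono_of_mem_nhdsWithin (hmem t ht)) hc
    (right_mem_Icc.2 h₀₁)

theorem le_of_deriv_nonneg
    (hf : ∀ t ∈ Icc 0 T, HasDerivWithinAt f (f' t) (Icc 0 T) t)
    (h₀ : 0 ≤ t₀) (h₀₁ : t₀ ≤ t₁) (h₁ : t₁ ≤ T)
    (hc : ∀ t ∈ Ico t₀ t₁, 0 ≤ f' t) : f t₀ ≤ f t₁ :=
  le_of_deriv_le (f := fun _ ↦ f t₀) (f' := fun _ ↦ 0)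
    (fun t _ ↦ hasDerivWithinAt_const t _ _) hf h₀ h₀₁ h₁ le_rfl hc

end Barriers

theorem hasDerivAt_max_zero_sq (y : ℝ) :
    HasDerivAt (fun y : ℝ ↦ max y 0 ^ 2) (2 * max y 0) y := by
  rcases lt_trichotomy y 0 with h | rfl | h
  · rw [max_eq_right h.le, mul_zero]
    refine (hasDerivAt_const y (0 : ℝ)).congr_of_eventuallyEq ?_
    filter_upwards [Iio_mem_nhds h] with z hz
    simp [max_eq_right (mem_Iio.1 hz).le]
  · rw [max_self, mul_zero]
    have : (fun y : ℝ ↦ max y 0 ^ 2) =O[𝓝 0] fun y ↦ ‖y - 0‖ ^ 2 := by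
      refine Asymptotics.IsBigO.of_bound 1 (Filter.Eventually.of_forall fun y ↦ ?_)
      rcases le_total y 0 with h | h <;> simp [h, sq_nonneg]
    exact (this.hasFDerivAt one_lt_two).hasDerivAt.congr_deriv (by simp)
  · rw [max_eq_left h.le]
    refine ((hasDerivAt_pow 2 y).congr_deriv (by simp)).congr_of_eventuallyEq ?_
    filter_upwards [Ioi_mem_nhds h] with z hz
    simp [max_eq_left (mem_Ioi.1 hz).le]

/-- A bounded Lipschitz vector field has a flow up to any time, Lipschitz in the initial point. -/
theorem exists_flow_of_lipschitzWith_of_bounded {E : Type*} [NormedAddCommGroup E]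
    [NormedSpace ℝ E] [CompleteSpace E] {F : E → E} {K M : ℝ≥0} (hK : LipschitzWith K F)
    (hM : ∀ z, ‖F z‖ ≤ M) (r : ℝ≥0) {T : ℝ} (hT : 0 ≤ T) :
    ∃ Φ : E → ℝ → E, (∀ z ∈ closedBall (0 : E) r, Φ z 0 = z ∧
      ∀ t ∈ Icc 0 T, HasDerivWithinAt (Φ z) (F (Φ z t)) (Icc 0 T) t) ∧
      ContinuousOn (Φ · T) (closedBall (0 : E) r) := by
  have h := IsPicardLindelof.of_time_independent (f := F) (tmin := 0) (tmax := T)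
    (t₀ := ⟨0, left_mem_Icc.2 hT⟩) (x₀ := (0 : E)) (a := M * T.toNNReal + r) (r := r)
    (fun z _ ↦ hM z) hK.lipschitzOnWith (by simp [hT])
  obtain ⟨Φ, hΦ, L, hL⟩ := h.exists_forall_mem_closedBall_eq_hasDerivWithinAt_lipschitzOnWith
  exact ⟨Φ, hΦ, (hL T (right_mem_Icc.2 hT)).continuousOn⟩

/-- A solution arc of an odd vector field joining a point to its opposite extends to a periodic
solution. -/
theorem exists_periodic_of_odd {E : Type*} [NormedAddCommGroup E] [NormedSpace ℝ E]
    {F : E → E} (hF : ∀ z, F (-z) = -F z) {τ : ℝ} (hτ : 0 < τ) {z : ℝ → E}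
    (hz : ∀ t ∈ Icc 0 τ, HasDerivWithinAt z (F (z t)) (Icc 0 τ) t) (hzτ : z τ = -z 0) :
    ∃ Z : ℝ → E, (∀ t, HasDerivAt Z (F (Z t)) t) ∧ (∀ t, Z (t + 2 * τ) = Z t) ∧
      Z 0 = z 0 ∧ Z τ = z τ := by
  have hF' (n : ℤ) (w : E) : F (n.negOnePow • w) = n.negOnePow • F w := by
    rcases n.even_or_odd with h | h
    · simp [Int.negOnePow_even _ h]
    · simp [Int.negOnePow_odd _ h, hF]
  set Z : ℝ → E := fun t ↦ ⌊t / τ⌋.negOnePow • z (t - ⌊t / τ⌋ * τ) with hZ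
  have hpiece (n : ℤ) (t : ℝ) (ht : t ∈ Icc (n * τ) ((n + 1) * τ)) :
      Z t = n.negOnePow • z (t - n * τ) := by
    rcases ht.2.lt_or_eq with h | rfl
    · have : ⌊t / τ⌋ = n := Int.floor_eq_iff.2 ⟨(le_div_iff₀ hτ).2 ht.1, (div_lt_iff₀ hτ).2 h⟩
      simp only [hZ, this]
    · have : ⌊((n : ℝ) + 1) * τ / τ⌋ = n + 1 := by
        rw [mul_div_cancel_right₀ _ hτ.ne']; exact_mod_cast Int.floor_intCast (n + 1)
      simp only [hZ, this]
      rw [show ((n : ℝ) + 1) * τ - n * τ = τ by ring, hzτ]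
      simp [Int.negOnePow_succ]
  have hderiv (n : ℤ) (t : ℝ) (ht : t ∈ Icc (n * τ) ((n + 1) * τ)) :
      HasDerivWithinAt Z (F (Z t)) (Icc (n * τ) ((n + 1) * τ)) t := by
    have hmaps : MapsTo (fun t ↦ t - n * τ) (Icc (n * τ) ((n + 1) * τ)) (Icc 0 τ) := fun s hs ↦
      ⟨by linarith [hs.1], by linarith [hs.2]⟩
    have h := (hz _ (hmaps ht)).scomp t (((hasDerivWithinAt_id t _).sub_const (n * τ))) hmaps
    rw [one_smul] at h
    have h' := h.const_smul (n.negOnePow : ℤˣ)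
    rw [hpiece n t ht, hF']
    exact h'.congr (fun s hs ↦ hpiece n s hs) (hpiece n t ht)
  refine ⟨Z, fun t ↦ ?_, fun t ↦ ?_, ?_, ?_⟩
  · have h₁ := (le_div_iff₀ hτ).1 (Int.floor_le (t / τ))
    have h₂ := (div_lt_iff₀ hτ).1 (Int.lt_floor_add_one (t / τ))
    have h₃ := (lt_div_iff₀ hτ).1 (show ((⌈t / τ⌉ - 1 : ℤ) : ℝ) < t / τ by
      push_cast; linarith [Int.ceil_lt_add_one (t / τ)])
    have h₄ : t ≤ (((⌈t / τ⌉ - 1 : ℤ) : ℝ) + 1) * τ := by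
      push_cast; linarith [(div_le_iff₀ hτ).1 (Int.le_ceil (t / τ))]
    have hr := (hderiv _ t ⟨h₁, h₂.le⟩).mono_of_mem_nhdsWithin (Icc_mem_nhdsGE_of_mem ⟨h₁, h₂⟩)
    have hl := (hderiv _ t ⟨h₃.le, h₄⟩).mono_of_mem_nhdsWithin (Icc_mem_nhdsLE_of_mem ⟨h₃, h₄⟩)
    simpa using hl.union hr
  · have : ⌊(t + 2 * τ) / τ⌋ = ⌊t / τ⌋ + 2 := by
      rw [add_div, mul_div_cancel_right₀ _ hτ.ne']; exact_mod_cast Int.floor_add_intCast (t / τ) 2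
    simp only [hZ, this]
    rw [Int.negOnePow_add, Int.negOnePow_even 2 even_two, mul_one]
    congr 2
    push_cast
    ring
  · simp [hZ]
  · simpa using hpiece 0 τ (by simp [hτ.le])

theorem bernstein_sum_nonneg {x v : ℝ} (hx : 0 ≤ x) (hv : 0 ≤ v) {c : Fin 10 → ℝ}
    (hc : ∀ i, 0 ≤ c i) : 0 ≤ ∑ i, c i * x ^ (i : ℕ) * v ^ (9 - (i : ℕ)) :=
  Finset.sum_nonneg fun i _ ↦ mul_nonneg (mul_nonneg (hc i) (pow_nonneg hx _)) (pow_nonneg hv _)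

/-- The outer barrier curve is `y = outerBarrier u`. -/
noncomputable def outerBarrier (u : ℝ) : ℝ := (4 - u) * (23 - 12 * u + 15 * u ^ 2) / 100

/-- The derivative of `outerBarrier`. -/
noncomputable def outerBarrierDeriv (u : ℝ) : ℝ := (-71 + 144 * u - 45 * u ^ 2) / 100

theorem hasDerivAt_outerBarrier (u : ℝ) :
    HasDerivAt outerBarrier (outerBarrierDeriv u) u := by
  have h := (((hasDerivAt_id u).const_sub 4).mul ((((hasDerivAt_id u).const_mul 12).const_sub 23).add
    (((hasDerivAt_id u).pow 2).const_mul 15))).div_const 100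
  refine h.congr_deriv ?_
  simp [outerBarrierDeriv]
  ring

theorem outerBarrier_nonneg {u : ℝ} (hu : u ≤ 4) : 0 ≤ outerBarrier u := by
  have : 0 ≤ 23 - 12 * u + 15 * u ^ 2 := by nlinarith [sq_nonneg (5 * u - 2)]
  have : 0 ≤ 4 - u := by linarith
  unfold outerBarrier
  positivity

theorem outerBarrier_le {u : ℝ} (hu : -4 ≤ u) (hu' : u ≤ 4) : outerBarrier u ≤ 25 := by
  unfold outerBarrier
  nlinarith [mul_nonneg (sub_nonneg.2 hu') (neg_le_iff_add_nonneg.1 hu), sq_nonneg u,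
    mul_nonneg (mul_nonneg (sub_nonneg.2 hu') (neg_le_iff_add_nonneg.1 hu)) (sub_nonneg.2 hu')]

theorem outerBarrier_defect_pos {u : ℝ} (hu : -4 ≤ u) (hu' : u ≤ 4) :
    0 < outerBarrier u * outerBarrierDeriv u + outerBarrier u ^ 3
      - 2111 / 1000 * u ^ 2 * outerBarrier u + u ^ 3 := by
  suffices h : 0 ≤ outerBarrier u * outerBarrierDeriv u + outerBarrier u ^ 3
      - 2111 / 1000 * u ^ 2 * outerBarrier u + u ^ 3 - 1 / 1000 by linarith
  unfold outerBarrier outerBarrierDeriv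
  rcases le_total u 0 with h₀ | h₀
  · obtain ⟨w, rfl⟩ : ∃ w, u = -w := ⟨-u, by ring⟩
    have hw : 0 ≤ w := by linarith
    have h₅ : 0 ≤ 7843 / 62500 - 1 / 1000 - 6517 / 250000 * w - 33509 / 50000 * w ^ 2
        - 80199 / 200000 * w ^ 3 + 2619 / 2500 * w ^ 4 + 1543047 / 1000000 * w ^ 5 := by
      nlinarith [mul_nonneg hw (sq_nonneg (w * (w - 47 / 100))), sq_nonneg (w * (w - 47 / 100)),
        mul_nonneg hw (sq_nonneg (w - 47 / 100)), sq_nonneg (w - 47 / 100), hw]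
    have h₉ : 0 ≤ 223857 / 250000 * w ^ 6 + 56241 / 200000 * w ^ 7 + 243 / 5000 * w ^ 8
        + 27 / 8000 * w ^ 9 := by positivity
    linear_combination h₅ + h₉
  rcases le_total u 1 with h₁ | h₁
  · have h := bernstein_sum_nonneg (sub_nonneg.2 h₀) (sub_nonneg.2 h₁)
      (c := ![15561 / 125000, 57323 / 50000, 1004983 / 250000, 6896631 / 1000000, 3262543 / 500000,
        1881913 / 500000, 41991 / 25000, 387707 / 500000, 70483 / 250000, 11343 / 250000])
      (fun i ↦ by fin_cases i <;> norm_num)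
    simp [Fin.sum_univ_succ] at h
    linear_combination h
  rcases le_total u 2 with h₂ | h₂
  · have h := bernstein_sum_nonneg (sub_nonneg.2 h₁) (sub_nonneg.2 h₂)
      (c := ![11343 / 250000, 133691 / 250000, 279807 / 100000, 2022439 / 250000, 6953669 / 500000,
        7313379 / 500000, 9436151 / 1000000, 368051 / 100000, 26967 / 31250, 14339 / 125000])
      (fun i ↦ by fin_cases i <;> norm_num)
    simp [Fin.sum_univ_succ] at h
    linear_combination h
  · have h := bernstein_sum_nonneg (sub_nonneg.2 h₂) (sub_nonneg.2 hu')
      (c := ![14339 / 64000000, 171417 / 64000000, 1308427 / 64000000, 920573 / 8000000,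
        5472399 / 12800000, 1603559 / 1600000, 18782233 / 12800000, 4169517 / 3200000, 813773 / 1280000, 63999 / 512000])
      (fun i ↦ by fin_cases i <;> norm_num)
    simp [Fin.sum_univ_succ] at h
    linear_combination h

/-- The vector field obtained from the original one by the reflection `x ↦ -x` and the reversal of
time. -/
def reversedField (a : ℝ) (z : ℝ × ℝ) : ℝ × ℝ :=
  (z.2, -z.1 ^ 3 + a * z.1 ^ 2 * z.2 - z.2 ^ 3)

/-- Projection to the rectangle `[-4, 4] × [0, 25]`. -/
noncomputable def clamp (z : ℝ × ℝ) : ℝ × ℝ := (max (min z.1 4) (-4), max (min z.2 25) 0)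

theorem clamp_mem (z : ℝ × ℝ) : clamp z ∈ Icc (-4 : ℝ) 4 ×ˢ Icc (0 : ℝ) 25 := by
  refine ⟨⟨le_max_right _ _, ?_⟩, ⟨le_max_right _ _, ?_⟩⟩ <;> simp [clamp]

theorem lipschitzWith_clamp : LipschitzWith 1 clamp := by
  have h₁ := ((LipschitzWith.prod_fst (α := ℝ) (β := ℝ)).min_const 4).max_const (-4)
  have h₂ := ((LipschitzWith.prod_snd (α := ℝ) (β := ℝ)).min_const 25).max_const 0
  simpa [clamp] using! h₁.prodMk h₂

theorem contDiff_reversedField (a : ℝ) : ContDiff ℝ 1 (reversedField a) := by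
  unfold reversedField
  fun_prop

theorem exists_lipschitz_bounded_clamped (a : ℝ) : ∃ K M : ℝ≥0,
    LipschitzWith K (fun z ↦ reversedField a (clamp z)) ∧
      ∀ z, ‖reversedField a (clamp z)‖ ≤ M := by
  have hcpt : IsCompact (Icc (-4 : ℝ) 4 ×ˢ Icc (0 : ℝ) 25) := isCompact_Icc.prod isCompact_Icc
  obtain ⟨K, hK⟩ := (contDiff_reversedField a).locallyLipschitz.locallyLipschitzOn
    |>.exists_lipschitzOnWith_of_compact hcpt
  obtain ⟨M, hM⟩ :=
    hcpt.exists_bound_of_continuousOn (contDiff_reversedField a).continuous.continuousOn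
  refine ⟨K, M.toNNReal, ?_, fun z ↦ (hM _ (clamp_mem z)).trans (Real.le_coe_toNNReal M)⟩
  have := hK.comp (lipschitzWith_clamp.lipschitzOnWith (s := univ)) fun z _ ↦ clamp_mem z
  rw [mul_one, lipschitzOnWith_univ] at this
  exact this

/-- A trajectory on `[0, T]` starting at `(-s, 0)`, of the vector field which agrees with
`reversedField a` in the upper half-plane and moves vertically in the lower half-plane. -/
structure IsArc (a T s : ℝ) (u y : ℝ → ℝ) : Prop where
  hu : ∀ t ∈ Icc 0 T, HasDerivWithinAt u (max (y t) 0) (Icc 0 T) t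
  hy : ∀ t ∈ Icc 0 T, HasDerivWithinAt y
    (-u t ^ 3 + a * u t ^ 2 * max (y t) 0 - max (y t) 0 ^ 3) (Icc 0 T) t
  u_zero : u 0 = -s
  y_zero : y 0 = 0
  neg_four_le : ∀ t ∈ Icc 0 T, -4 ≤ u t
  le_four : ∀ t ∈ Icc 0 T, u t ≤ 4
  y_le : ∀ t ∈ Icc 0 T, y t ≤ 25

theorem IsArc.of_clamped {a T s : ℝ} (ha : a ≤ 2111 / 1000) (hs : 0 ≤ s) (hs' : s ≤ 4)
    {z : ℝ → ℝ × ℝ} (hz₀ : z 0 = (-s, 0))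
    (hz : ∀ t ∈ Icc 0 T, HasDerivWithinAt z (reversedField a (clamp (z t))) (Icc 0 T) t) :
    IsArc a T s (fun t ↦ (z t).1) (fun t ↦ (z t).2) := by
  have hu (t) (ht : t ∈ Icc 0 T) : HasDerivWithinAt (fun t ↦ (z t).1)
      (reversedField a (clamp (z t))).1 (Icc 0 T) t := (hz t ht).fst
  have hy (t) (ht : t ∈ Icc 0 T) : HasDerivWithinAt (fun t ↦ (z t).2)
      (reversedField a (clamp (z t))).2 (Icc 0 T) t := (hz t ht).snd
  set u := fun t ↦ (z t).1 with hu_def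
  set y := fun t ↦ (z t).2 with hy_def
  have hu₀ : u 0 = -s := by simp [hu_def, hz₀]
  have hy₀ : y 0 = 0 := by simp [hy_def, hz₀]
  have hmono {t₀ t₁ : ℝ} (h₀ : 0 ≤ t₀) (h : t₀ ≤ t₁) (h₁ : t₁ ≤ T) : u t₀ ≤ u t₁ :=
    le_of_deriv_nonneg hu h₀ h h₁ fun t _ ↦ (clamp_mem (z t)).2.1
  have hlow (t) (ht : t ∈ Icc 0 T) : -4 ≤ u t := by linarith [hmono le_rfl ht.1 ht.2]
  have hbar (t₁) (ht₁ : t₁ ∈ Icc 0 T) (hut : u t₁ ≤ 4) : y t₁ ≤ outerBarrier (u t₁) := by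
    refine le_of_deriv_lt_at_contact hy
      (fun t ht ↦ (hasDerivAt_outerBarrier (u t)).comp_hasDerivWithinAt t (hu t ht)) le_rfl ht₁.1
      ht₁.2 (by rw [hy₀]; exact outerBarrier_nonneg (by linarith)) fun t ht hc ↦ ?_
    have h₄ : u t ≤ 4 := (hmono ht.1 ht.2.le ht₁.2).trans hut
    have h₄' : -4 ≤ u t := hlow t ⟨ht.1, ht.2.le.trans ht₁.2⟩
    have hc₁ : (clamp (z t)).1 = u t := by
      change max (min (u t) 4) (-4) = u t
      rw [min_eq_left h₄, max_eq_left h₄']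
    have hc₂ : (clamp (z t)).2 = outerBarrier (u t) := by
      change max (min (y t) 25) 0 = _
      rw [hc, Function.comp_apply, min_eq_left (outerBarrier_le h₄' h₄),
        max_eq_left (outerBarrier_nonneg h₄)]
    simp only [reversedField, hc₁, hc₂]
    have := mul_le_mul_of_nonneg_right ha (mul_nonneg (sq_nonneg (u t)) (outerBarrier_nonneg h₄))
    linarith [outerBarrier_defect_pos h₄' h₄]
  have hupp (t) (ht : t ∈ Icc 0 T) : u t ≤ 4 := by
    by_contra! hlt
    obtain ⟨t₁, ht₁, hut₁⟩ : ∃ t₁ ∈ Icc 0 t, u t₁ = 4 :=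
      intermediate_value_Icc ht.1 (fun r hr ↦ (hu r ⟨hr.1, hr.2.trans ht.2⟩).continuousWithinAt.mono
        (Icc_subset_Icc_right ht.2)) ⟨by linarith, hlt.le⟩
    have hneg {r : ℝ} (hr : t₁ ≤ r) (hr' : r ≤ t) : y r ≤ 0 := by
      refine le_of_deriv_lt_at_contact hy (g := fun _ ↦ 0) (g' := fun _ ↦ 0)
        (fun t _ ↦ hasDerivWithinAt_const t _ _) ht₁.1 hr (hr'.trans ht.2) ?_ fun q hq hc ↦ ?_
      · refine (hbar t₁ ⟨ht₁.1, ht₁.2.trans ht.2⟩ hut₁.le).trans_eq ?_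
        simp [hut₁, outerBarrier]
      · have hc₁ : (clamp (z q)).1 = 4 := by
          have : 4 ≤ u q := hut₁ ▸ hmono ht₁.1 hq.1 ((hq.2.le.trans hr').trans ht.2)
          change max (min (u q) 4) (-4) = 4
          rw [min_eq_right this]; norm_num
        have hc₂ : (clamp (z q)).2 = 0 := by
          change max (min (y q) 25) 0 = 0
          rw [hc]; norm_num
        simp only [reversedField, hc₁, hc₂]
        norm_num
    have : u t ≤ 4 := by
      refine le_of_deriv_le hu (g := fun _ ↦ 4) (g' := fun _ ↦ 0)
        (fun t _ ↦ hasDerivWithinAt_const t _ _) ht₁.1 ht₁.2 ht.2 hut₁.le fun q hq ↦ ?_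
      have : min (y q) 25 ≤ 0 := (min_le_left _ _).trans (hneg hq.1 hq.2.le)
      change max (min (y q) 25) 0 ≤ 0
      rw [max_eq_right this]
    linarith
  have hy25 (t) (ht : t ∈ Icc 0 T) : y t ≤ 25 :=
    (hbar t ht (hupp t ht)).trans (outerBarrier_le (hlow t ht) (hupp t ht))
  have hclamp (t) (ht : t ∈ Icc 0 T) : clamp (z t) = (u t, max (y t) 0) := by
    change (max (min (u t) 4) (-4), max (min (y t) 25) 0) = _
    rw [min_eq_left (hupp t ht), max_eq_left (hlow t ht), min_eq_left (hy25 t ht)]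
  exact ⟨fun t ht ↦ by simpa [hclamp t ht, reversedField] using hu t ht,
    fun t ht ↦ by simpa [hclamp t ht, reversedField] using hy t ht, hu₀, hy₀, hlow, hupp, hy25⟩

theorem lyapunov_deriv_nonneg {a v w : ℝ} (ha : 0 < a) (ha' : a ≤ 2111 / 1000)
    (hv : v ^ 2 ≤ (a / 30) ^ 2) (hw : w ^ 2 ≤ (a / 30) ^ 2) :
    0 ≤ a / 2 * (v ^ 2 * w ^ 2) + a / 6 * v ^ 6 + w ^ 4 - a ^ 2 / 6 * (v ^ 5 * w) -
      6 * (v ^ 4 * w ^ 2) + 37 * a / 6 * (v ^ 3 * w ^ 3) - 6 * (v * w ^ 5) := by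
  have hr : (a / 30) ^ 2 ≤ a / 426 := by nlinarith
  have hv' : v ^ 2 ≤ a / 426 := hv.trans hr
  have hw' : w ^ 2 ≤ a / 426 := hw.trans hr
  have h₁ : a / 12 * (v ^ 4 * (v - a * w) ^ 2) ≥ 0 := by positivity
  have h₂ : (v ^ 2 * w ^ 2) * v ^ 2 ≤ (v ^ 2 * w ^ 2) * (a / 426) := by gcongr
  have h₃ : a ^ 3 / 12 + 6 ≤ 7 := by
    have : a ^ 3 ≤ (2111 / 1000) ^ 3 := by gcongr
    linarith
  have h₄ : (a ^ 3 / 12 + 6) * (v ^ 4 * w ^ 2) ≤ 7 * (v ^ 4 * w ^ 2) := by gcongr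
  have hvw : -(a / 426) ≤ v * w := by nlinarith [sq_nonneg (v + w)]
  have h₅ : (v ^ 2 * w ^ 2) * (-(a / 426)) ≤ (v ^ 2 * w ^ 2) * (v * w) := by gcongr
  have h₆ : 37 * a / 6 * ((v ^ 2 * w ^ 2) * (-(a / 426))) ≤
      37 * a / 6 * ((v ^ 2 * w ^ 2) * (v * w)) := by gcongr
  have h₇ : a * (a * (v ^ 2 * w ^ 2)) ≤ 2111 / 1000 * (a * (v ^ 2 * w ^ 2)) := by gcongr
  have h₈ : v * w ≤ a / 426 := by nlinarith [sq_nonneg (v - w)]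
  have h₉ : w ^ 4 * (v * w) ≤ w ^ 4 * (a / 426) := by gcongr
  have h₁₀ : w ^ 4 * a ≤ w ^ 4 * (2111 / 1000) := by gcongr
  have h₁₁ : 0 ≤ a * (v ^ 2 * w ^ 2) := by positivity
  have h₁₂ : 0 ≤ w ^ 4 := by positivity
  have h₁₃ : 0 ≤ a * v ^ 6 := by positivity
  linarith

namespace IsArc

variable {a T s t t₀ t₁ : ℝ} {u y : ℝ → ℝ}

theorem u_mono (h : IsArc a T s u y) (h₀ : 0 ≤ t₀) (h₀₁ : t₀ ≤ t₁) (h₁ : t₁ ≤ T) :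
    u t₀ ≤ u t₁ :=
  le_of_deriv_nonneg h.hu h₀ h₀₁ h₁ fun _ _ ↦ le_max_right _ _

theorem hasDerivWithinAt_energy (h : IsArc a T s u y) (ht : t ∈ Icc 0 T) :
    HasDerivWithinAt (fun t ↦ max (y t) 0 ^ 2 / 2 + u t ^ 4 / 4)
      (a * u t ^ 2 * max (y t) 0 ^ 2 - max (y t) 0 ^ 4) (Icc 0 T) t := by
  have h₁ := ((hasDerivAt_max_zero_sq (y t)).comp_hasDerivWithinAt t (h.hy t ht)).div_const 2
  have h₂ := ((h.hu t ht).pow 4).div_const 4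
  refine (h₁.add h₂).congr_deriv ?_
  push_cast
  ring

theorem hasDerivWithinAt_energy_mul_exp (h : IsArc a T s u y) (k : ℝ) (ht : t ∈ Icc 0 T) :
    HasDerivWithinAt (fun t ↦ (max (y t) 0 ^ 2 / 2 + u t ^ 4 / 4) * Real.exp (k * u t))
      ((a * u t ^ 2 * max (y t) 0 ^ 2 - max (y t) 0 ^ 4 +
        k * max (y t) 0 * (max (y t) 0 ^ 2 / 2 + u t ^ 4 / 4)) * Real.exp (k * u t))
      (Icc 0 T) t := by
  refine ((h.hasDerivWithinAt_energy ht).mul ((h.hu t ht).const_mul k).exp).congr_deriv ?_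
  ring

theorem energy_ge (h : IsArc a T s u y) (ha : 0 ≤ a) (hs' : s ≤ 4) (ht : t ∈ Icc 0 T) :
    s ^ 4 / 4 * Real.exp (-400) ≤ max (y t) 0 ^ 2 / 2 + u t ^ 4 / 4 := by
  have hmono := le_of_deriv_nonneg
    (fun t ht ↦ h.hasDerivWithinAt_energy_mul_exp 50 ht) le_rfl ht.1 ht.2 fun r hr ↦ by
      have hp : max (y r) 0 ≤ 25 := max_le (h.y_le r ⟨hr.1, hr.2.le.trans ht.2⟩) (by norm_num)
      have hp₀ : 0 ≤ max (y r) 0 := le_max_right _ _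
      generalize max (y r) 0 = p at hp hp₀
      refine mul_nonneg ?_ (Real.exp_pos _).le
      have h₁ : 0 ≤ a * u r ^ 2 * p ^ 2 := by positivity
      have h₂ : 0 ≤ p * u r ^ 4 := by positivity
      nlinarith [mul_nonneg (pow_nonneg hp₀ 3) (sub_nonneg.2 hp)]
  simp only [h.u_zero, h.y_zero, max_self] at hmono
  have h₁ : Real.exp (50 * -s) ≥ Real.exp (-200) := Real.exp_le_exp.2 (by linarith)
  have h₂ : Real.exp (50 * u t) ≤ Real.exp 200 := Real.exp_le_exp.2 (by linarith [h.le_four t ht])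
  have h₃ : Real.exp (-400) * Real.exp 200 = Real.exp (-200) := by
    rw [← Real.exp_add]; norm_num
  have h₄ : 0 ≤ max (y t) 0 ^ 2 / 2 + u t ^ 4 / 4 := by positivity
  refine le_of_mul_le_mul_right ?_ (Real.exp_pos 200)
  calc s ^ 4 / 4 * Real.exp (-400) * Real.exp 200 = s ^ 4 / 4 * Real.exp (-200) := by
        rw [mul_assoc, h₃]
    _ ≤ s ^ 4 / 4 * Real.exp (50 * -s) := by gcongr
    _ = (0 ^ 2 / 2 + (-s) ^ 4 / 4) * Real.exp (50 * -s) := by ring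
    _ ≤ _ := hmono
    _ ≤ _ := by gcongr

theorem energy_le (h : IsArc a T s u y) (ha : 0 ≤ a) (ha' : a ≤ 2111 / 1000) (hs' : s ≤ 4)
    (ht : t ∈ Icc 0 T) :
    max (y t) 0 ^ 2 / 2 + u t ^ 4 / 4 ≤ s ^ 4 / 4 * Real.exp 68 := by
  have hmono := le_of_deriv_le
    (fun t ht ↦ h.hasDerivWithinAt_energy_mul_exp (-4 * a) ht)
    (fun t _ ↦ hasDerivWithinAt_const t _ _) le_rfl ht.1 ht.2 le_rfl fun r hr ↦ by
      have hp₀ : 0 ≤ max (y r) 0 := le_max_right _ _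
      generalize max (y r) 0 = p at hp₀
      refine mul_nonpos_of_nonpos_of_nonneg ?_ (Real.exp_pos _).le
      have h₁ : 0 ≤ a * p * ((p - u r ^ 2) ^ 2 + p ^ 2 + p * u r ^ 2) := by positivity
      nlinarith [pow_nonneg hp₀ 4]
  simp only [h.u_zero, h.y_zero, max_self] at hmono
  have h₁ : Real.exp (-4 * a * -s) ≤ Real.exp 34 := Real.exp_le_exp.2 (by nlinarith)
  have h₂ : Real.exp (-34) ≤ Real.exp (-4 * a * u t) :=
    Real.exp_le_exp.2 (by nlinarith [h.le_four t ht])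
  have h₃ : Real.exp 68 * Real.exp (-34) = Real.exp 34 := by
    rw [← Real.exp_add]; norm_num
  have h₄ : 0 ≤ max (y t) 0 ^ 2 / 2 + u t ^ 4 / 4 := by positivity
  refine le_of_mul_le_mul_right ?_ (Real.exp_pos (-34))
  calc _ ≤ (max (y t) 0 ^ 2 / 2 + u t ^ 4 / 4) * Real.exp (-4 * a * u t) := by gcongr
    _ ≤ _ := hmono
    _ = s ^ 4 / 4 * Real.exp (-4 * a * -s) := by ring
    _ ≤ s ^ 4 / 4 * Real.exp 34 := by gcongr
    _ = s ^ 4 / 4 * Real.exp 68 * Real.exp (-34) := by rw [mul_assoc, h₃]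

theorem u_ne_zero (h : IsArc a T s u y) (ha : 0 ≤ a) (hs : 0 < s) (hs' : s ≤ 4)
    (ht : t ∈ Icc 0 T) (hy : y t ≤ 0) : u t ≠ 0 := fun h₀ ↦ by
  have := h.energy_ge ha hs' ht
  rw [h₀, max_eq_right hy] at this
  have : 0 < s ^ 4 / 4 * Real.exp (-400) := by positivity
  linarith

theorem u_pos_of_y_neg (h : IsArc a T s u y) (ha : 0 ≤ a) (hs : 0 < s) (hs' : s ≤ 4)
    (ht : t ∈ Icc 0 T) (hy : y t < 0) : 0 < u t := by
  by_contra! hu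
  refine hy.not_ge (le_of_deriv_lt_at_contact (f := fun _ ↦ 0) (f' := fun _ ↦ 0)
    (fun t _ ↦ hasDerivWithinAt_const t _ _) h.hy le_rfl ht.1 ht.2 h.y_zero.ge fun r hr hc ↦ ?_)
  have hr' : r ∈ Icc 0 T := ⟨hr.1, hr.2.le.trans ht.2⟩
  have hneg : u r < 0 := lt_of_le_of_ne ((h.u_mono hr.1 hr.2.le ht.2).trans hu)
    (h.u_ne_zero ha hs hs' hr' hc.ge)
  rw [← hc, max_self]
  nlinarith [pow_pos (neg_pos.2 hneg) 3]

theorem y_neg_of_le (h : IsArc a T s u y) (ha : 0 ≤ a) (hs : 0 < s) (hs' : s ≤ 4)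
    (h₀ : 0 ≤ t₀) (h₀₁ : t₀ ≤ t₁) (h₁ : t₁ ≤ T) (hy : y t₀ < 0) : y t₁ < 0 := by
  refine lt_of_le_of_lt (le_of_deriv_lt_at_contact h.hy (g := fun _ ↦ y t₀) (g' := fun _ ↦ 0)
    (fun t _ ↦ hasDerivWithinAt_const t _ _) h₀ h₀₁ h₁ le_rfl fun r hr hc ↦ ?_) hy
  have hu : 0 < u r := (h.u_pos_of_y_neg ha hs hs' ⟨h₀, h₀₁.trans h₁⟩ hy).trans_le
    (h.u_mono h₀ hr.1 (hr.2.le.trans h₁))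
  rw [hc, max_eq_right hy.le]
  nlinarith [pow_pos hu 3]

/-- An arc leaves the closed upper half-plane within a time controlled by its initial energy. -/
theorem y_end_neg (h : IsArc a T s u y) (ha : 0 ≤ a) (ha' : a ≤ 2111 / 1000) (hs : 0 < s)
    (hs' : s ≤ 4) (hT₀ : 0 ≤ T) (hT : 30000 < s ^ 4 / 50 * Real.exp (-400) * T) : y T < 0 := by
  by_contra! hyT
  have hy {t : ℝ} (ht : t ∈ Icc 0 T) : 0 ≤ y t := by
    by_contra! hlt
    exact hyT.not_gt (h.y_neg_of_le ha hs hs' ht.1 ht.2 le_rfl hlt)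
  set c := s ^ 4 / 50 * Real.exp (-400) with hc
  have hM := le_of_deriv_le (t₁ := T) (f := fun t ↦ c * t - 12000) (f' := fun _ ↦ c)
    (g := fun t ↦ 3000 * u t - u t * y t)
    (fun t _ ↦ ((hasDerivWithinAt_id t _).const_mul c).sub_const _ |>.congr_deriv (mul_one c))
    (fun t ht ↦ ((h.hu t ht).const_mul 3000).sub ((h.hu t ht).mul (h.hy t ht))) le_rfl hT₀ le_rfl
    (by simp only [h.u_zero, h.y_zero]; linarith) fun t ht ↦ by
      have ht' := Ico_subset_Icc_self ht
      have hE := h.energy_ge ha hs' ht'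
      have h₀ := hy ht'
      have h₁ := h.y_le t ht'
      have h₂ := h.neg_four_le t ht'
      have h₃ := h.le_four t ht'
      rw [max_eq_left h₀] at hE ⊢
      generalize u t = v at *
      generalize y t = w at *
      have h₄ : v ^ 3 ≤ 64 := by nlinarith [sq_nonneg (v + 2)]
      have h₅ : w ^ 2 ≤ 25 * w := by nlinarith
      have h₆ : a * v ^ 3 ≤ 136 := by nlinarith
      have h₇ : v ^ 4 = v ^ 2 * v ^ 2 := by ring
      have h₈ : a * v ^ 3 * w ≤ 136 * w := mul_le_mul_of_nonneg_right h₆ h₀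
      have h₉ : -(v * w ^ 3) ≤ 2500 * w := by
        have : w ^ 3 ≤ 625 * w := by nlinarith
        nlinarith [mul_nonneg (pow_nonneg h₀ 3) (neg_le_iff_add_nonneg.1 h₂)]
      nlinarith [sq_nonneg (v ^ 2)]
  have h₁ := h.y_le T (right_mem_Icc.2 hT₀)
  have h₂ := h.neg_four_le T (right_mem_Icc.2 hT₀)
  have h₃ := h.le_four T (right_mem_Icc.2 hT₀)
  nlinarith

/-- The first return of an arc to the horizontal axis. -/
theorem exists_return (h : IsArc a T s u y) (ha : 0 ≤ a) (hs : 0 < s) (hs' : s ≤ 4)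
    (hT₀ : 0 ≤ T) (hyT : y T < 0) :
    ∃ τ ∈ Ioo 0 T, y τ = 0 ∧ u τ = u T ∧ 0 < u T ∧ ∀ t ∈ Icc 0 τ, 0 ≤ y t := by
  have hcont : ContinuousOn y (Icc 0 T) := fun t ht ↦ (h.hy t ht).continuousWithinAt
  have hcpt : IsCompact (Icc 0 T ∩ y ⁻¹' Ici 0) :=
    isCompact_Icc.of_isClosed_subset (hcont.preimage_isClosed_of_isClosed isClosed_Icc isClosed_Ici)
      inter_subset_left
  obtain ⟨τ, ⟨hτ, hyτ⟩, hmax⟩ := hcpt.exists_isGreatest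
    ⟨0, left_mem_Icc.2 hT₀, h.y_zero.ge⟩
  have hyτ : 0 ≤ y τ := hyτ
  have hneg {t : ℝ} (ht : τ < t) (htT : t ≤ T) : y t < 0 := by
    by_contra! hlt
    exact ht.not_ge (hmax ⟨⟨hτ.1.trans ht.le, htT⟩, hlt⟩)
  have hτT : τ < T := hτ.2.lt_of_ne fun h ↦ by rw [h] at hyτ; linarith
  have hyτ₀ : y τ = 0 := by
    obtain ⟨t, ht, hyt⟩ : ∃ t ∈ Icc τ T, y t = 0 :=
      intermediate_value_Icc' hτT.le (hcont.mono (Icc_subset_Icc_left hτ.1)) ⟨hyT.le, hyτ⟩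
    rcases ht.1.eq_or_lt with rfl | hlt
    · exact hyt
    · linarith [hneg hlt ht.2]
  have huT := h.u_pos_of_y_neg ha hs hs' (right_mem_Icc.2 hT₀) hyT
  have huτ : u T ≤ u τ := le_of_deriv_le h.hu (g := fun _ ↦ u τ) (g' := fun _ ↦ 0)
    (fun t _ ↦ hasDerivWithinAt_const t _ _) hτ.1 hτT.le le_rfl le_rfl fun t ht ↦ by
      rcases ht.1.eq_or_lt with rfl | hlt
      · simp [hyτ₀]
      · exact (max_eq_right (hneg hlt ht.2.le).le).le
  have huτ' := huτ.antisymm (h.u_mono hτ.1 hτT.le le_rfl)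
  refine ⟨τ, ⟨hτ.1.lt_of_ne ?_, hτT⟩, hyτ₀, huτ'.symm, huT, fun t ht ↦ ?_⟩
  · rintro rfl
    linarith [h.u_zero]
  · by_contra! hlt
    linarith [h.y_neg_of_le ha hs hs' ht.1 ht.2 hτ.2 hlt]

/-- Small arcs spiral away from the origin. -/
theorem le_u_end (h : IsArc a T s u y) (ha : 0 < a) (ha' : a ≤ 2111 / 1000) (hT₀ : 0 ≤ T)
    (hs : s = a / 30 * Real.exp (-17)) (hyT : y T < 0) : s ≤ u T := by
  have hs₀ : 0 < s := by rw [hs]; positivity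
  have hexp : Real.exp (-17) ≤ 1 := Real.exp_le_one_iff.2 (by norm_num)
  have hs' : s ≤ 4 := by rw [hs]; nlinarith [Real.exp_pos (-17)]
  obtain ⟨τ, hτ, hyτ, huτ, huT, hy⟩ := h.exists_return ha.le hs₀ hs' hT₀ hyT
  have hsmall : s ^ 4 / 4 * Real.exp 68 = (a / 30) ^ 4 / 4 := by
    have : Real.exp (-17) ^ 4 * Real.exp 68 = 1 := by
      rw [← Real.exp_nat_mul, ← Real.exp_add]; norm_num
    rw [hs, mul_pow]
    linear_combination (a / 30) ^ 4 / 4 * this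
  have hV := le_of_deriv_nonneg (f := fun t ↦ max (y t) 0 ^ 2 / 2 + u t ^ 4 / 4
      - a / 6 * (u t ^ 3 * y t) + 2 * (u t * y t ^ 3))
    (fun t ht ↦ ((h.hasDerivWithinAt_energy ht).sub
      ((((h.hu t ht).pow 3).mul (h.hy t ht)).const_mul (a / 6))).add
      (((h.hu t ht).mul ((h.hy t ht).pow 3)).const_mul 2)) le_rfl hτ.1.le hτ.2.le fun t ht ↦ by
      have hE := h.energy_le ha.le ha' hs' (t := t) ⟨ht.1, (ht.2.trans hτ.2).le⟩
      have h₀ := hy t (Ico_subset_Icc_self ht)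
      rw [max_eq_left h₀, hsmall] at hE
      simp only [max_eq_left h₀, Pi.pow_apply]
      generalize u t = v at *
      generalize y t = w at *
      set r := a / 30 with hr
      have hr₀ : 0 < r := by positivity
      have hv : v ^ 2 ≤ r ^ 2 := by
        refine abs_le_of_sq_le_sq' ?_ (sq_nonneg r) |>.2
        nlinarith [sq_nonneg w]
      have hw : w ^ 2 ≤ r ^ 2 := by
        have : r ^ 2 ≤ 1 := by nlinarith
        nlinarith [sq_nonneg (v ^ 2), sq_nonneg (r ^ 2), sq_nonneg r]
      convert lyapunov_deriv_nonneg ha ha' hv hw using 1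
      push_cast
      ring
  simp only [h.u_zero, h.y_zero, hyτ, huτ, max_self] at hV
  refine le_of_pow_le_pow_left₀ (n := 4) (by norm_num) huT.le ?_
  linarith

end IsArc

theorem rpow_bound : 3 * ((6 * Real.sqrt 3 - 9) / 4) ^ ((1 : ℝ) / 3) ≤ 2111 / 1000 := by
  have h₁ : Real.sqrt 3 ≤ 17322 / 10000 := Real.sqrt_le_iff.2 (by norm_num)
  have h₂ : 3 / 2 ≤ Real.sqrt 3 := Real.le_sqrt_of_sq_le (by norm_num)
  have h₃ : ((6 * Real.sqrt 3 - 9) / 4) ^ ((1 : ℝ) / 3) ≤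
      (((2111 / 3000 : ℝ)) ^ 3) ^ ((1 : ℝ) / 3) :=
    Real.rpow_le_rpow (by linarith) (by norm_num; linarith) (by norm_num)
  have h₄ : (((2111 / 3000 : ℝ)) ^ 3) ^ ((1 : ℝ) / 3) = 2111 / 3000 := by
    have := Real.pow_rpow_inv_natCast (x := 2111 / 3000) (n := 3) (by norm_num) (by norm_num)
    simpa using this
  linarith

/-- For `0 < a ≤ 2.111` some trajectory of the reversed system joins a point of the horizontal
axis to its opposite through the upper half-plane. -/
theorem exists_symmetric_arc {a : ℝ} (ha : 0 < a) (ha' : a ≤ 2111 / 1000) :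
    ∃ s τ : ℝ, ∃ z : ℝ → ℝ × ℝ, 0 < s ∧ 0 < τ ∧ z 0 = (-s, 0) ∧ z τ = (s, 0) ∧
      ∀ t ∈ Icc 0 τ, HasDerivWithinAt z (reversedField a (z t)) (Icc 0 τ) t := by
  obtain ⟨K, M, hK, hM⟩ := exists_lipschitz_bounded_clamped a
  set ε := a / 30 * Real.exp (-17) with hε
  have hε₀ : 0 < ε := by positivity
  have hε₄ : ε ≤ 4 := by
    have : Real.exp (-17) ≤ 1 := Real.exp_le_one_iff.2 (by norm_num)
    nlinarith [Real.exp_pos (-17)]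
  set c := ε ^ 4 / 50 * Real.exp (-400) with hc
  have hc₀ : 0 < c := by positivity
  set T := 30001 / c with hT
  have hT₀ : 0 ≤ T := by positivity
  obtain ⟨Φ, hΦ, hcont⟩ := exists_flow_of_lipschitzWith_of_bounded hK hM 4 hT₀
  have hmem {s : ℝ} (hs : s ∈ Icc ε 4) : ((-s, 0) : ℝ × ℝ) ∈ closedBall 0 ((4 : ℝ≥0) : ℝ) := by
    simp [Prod.norm_def, abs_of_pos (hε₀.trans_le hs.1), hs.2]
  have harc {s : ℝ} (hs : s ∈ Icc ε 4) :
      IsArc a T s (fun t ↦ (Φ (-s, 0) t).1) (fun t ↦ (Φ (-s, 0) t).2) :=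
    .of_clamped ha' (hε₀.trans_le hs.1).le hs.2 (hΦ _ (hmem hs)).1 (hΦ _ (hmem hs)).2
  have hend {s : ℝ} (hs : s ∈ Icc ε 4) : (Φ (-s, 0) T).2 < 0 := by
    refine (harc hs).y_end_neg ha.le ha' (hε₀.trans_le hs.1) hs.2 hT₀ ?_
    calc (30000 : ℝ) < c * T := by rw [hT, mul_div_cancel₀ _ hc₀.ne']; norm_num
      _ ≤ _ := by rw [hc]; gcongr; exact hs.1
  have hP : ContinuousOn (fun s : ℝ ↦ (Φ (-s, 0) T).1 - s) (Icc ε 4) :=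
    (continuous_fst.comp_continuousOn (hcont.comp (f := fun s : ℝ ↦ ((-s, 0) : ℝ × ℝ))
      (by fun_prop) fun s hs ↦ hmem hs)).sub continuousOn_id
  have hεm : ε ∈ Icc ε 4 := left_mem_Icc.2 hε₄
  have h₄m : (4 : ℝ) ∈ Icc ε 4 := right_mem_Icc.2 hε₄
  obtain ⟨s, hs, hPs⟩ : ∃ s ∈ Icc ε 4, (Φ (-s, 0) T).1 - s = 0 :=
    intermediate_value_Icc' hε₄ hP
      ⟨sub_nonpos.2 ((harc h₄m).le_four T (right_mem_Icc.2 hT₀)),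
        sub_nonneg.2 ((harc hεm).le_u_end ha ha' hT₀ hε (hend hεm))⟩
  have hs₀ : 0 < s := hε₀.trans_le hs.1
  obtain ⟨τ, hτ, hyτ, huτ, -, hy⟩ := (harc hs).exists_return ha.le hs₀ hs.2 hT₀ (hend hs)
  refine ⟨s, τ, Φ (-s, 0), hs₀, hτ.1, (hΦ _ (hmem hs)).1,
    Prod.ext (huτ.trans (sub_eq_zero.1 hPs)) hyτ, fun t ht ↦ ?_⟩
  have ht' : t ∈ Icc 0 T := ⟨ht.1, ht.2.trans hτ.2.le⟩
  have hclamp : clamp (Φ (-s, 0) t) = Φ (-s, 0) t := by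
    refine Prod.ext ?_ ?_
    · simp only [clamp]
      rw [min_eq_left ((harc hs).le_four t ht'), max_eq_left ((harc hs).neg_four_le t ht')]
    · simp only [clamp]
      rw [min_eq_left ((harc hs).y_le t ht'), max_eq_left (hy t ht)]
  have := (hΦ _ (hmem hs)).2 t ht'
  rw [hclamp] at this
  exact this.mono (Icc_subset_Icc_right hτ.2.le)

/-- For `-3((6√3-9)/4)^(1/3) < α < 0`, the system `ẋ = y`, `ẏ = -x³ + αx²y + y³` has at least
one limit cycle, i.e. it admits a nonconstant periodic solution. -/
theorem exists_limit_cycle (α : ℝ)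
    (h₁ : -3 * ((6 * Real.sqrt 3 - 9) / 4) ^ ((1 : ℝ) / 3) < α) (h₂ : α < 0) :
    ∃ x y : ℝ → ℝ, IsSolXY α x y ∧ IsPeriodicSol x y ∧ NonconstSol x y := by
  obtain ⟨s, τ, z, hs, hτ, hz₀, hzτ, hz⟩ := exists_symmetric_arc (a := -α) (neg_pos.2 h₂)
    (by linarith [rpow_bound])
  obtain ⟨Z, hZ, hper, hZ₀, hZτ⟩ := exists_periodic_of_odd (F := reversedField (-α))
    (fun w ↦ by ext <;> simp [reversedField]; ring) hτ hz (by simp [hz₀, hzτ])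
  refine ⟨fun t ↦ -(Z (-t)).1, fun t ↦ (Z (-t)).2, fun t ↦ ?_, ⟨2 * τ, by positivity, fun t ↦ ?_⟩,
    0, -τ, ?_⟩
  · have h := (hZ (-t)).scomp t (hasDerivAt_neg t)
    have hx : HasDerivAt (fun t ↦ (Z (-t)).1) ((-1 : ℝ) • reversedField (-α) (Z (-t))).1 t := h.fst
    have hy : HasDerivAt (fun t ↦ (Z (-t)).2) ((-1 : ℝ) • reversedField (-α) (Z (-t))).2 t := h.snd
    refine ⟨hx.neg.congr_deriv ?_, hy.congr_deriv ?_⟩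
    · simp [reversedField]
    · simp only [reversedField, Prod.smul_mk, smul_eq_mul]
      ring
  · have := hper (-(t + 2 * τ))
    rw [show -(t + 2 * τ) + 2 * τ = -t by ring] at this
    simp [this]
  · simp only [neg_zero, neg_neg, hZ₀, hZτ, hz₀, hzτ, ne_eq, Prod.mk.injEq, and_true]
    intro h
    linarith
end

section
/- Let μ > 0, let v₁ < 0, and let z₁ > √(−μ·v₁). Define φ : [v₁, +∞) → ℝ by φ(v) = (1/2)·[ z₁ − μ·v₁/z₁ + √( (z₁ + μ·v₁/z₁)² + 4μ·(v − v₁) ) ]. Then φ(v₁) = z₁ and, for every v ≥ v₁, φ(v) > 0, μ·v + φ(v)² > 0, φ is differentiable at v, and φ′(v) = μ·φ(v)/(μ·v + φ(v)²); that is, φ is an explicit solution of the barrier equation dz/dv = μz/(μv + z²) with initial value z₁ at v₁. -/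
/-- Explicit lower-barrier solution: for `μ > 0`, `v₁ < 0` and `z₁ > √(-μv₁)`, the function
`φ(v) = (1/2)[z₁ - μv₁/z₁ + √((z₁ + μv₁/z₁)² + 4μ(v - v₁))]` satisfies `φ(v₁) = z₁` and, for
every `v ≥ v₁`, `φ(v) > 0`, `μv + φ(v)² > 0`, `φ` is differentiable at `v` and
`φ′(v) = μφ(v)/(μv + φ(v)²)`. -/
theorem explicit_barrier_solution (μ v₁ z₁ : ℝ) (hμ : 0 < μ) (hv₁ : v₁ < 0)
    (hz₁ : Real.sqrt (-(μ * v₁)) < z₁)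
    (φ : ℝ → ℝ)
    (hφ : ∀ v : ℝ, φ v = (1 / 2) * (z₁ - μ * v₁ / z₁ +
      Real.sqrt ((z₁ + μ * v₁ / z₁) ^ 2 + 4 * μ * (v - v₁)))) :
    φ v₁ = z₁ ∧ ∀ v : ℝ, v₁ ≤ v →
      0 < φ v ∧ 0 < μ * v + (φ v) ^ 2 ∧
      HasDerivAt φ (μ * φ v / (μ * v + (φ v) ^ 2)) v := by
  have hz : 0 < z₁ := (Real.sqrt_nonneg _).trans_lt hz₁
  have hsq : -(μ * v₁) < z₁ ^ 2 := (Real.sqrt_lt' hz).1 hz₁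
  obtain ⟨a, ha⟩ : ∃ a, a = μ * v₁ / z₁ := ⟨_, rfl⟩
  have haz : a * z₁ = μ * v₁ := by rw [ha]; field_simp
  simp only [← ha] at hφ
  have ha_neg : a < 0 := by rw [ha]; exact div_neg_of_neg_of_pos (mul_neg_of_pos_of_neg hμ hv₁) hz
  have hza : 0 < z₁ + a := by
    refine pos_of_mul_pos_left ?_ hz.le
    linarith [add_mul z₁ a z₁, sq z₁]
  refine ⟨?_, fun v hv => ?_⟩
  · rw [hφ, sub_self, mul_zero, add_zero, Real.sqrt_sq hza.le]
    ring
  have hD : 0 < (z₁ + a) ^ 2 + 4 * μ * (v - v₁) :=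
    add_pos_of_pos_of_nonneg (pow_pos hza 2) (mul_nonneg (by positivity) (sub_nonneg.2 hv))
  have hderiv : HasDerivAt φ (μ / √((z₁ + a) ^ 2 + 4 * μ * (v - v₁))) v := by
    have hlin : HasDerivAt (fun v => (z₁ + a) ^ 2 + 4 * μ * (v - v₁)) (4 * μ) v := by
      simpa using (((hasDerivAt_id v).sub_const v₁).const_mul (4 * μ)).const_add ((z₁ + a) ^ 2)
    rw [funext hφ]
    refine (((hlin.sqrt hD.ne').const_add (z₁ - a)).const_mul (1 / 2)).congr_deriv ?_
    ring
  have hφv := hφ v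
  have hs := Real.sqrt_pos.2 hD
  have hs_sq := Real.sq_sqrt hD.le
  set s := √((z₁ + a) ^ 2 + 4 * μ * (v - v₁))
  have hpos : 0 < φ v := by rw [hφv]; linarith
  -- the first integral `φ - μ v / φ = z₁ - a` in polynomial form
  have hden : μ * v + φ v ^ 2 = φ v * s := by
    rw [hφv]
    linear_combination (-1 / 4) * hs_sq - haz
  refine ⟨hpos, hden ▸ mul_pos hpos hs, ?_⟩
  rwa [hden, mul_comm μ, mul_div_mul_left _ _ hpos.ne']
end
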